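/- Let G be the generalized quaternion (dicyclic) group Q_24 of order 24 (in Mathlib, QuaternionGroup 6), and let ZG denote its integral group ring MonoidAlgebra ℤ Q_24. Then there are exactly 3 isomorphism classes of finitely generated left ZG-modules P that are stably free of rank one, i.e. such that P ⊕ (ZG)^a ≅ (ZG)^(a+1) for some natural number a. -/

import Mathlib

/-!
STATEMENT 0: Over the integral group ring `ℤQ₂₄` of the quaternion group `Q₂₄` of order 24
(`QuaternionGroup 6`), there are exactly 3 isomorphism classes of (finitely generated)
stably free rank one left modules, i.e. modules `P` with `P ⊕ (ℤQ₂₄)^a ≅ (ℤQ₂₄)^(a+1)`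
for some `a : ℕ`.
-/

noncomputable section

open CategoryTheory

/-- The quaternion group of order 24. -/
abbrev Q24 : Type := QuaternionGroup 6

/-- The integral group ring `ℤQ₂₄`. -/
abbrev ZQ24 : Type := MonoidAlgebra ℤ Q24

/-- A `ℤQ₂₄`-module is stably free of rank one if `P ⊕ (ℤQ₂₄)^a ≅ (ℤQ₂₄)^(a+1)` for some
natural number `a`.  (Such a module is automatically finitely generated.) -/
def IsStablyFreeOfRankOne (P : ModuleCat.{0} ZQ24) : Prop :=
  ∃ a : ℕ, Nonempty ((↥P × (Fin a → ZQ24)) ≃ₗ[ZQ24] (Fin (a + 1) → ZQ24))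

namespace SwanQ24

/-! ### Homomorphisms out of quaternion, quadratic and group algebras -/

/-- The ring homomorphism out of a quaternion algebra determined by a homomorphism on scalars
with central image and images of the generators. -/
def quatHom {R E : Type} [CommRing R] [Ring E] {c₁ c₂ c₃ : R} (f : R →+* E) (X Y : E)
    (hf : ∀ r e, f r * e = e * f r) (hX : X * X = f c₁ + f c₂ * X) (hY : Y * Y = f c₃)
    (hYX : Y * X = f c₂ * Y - X * Y) : QuaternionAlgebra R c₁ c₂ c₃ →+* E :=
  letI : Algebra R E := f.toAlgebra' hf
  (QuaternionAlgebra.Basis.liftHom (R := R) (A := E) (c₁ := c₁) (c₂ := c₂) (c₃ := c₃)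
    { i := X, j := Y, k := X * Y
      i_mul_i := by simp only [Algebra.smul_def, mul_one]; exact hX
      j_mul_j := by simp only [Algebra.smul_def, mul_one]; exact hY
      i_mul_j := rfl
      j_mul_i := by simp only [Algebra.smul_def]; exact hYX } : _ →ₐ[R] E).toRingHom

theorem quatHom_apply {R E : Type} [CommRing R] [Ring E] {c₁ c₂ c₃ : R} (f : R →+* E) (X Y : E)
    (hf hX hY hYX) (q : QuaternionAlgebra R c₁ c₂ c₃) :
    quatHom f X Y hf hX hY hYX q
      = f q.re + f q.imI * X + f q.imJ * Y + f q.imK * (X * Y) := by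
  let _ : Algebra R E := f.toAlgebra' hf
  change QuaternionAlgebra.Basis.lift _ q = _
  simp only [QuaternionAlgebra.Basis.lift, Algebra.smul_def]
  rfl

/-- The ring homomorphism out of a quadratic algebra determined by a homomorphism on scalars and
the image of the generator. -/
def quadHom {R E : Type} [CommRing R] [Ring E] {a b : R} (f : R →+* E) (X : E)
    (hf : ∀ r e, f r * e = e * f r) (hX : X * X = f a + f b * X) : QuadraticAlgebra R a b →+* E :=
  letI : Algebra R E := f.toAlgebra' hf
  (QuadraticAlgebra.lift (R := R) (a := a) (b := b) ⟨X, by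
    simp only [Algebra.smul_def, mul_one]; exact hX⟩ : _ →ₐ[R] E).toRingHom

theorem quadHom_apply {R E : Type} [CommRing R] [Ring E] {a b : R} (f : R →+* E) (X : E)
    (hf hX) (q : QuadraticAlgebra R a b) :
    quadHom f X hf hX q = f q.re + f q.im * X := by
  let _ : Algebra R E := f.toAlgebra' hf
  change (QuadraticAlgebra.lift _ : QuadraticAlgebra R a b →ₐ[R] E) q = _
  simp only [QuadraticAlgebra.lift, Equiv.coe_fn_mk, AlgHom.coe_mk, RingHom.coe_mk,
    MonoidHom.coe_mk, OneHom.coe_mk, Algebra.smul_def, mul_one]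
  rfl

/-- The monoid homomorphism out of `Q24` determined by images of the generators. -/
def groupHom {E : Type} [Ring E] (X Y : E) (hX : X ^ 12 = 1) (hY : Y * Y = X ^ 6)
    (hXY : X * Y = Y * X ^ 11) : Q24 →* E where
  toFun g := match g with
    | .a k => X ^ (k : ZMod 12).val
    | .xa k => Y * X ^ (k : ZMod 12).val
  map_one' := by
    change X ^ (0 : ZMod 12).val = 1
    simp
  map_mul' := by
    have key : ∀ m n : ℕ, m % 12 = n % 12 → X ^ m = X ^ n := fun m n h => by
      rw [pow_eq_pow_mod m hX, pow_eq_pow_mod n hX, h]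
    have hswap : ∀ n : ℕ, X ^ n * Y = Y * X ^ (11 * n) := fun n => by
      induction n with
      | zero => simp
      | succ n ih => rw [pow_succ, mul_assoc, hXY, ← mul_assoc, ih, mul_assoc, ← pow_add]; rfl
    rintro (i | i) (j | j)
    · change X ^ ((i + j : ZMod 12)).val = X ^ (i : ZMod 12).val * X ^ (j : ZMod 12).val
      rw [← pow_add]
      exact key _ _ (by rw [ZMod.val_add]; simp)
    · change Y * X ^ ((j - i : ZMod 12)).val = X ^ (i : ZMod 12).val * (Y * X ^ (j : ZMod 12).val)
      rw [← mul_assoc, hswap, mul_assoc, ← pow_add]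
      congr 1
      refine key _ _ ?_
      revert i j; decide
    · change Y * X ^ ((i + j : ZMod 12)).val = Y * X ^ (i : ZMod 12).val * X ^ (j : ZMod 12).val
      rw [mul_assoc, ← pow_add]
      congr 1
      exact key _ _ (by rw [ZMod.val_add]; simp)
    · change X ^ ((6 + j - i : ZMod 12)).val
        = Y * X ^ (i : ZMod 12).val * (Y * X ^ (j : ZMod 12).val)
      rw [mul_assoc, ← mul_assoc (X ^ _) Y, hswap, mul_assoc Y, ← pow_add, ← mul_assoc, hY,
        ← pow_add]
      refine key _ _ ?_
      revert i j; decide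

/-- The ring homomorphism out of `ZQ24` determined by images of the generators. -/
def groupRingHom {E : Type} [Ring E] (X Y : E) (hX : X ^ 12 = 1) (hY : Y * Y = X ^ 6)
    (hXY : X * Y = Y * X ^ 11) : ZQ24 →+* E :=
  (MonoidAlgebra.lift ℤ E Q24 (groupHom X Y hX hY hXY)).toRingHom

theorem groupRingHom_single {E : Type} [Ring E] (X Y : E) (hX : X ^ 12 = 1) (hY : Y * Y = X ^ 6)
    (hXY : X * Y = Y * X ^ 11) (g : Q24) (n : ℤ) :
    groupRingHom X Y hX hY hXY (MonoidAlgebra.single g n)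
      = n * groupHom X Y hX hY hXY g := by
  change MonoidAlgebra.lift ℤ E Q24 (groupHom X Y hX hY hXY) (MonoidAlgebra.single g n) = _
  rw [MonoidAlgebra.lift_single, zsmul_eq_mul]

/-- The generator `x` of order twelve, in the group ring. -/
def gx : ZQ24 := MonoidAlgebra.single (.a 1) 1

/-- The generator `y` of order four, in the group ring. -/
def gy : ZQ24 := MonoidAlgebra.single (.xa 0) 1

@[simp] theorem groupRingHom_gx {E : Type} [Ring E] (X Y : E) (hX hY hXY) :
    groupRingHom X Y hX hY hXY gx = X := by
  rw [gx, groupRingHom_single]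
  change ((1 : ℤ) : E) * X ^ 1 = X
  simp

@[simp] theorem groupRingHom_gy {E : Type} [Ring E] (X Y : E) (hX hY hXY) :
    groupRingHom X Y hX hY hXY gy = Y := by
  rw [gy, groupRingHom_single]
  change ((1 : ℤ) : E) * (Y * X ^ 0) = Y
  simp

theorem single_a (k : ZMod 12) :
    (MonoidAlgebra.single (QuaternionGroup.a k) 1 : ZQ24) = gx ^ k.val := by
  rw [gx, MonoidAlgebra.single_pow, QuaternionGroup.a_one_pow, one_pow]
  congr 2
  exact (ZMod.natCast_zmod_val k).symm

theorem single_xa (k : ZMod 12) :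
    (MonoidAlgebra.single (QuaternionGroup.xa k) 1 : ZQ24) = gy * gx ^ k.val := by
  rw [← single_a, gy, MonoidAlgebra.single_mul_single, QuaternionGroup.xa_mul_a, mul_one, zero_add]

/-- Two ring homomorphisms out of `ZQ24` agreeing on the generators are equal. -/
theorem groupRing_hom_ext {E : Type} [Ring E] {f g : ZQ24 →+* E} (hx : f gx = g gx)
    (hy : f gy = g gy) : f = g := by
  refine MonoidAlgebra.ringHom_ext' ?_ ?_
  · exact RingHom.ext_int _ _
  · ext q
    rcases q with k | k
    · change f (MonoidAlgebra.single _ 1) = g (MonoidAlgebra.single _ 1)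
      erw [single_a]
      rw [map_pow, map_pow, hx]
    · change f (MonoidAlgebra.single _ 1) = g (MonoidAlgebra.single _ 1)
      erw [single_xa]
      rw [map_mul, map_mul, map_pow, map_pow, hx, hy]

instance {R : Type} [DecidableEq R] {a b c : R} : DecidableEq (QuaternionAlgebra R a b c) :=
  fun _ _ => decidable_of_iff' _ QuaternionAlgebra.ext_iff

/-! ### The four vertex rings and the four edge rings -/

/-- `ℤ[√3]`. -/
abbrev RB : Type := QuadraticAlgebra ℤ 3 0
/-- `ℤ[C₂]`. -/
abbrev RO : Type := QuadraticAlgebra ℤ 1 0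
/-- `𝔽₂[C₂]`. -/
abbrev K2 : Type := QuadraticAlgebra (ZMod 2) 1 0
/-- `𝔽₃[C₂]`. -/
abbrev K3 : Type := QuadraticAlgebra (ZMod 3) 1 0

/-- The Lipschitz quaternions. -/
abbrev VA : Type := QuaternionAlgebra ℤ (-1) 0 (-1)
/-- The order `ℤ[ζ₁₂, j]`. -/
abbrev VB : Type := QuaternionAlgebra RB (-1) ⟨0, 1⟩ (-1)
/-- The order with `x² + cx + 1 = 0` and `y² = 1`, over `ℤ[C₂]` with generator `c`. -/
abbrev VO : Type := QuaternionAlgebra RO (-1) ⟨0, -1⟩ 1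
/-- The group ring of the Klein four group. -/
abbrev VZ : Type := QuadraticAlgebra RO 1 0

/-- The quaternion algebra over `𝔽₃`. -/
abbrev EAB : Type := QuaternionAlgebra (ZMod 3) (-1) 0 (-1)
/-- Two by two matrices over `𝔽₂[C₂]`. -/
abbrev EBO : Type := Matrix (Fin 2) (Fin 2) K2
/-- The group ring of the Klein four group over `𝔽₃`. -/
abbrev EOZ : Type := QuadraticAlgebra K3 1 0
/-- The group ring of the Klein four group over `𝔽₂`. -/
abbrev EZA : Type := QuadraticAlgebra K2 1 0

def piA : ZQ24 →+* VA :=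
  groupRingHom ⟨0, 1, 0, 0⟩ ⟨0, 0, 1, 0⟩ (by decide +kernel) (by decide +kernel) (by decide +kernel)

def piB : ZQ24 →+* VB :=
  groupRingHom ⟨0, 1, 0, 0⟩ ⟨0, 0, 1, 0⟩ (by decide +kernel) (by decide +kernel) (by decide +kernel)

def piO : ZQ24 →+* VO :=
  groupRingHom ⟨0, 1, 0, 0⟩ ⟨0, 0, 1, 0⟩ (by decide +kernel) (by decide +kernel) (by decide +kernel)

def piZ : ZQ24 →+* VZ :=
  groupRingHom ⟨⟨0, 1⟩, 0⟩ ⟨0, 1⟩ (by decide +kernel) (by decide +kernel) (by decide +kernel)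

def redB3 : RB →+* ZMod 3 :=
  quadHom (Int.castRingHom (ZMod 3)) 0 (fun _ _ => mul_comm _ _) (by decide +kernel)

def redB2 : RB →+* K2 :=
  quadHom (Int.castRingHom K2) ⟨0, 1⟩ (fun _ _ => mul_comm _ _) (by decide +kernel)

def redO2 : RO →+* K2 :=
  quadHom (Int.castRingHom K2) ⟨0, 1⟩ (fun _ _ => mul_comm _ _) (by decide +kernel)

def redO3 : RO →+* K3 :=
  quadHom (Int.castRingHom K3) ⟨0, 1⟩ (fun _ _ => mul_comm _ _) (by decide +kernel)

def abA : VA →+* EAB :=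
  quatHom (Int.castRingHom EAB) ⟨0, 1, 0, 0⟩ ⟨0, 0, 1, 0⟩ (fun _ _ => Int.cast_comm _ _)
    (by decide +kernel) (by decide +kernel) (by decide +kernel)

def abB : VB →+* EAB :=
  quatHom (quadHom (Int.castRingHom EAB) 0 (fun _ _ => Int.cast_comm _ _) (by decide +kernel))
    ⟨0, 1, 0, 0⟩ ⟨0, 0, 1, 0⟩
    (fun _ _ => by simp only [quadHom_apply, mul_zero, add_zero]; exact Int.cast_comm _ _)
    (by decide +kernel) (by decide +kernel) (by decide +kernel)

def boB : VB →+* EBO :=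
  quatHom ((Matrix.scalar (Fin 2)).comp redB2) !![⟨0, 1⟩, ⟨0, 1⟩; ⟨0, 1⟩, 0] !![1, 1; 0, 1]
    (fun _ _ => Matrix.scalar_comm _ (fun _ => Commute.all _ _) _)
    (by decide +kernel) (by decide +kernel) (by decide +kernel)

/-- The embedding of `VO` in the two by two matrices over `ℤ[C₂]`. -/
def rhoO : VO →+* Matrix (Fin 2) (Fin 2) RO :=
  quatHom (Matrix.scalar (Fin 2)) !![⟨0, 1⟩, ⟨0, -1⟩; ⟨0, 3⟩, ⟨0, -2⟩] !![1, -1; 0, -1]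
    (fun _ _ => Matrix.scalar_comm _ (fun _ => Commute.all _ _) _)
    (by decide +kernel) (by decide +kernel) (by decide +kernel)

def boO : VO →+* EBO := redO2.mapMatrix.comp rhoO

def ozO : VO →+* EOZ :=
  quatHom (quadHom (Int.castRingHom EOZ) ⟨⟨0, 1⟩, 0⟩ (fun _ _ => mul_comm _ _)
      (by decide +kernel)) ⟨⟨0, 1⟩, 0⟩ ⟨0, 1⟩
    (fun _ _ => mul_comm _ _) (by decide +kernel) (by decide +kernel) (by decide +kernel)

def ozZ : VZ →+* EOZ :=
  quadHom (quadHom (Int.castRingHom EOZ) ⟨⟨0, 1⟩, 0⟩ (fun _ _ => mul_comm _ _)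
      (by decide +kernel)) ⟨0, 1⟩ (fun _ _ => mul_comm _ _) (by decide +kernel)

def zaZ : VZ →+* EZA :=
  quadHom (quadHom (Int.castRingHom EZA) ⟨⟨0, 1⟩, 0⟩ (fun _ _ => mul_comm _ _)
      (by decide +kernel)) ⟨0, 1⟩ (fun _ _ => mul_comm _ _) (by decide +kernel)

def zaA : VA →+* EZA :=
  quatHom (Int.castRingHom EZA) ⟨⟨0, 1⟩, 0⟩ ⟨0, 1⟩ (fun _ _ => mul_comm _ _)
    (by decide +kernel) (by decide +kernel) (by decide +kernel)

/-! ### The group ring as an iterated fibre product -/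

theorem abA_piA (r : ZQ24) : abA (piA r) = abB (piB r) := by
  refine RingHom.congr_fun (f := abA.comp piA) (g := abB.comp piB) (groupRing_hom_ext ?_ ?_) r <;>
  · simp only [RingHom.comp_apply, piA, piB, groupRingHom_gx, groupRingHom_gy]
    decide +kernel

theorem boB_piB (r : ZQ24) : boB (piB r) = boO (piO r) := by
  refine RingHom.congr_fun (f := boB.comp piB) (g := boO.comp piO) (groupRing_hom_ext ?_ ?_) r <;>
  · simp only [RingHom.comp_apply, piO, piB, groupRingHom_gx, groupRingHom_gy]
    decide +kernel

theorem ozO_piO (r : ZQ24) : ozO (piO r) = ozZ (piZ r) := by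
  refine RingHom.congr_fun (f := ozO.comp piO) (g := ozZ.comp piZ) (groupRing_hom_ext ?_ ?_) r <;>
  · simp only [RingHom.comp_apply, piO, piZ, groupRingHom_gx, groupRingHom_gy]
    decide +kernel

theorem zaZ_piZ (r : ZQ24) : zaZ (piZ r) = zaA (piA r) := by
  refine RingHom.congr_fun (f := zaZ.comp piZ) (g := zaA.comp piA) (groupRing_hom_ext ?_ ?_) r <;>
  · simp only [RingHom.comp_apply, piA, piZ, groupRingHom_gx, groupRingHom_gy]
    decide +kernel

@[simp] theorem piA_gx : piA gx = ⟨0, 1, 0, 0⟩ := groupRingHom_gx ..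
@[simp] theorem piA_gy : piA gy = ⟨0, 0, 1, 0⟩ := groupRingHom_gy ..
@[simp] theorem piB_gx : piB gx = ⟨0, 1, 0, 0⟩ := groupRingHom_gx ..
@[simp] theorem piB_gy : piB gy = ⟨0, 0, 1, 0⟩ := groupRingHom_gy ..
@[simp] theorem piO_gx : piO gx = ⟨0, 1, 0, 0⟩ := groupRingHom_gx ..
@[simp] theorem piO_gy : piO gy = ⟨0, 0, 1, 0⟩ := groupRingHom_gy ..
@[simp] theorem piZ_gx : piZ gx = ⟨⟨0, 1⟩, 0⟩ := groupRingHom_gx ..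
@[simp] theorem piZ_gy : piZ gy = ⟨0, 1⟩ := groupRingHom_gy ..

def secA (a : VA) : ZQ24 := a.re + a.imI * gx + a.imJ * gy + a.imK * (gx * gy)

theorem piA_secA (a : VA) : piA (secA a) = a := by
  simp only [secA, map_add, map_mul, map_intCast, piA_gx, piA_gy]
  ext <;> simp

/-- A lift of an element of `ℤ[√3]`. -/
def secRB (q : RB) : ZQ24 := q.re + q.im * (gx + gx ^ 11)

theorem piB_secRB (q : RB) : piB (secRB q) = ⟨q, 0, 0, 0⟩ := by
  have h : piB (gx + gx ^ 11) = ⟨⟨0, 1⟩, 0, 0, 0⟩ := by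
    simp only [map_add, map_pow, piB_gx]; decide +kernel
  rw [secRB, map_add, map_mul, h, map_intCast, map_intCast]
  ext <;> simp

def secB (b : VB) : ZQ24 :=
  secRB b.re + secRB b.imI * gx + secRB b.imJ * gy + secRB b.imK * (gx * gy)

theorem piB_secB (b : VB) : piB (secB b) = b := by
  simp only [secB, map_add, map_mul, piB_secRB, piB_gx, piB_gy]
  ext <;> simp

/-- A lift of an element of `ℤ[C₂]`. -/
def secRO (q : RO) : ZQ24 := q.re + q.im * gx ^ 3

theorem piO_secRO (q : RO) : piO (secRO q) = ⟨q, 0, 0, 0⟩ := by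
  have h : piO (gx ^ 3) = ⟨⟨0, 1⟩, 0, 0, 0⟩ := by
    simp only [map_pow, piO_gx]; decide +kernel
  rw [secRO, map_add, map_mul, h, map_intCast, map_intCast]
  ext <;> simp

def secO (b : VO) : ZQ24 :=
  secRO b.re + secRO b.imI * gx + secRO b.imJ * gy + secRO b.imK * (gx * gy)

theorem piO_secO (b : VO) : piO (secO b) = b := by
  simp only [secO, map_add, map_mul, piO_secRO, piO_gx, piO_gy]
  ext <;> simp

def secZ (z : VZ) : ZQ24 :=
  z.re.re + z.re.im * gx + z.im.re * gy + z.im.im * (gx * gy)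

theorem piZ_secZ (z : VZ) : piZ (secZ z) = z := by
  simp only [secZ, map_add, map_mul, map_intCast, piZ_gx, piZ_gy]
  ext <;> simp

theorem abA_apply (a : VA) : abA a = ⟨a.re, a.imI, a.imJ, a.imK⟩ := by
  rw [abA, quatHom_apply]
  ext <;> simp

theorem abB_apply (b : VB) : abB b = ⟨b.re.re, b.imI.re, b.imJ.re, b.imK.re⟩ := by
  rw [abB, quatHom_apply]
  simp only [quadHom_apply]
  ext <;> simp

theorem redO2_apply (q : RO) : redO2 q = ⟨q.re, q.im⟩ := by
  rw [redO2, quadHom_apply]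
  ext <;> simp

theorem redO3_apply (q : RO) : redO3 q = ⟨q.re, q.im⟩ := by
  rw [redO3, quadHom_apply]
  ext <;> simp

theorem redB2_apply (q : RB) : redB2 q = ⟨q.re, q.im⟩ := by
  rw [redB2, quadHom_apply]
  ext <;> simp

theorem ozZ_apply (z : VZ) : ozZ z = ⟨⟨z.re.re, z.re.im⟩, ⟨z.im.re, z.im.im⟩⟩ := by
  rw [ozZ, quadHom_apply]
  simp only [quadHom_apply]
  ext <;> simp

theorem zaZ_apply (z : VZ) : zaZ z = ⟨⟨z.re.re, z.re.im⟩, ⟨z.im.re, z.im.im⟩⟩ := by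
  rw [zaZ, quadHom_apply]
  simp only [quadHom_apply]
  ext <;> simp

theorem rhoO_apply (q : VO) : rhoO q =
    !![q.re + ⟨0, 1⟩ * q.imI + q.imJ + ⟨0, 1⟩ * q.imK, -⟨0, 1⟩ * q.imI - q.imJ;
       3 * (⟨0, 1⟩ * q.imI + ⟨0, 1⟩ * q.imK),
       q.re - 2 * (⟨0, 1⟩ * q.imI) - q.imJ - ⟨0, 1⟩ * q.imK] := by
  rw [rhoO, quatHom_apply]
  have h2 : (2 : RO) = ⟨2, 0⟩ := by decide +kernel
  have h3 : (3 : RO) = ⟨3, 0⟩ := by decide +kernel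
  ext i j <;> fin_cases i <;> fin_cases j <;>
    simp [Matrix.mul_apply, Fin.sum_univ_two, h2, h3] <;> ring

theorem ozO_apply (q : VO) : ozO q =
    ⟨⟨q.re.re + q.imI.im, q.re.im + q.imI.re⟩, ⟨q.imJ.re + q.imK.im, q.imJ.im + q.imK.re⟩⟩ := by
  rw [ozO, quatHom_apply]
  simp only [quadHom_apply]
  ext <;> simp

theorem exists_of_abA_eq_zero {a : VA} (h : abA a = 0) : ∃ a' : VA, a = 3 * a' := by
  rw [abA_apply, QuaternionAlgebra.ext_iff] at h
  obtain ⟨h0, h1, h2, h3⟩ := h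
  simp only [QuaternionAlgebra.re_zero, QuaternionAlgebra.imI_zero, QuaternionAlgebra.imJ_zero,
    QuaternionAlgebra.imK_zero] at h0 h1 h2 h3
  obtain ⟨a0, h0⟩ := (ZMod.intCast_zmod_eq_zero_iff_dvd _ 3).1 h0
  obtain ⟨a1, h1⟩ := (ZMod.intCast_zmod_eq_zero_iff_dvd _ 3).1 h1
  obtain ⟨a2, h2⟩ := (ZMod.intCast_zmod_eq_zero_iff_dvd _ 3).1 h2
  obtain ⟨a3, h3⟩ := (ZMod.intCast_zmod_eq_zero_iff_dvd _ 3).1 h3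
  have h3' : (3 : VA) = ⟨3, 0, 0, 0⟩ := by decide +kernel
  refine ⟨⟨a0, a1, a2, a3⟩, ?_⟩
  rw [h3']
  ext <;> simp [h0, h1, h2, h3]

theorem exists_of_boO_eq_zero {o : VO} (h : boO o = 0) : ∃ o' : VO, o = 2 * o' := by
  have h' : ∀ i j, redO2 (rhoO o i j) = 0 := fun i j => congrFun₂ h i j
  simp only [redO2_apply, rhoO_apply, QuadraticAlgebra.ext_iff] at h'
  have h2 : (2 : RO) = ⟨2, 0⟩ := by decide +kernel
  have h3 : (3 : RO) = ⟨3, 0⟩ := by decide +kernel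
  have e00 := h' 0 0
  have e01 := h' 0 1
  have e10 := h' 1 0
  have e11 := h' 1 1
  simp only [Matrix.of_apply, Matrix.cons_val', Matrix.cons_val_zero, Matrix.cons_val_one,
    Matrix.cons_val_fin_one, h2, h3, QuadraticAlgebra.re_add, QuadraticAlgebra.im_add,
    QuadraticAlgebra.re_sub, QuadraticAlgebra.im_sub, QuadraticAlgebra.re_mul,
    QuadraticAlgebra.im_mul, QuadraticAlgebra.re_neg, QuadraticAlgebra.im_neg,
    QuadraticAlgebra.re_zero, QuadraticAlgebra.im_zero, ZMod.intCast_zmod_eq_zero_iff_dvd]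
    at e00 e01 e10 e11
  have hd : ∃ r : VO, o.re.re = 2 * r.re.re ∧ o.re.im = 2 * r.re.im ∧ o.imI.re = 2 * r.imI.re ∧
      o.imI.im = 2 * r.imI.im ∧ o.imJ.re = 2 * r.imJ.re ∧ o.imJ.im = 2 * r.imJ.im ∧
      o.imK.re = 2 * r.imK.re ∧ o.imK.im = 2 * r.imK.im := by
    refine ⟨⟨⟨o.re.re / 2, o.re.im / 2⟩, ⟨o.imI.re / 2, o.imI.im / 2⟩,
      ⟨o.imJ.re / 2, o.imJ.im / 2⟩, ⟨o.imK.re / 2, o.imK.im / 2⟩⟩, ?_⟩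
    dsimp only
    push_cast at e00 e01 e10 e11
    omega
  obtain ⟨r, hr⟩ := hd
  have h2' : (2 : VO) = ⟨⟨2, 0⟩, 0, 0, 0⟩ := by decide +kernel
  refine ⟨r, ?_⟩
  rw [h2']
  ext <;> simp [hr]

theorem exists_of_red_eq_zero {z : VZ} (h3 : ozZ z = 0) (h2 : zaZ z = 0) :
    ∃ z' : VZ, z = 6 * z' := by
  rw [ozZ_apply] at h3
  rw [zaZ_apply] at h2
  simp only [QuadraticAlgebra.ext_iff, QuadraticAlgebra.re_zero, QuadraticAlgebra.im_zero,
    ZMod.intCast_zmod_eq_zero_iff_dvd] at h2 h3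
  have h6 : (6 : VZ) = ⟨⟨6, 0⟩, 0⟩ := by decide +kernel
  refine ⟨⟨⟨z.re.re / 6, z.re.im / 6⟩, ⟨z.im.re / 6, z.im.im / 6⟩⟩, ?_⟩
  rw [h6]
  push_cast at h2 h3
  ext <;> simp <;> omega

/-- A tuple compatible along all four edges comes from the group ring. -/
theorem exists_of_matched {a : VA} {b : VB} {z : VZ} {o : VO} (hab : abA a = abB b)
    (hbo : boB b = boO o) (hoz : ozO o = ozZ z) (hza : zaZ z = zaA a) :
    ∃ r : ZQ24, piA r = a ∧ piB r = b ∧ piZ r = z ∧ piO r = o := by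
  obtain ⟨a', ha'⟩ := exists_of_abA_eq_zero (a := a - piA (secB b)) (by
    rw [map_sub, abA_piA, piB_secB, hab, sub_self])
  set r₁ := secB b + (gx ^ 4 - gx ^ 2 + 1) * secA a' with hr₁
  have hA : piA (gx ^ 4 - gx ^ 2 + 1) = 3 := by
    simp only [map_add, map_sub, map_pow, map_one, piA_gx]; decide +kernel
  have hB : piB (gx ^ 4 - gx ^ 2 + 1) = 0 := by
    simp only [map_add, map_sub, map_pow, map_one, piB_gx]; decide +kernel
  have h1A : piA r₁ = a := by
    rw [hr₁, map_add, map_mul, hA, piA_secA, ← ha']; abel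
  have h1B : piB r₁ = b := by
    rw [hr₁, map_add, map_mul, hB, zero_mul, add_zero, piB_secB]
  obtain ⟨o', ho'⟩ := exists_of_boO_eq_zero (o := o - piO r₁) (by
    rw [map_sub, ← boB_piB, h1B, hbo, sub_self])
  set r₂ := r₁ + (gx ^ 6 + 1) * secO o' with hr₂
  have h6A : piA (gx ^ 6 + 1) = 0 := by
    simp only [map_add, map_pow, map_one, piA_gx]; decide +kernel
  have h6B : piB (gx ^ 6 + 1) = 0 := by
    simp only [map_add, map_pow, map_one, piB_gx]; decide +kernel
  have h6O : piO (gx ^ 6 + 1) = 2 := by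
    simp only [map_add, map_pow, map_one, piO_gx]; decide +kernel
  have h2A : piA r₂ = a := by rw [hr₂, map_add, map_mul, h6A, zero_mul, add_zero, h1A]
  have h2B : piB r₂ = b := by rw [hr₂, map_add, map_mul, h6B, zero_mul, add_zero, h1B]
  have h2O : piO r₂ = o := by
    rw [hr₂, map_add, map_mul, h6O, piO_secO, ← ho']; abel
  obtain ⟨z', hz'⟩ := exists_of_red_eq_zero (z := z - piZ r₂) (by
    rw [map_sub, ← ozO_piO, h2O, hoz, sub_self]) (by rw [map_sub, zaZ_piZ, h2A, hza, sub_self])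
  refine ⟨r₂ + (gx ^ 6 + 1) * (gx ^ 4 + gx ^ 2 + 1) * secZ z', ?_, ?_, ?_, ?_⟩
  · rw [map_add, map_mul, map_mul, h6A, zero_mul, zero_mul, add_zero, h2A]
  · rw [map_add, map_mul, map_mul, h6B, zero_mul, zero_mul, add_zero, h2B]
  · have h : piZ ((gx ^ 6 + 1) * (gx ^ 4 + gx ^ 2 + 1)) = 6 := by
      simp only [map_add, map_mul, map_pow, map_one, piZ_gx]; decide +kernel
    rw [map_add, map_mul, h, piZ_secZ, ← hz']; abel
  · have h : piO ((gx ^ 6 + 1) * (gx ^ 4 + gx ^ 2 + 1)) = 0 := by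
      simp only [map_add, map_mul, map_pow, map_one, piO_gx]; decide +kernel
    rw [map_add, map_mul, h, zero_mul, add_zero, h2O]

/-- The homomorphism to the product of the vertex rings. -/
def piAll : ZQ24 →+* VA × VB × VZ × VO := piA.prod (piB.prod (piZ.prod piO))

theorem piAll_injective : Function.Injective piAll := by
  let f : ZQ24 →ₗ[ℤ] VA × VB × VZ × VO := piAll.toAddMonoidHom.toIntLinearMap
  have hf : ∀ r, f r = (piA r, piB r, piZ r, piO r) := fun _ => rfl
  have hRB : Module.finrank ℤ RB = 2 := QuadraticAlgebra.finrank_eq_two ..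
  have hRO : Module.finrank ℤ RO = 2 := QuadraticAlgebra.finrank_eq_two ..
  have hA : Module.finrank ℤ VA = 4 := QuaternionAlgebra.finrank_eq_four ..
  have hB : Module.finrank ℤ VB = 8 := by
    rw [← Module.finrank_mul_finrank ℤ RB VB, hRB, QuaternionAlgebra.finrank_eq_four]
  have hO : Module.finrank ℤ VO = 8 := by
    rw [← Module.finrank_mul_finrank ℤ RO VO, hRO, QuaternionAlgebra.finrank_eq_four]
  have hZ : Module.finrank ℤ VZ = 4 := by
    rw [← Module.finrank_mul_finrank ℤ RO VZ, hRO, QuadraticAlgebra.finrank_eq_two]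
  have : Module.Finite ℤ VB := Module.Finite.trans RB VB
  have : Module.Finite ℤ VO := Module.Finite.trans RO VO
  have : Module.Finite ℤ VZ := Module.Finite.trans RO VZ
  have : Module.Free ℤ VB := Module.Free.trans (S := RB)
  have : Module.Free ℤ VO := Module.Free.trans (S := RO)
  have : Module.Free ℤ VZ := Module.Free.trans (S := RO)
  have hW : Module.finrank ℤ (VA × VB × VZ × VO) = 24 := by
    rw [Module.finrank_prod, Module.finrank_prod, Module.finrank_prod, hA, hB, hO, hZ]
  have hR : Module.finrank ℤ ZQ24 = 24 := by
    rw [(MonoidAlgebra.coeffLinearEquiv ℤ).finrank_eq, Module.finrank_finsupp_self,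
      QuaternionGroup.card]
  have : Module.Finite ℤ ZQ24 :=
    Module.Finite.equiv (MonoidAlgebra.coeffLinearEquiv (S := ℤ) (M := Q24) ℤ).symm
  let g : (VA × VB × VZ × VO) →ₗ[ℤ] (VA × VB × VZ × VO) := (12 : ℤ) • LinearMap.id
  have hle : LinearMap.range g ≤ LinearMap.range f := by
    rintro _ ⟨⟨a, b, z, o⟩, rfl⟩
    have hEAB : (12 : EAB) = 0 := by decide +kernel
    have hEBO : (12 : EBO) = 0 := by decide +kernel
    have hEOZ : (12 : EOZ) = 0 := by decide +kernel
    have hEZA : (12 : EZA) = 0 := by decide +kernel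
    obtain ⟨r, hr⟩ := exists_of_matched (a := 12 * a) (b := 12 * b) (z := 12 * z) (o := 12 * o)
      (by rw [map_mul, map_mul, map_ofNat, map_ofNat, hEAB, zero_mul, zero_mul])
      (by rw [map_mul, map_mul, map_ofNat, map_ofNat, hEBO, zero_mul, zero_mul])
      (by rw [map_mul, map_mul, map_ofNat, map_ofNat, hEOZ, zero_mul, zero_mul])
      (by rw [map_mul, map_mul, map_ofNat, map_ofNat, hEZA, zero_mul, zero_mul])
    refine ⟨r, ?_⟩
    rw [hf, hr.1, hr.2.1, hr.2.2.1, hr.2.2.2]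
    simp only [g, zsmul_eq_mul]
    norm_num
  have h1 : Module.finrank ℤ (LinearMap.range g) = 24 := by
    rw [LinearMap.finrank_range_of_inj, hW]
    intro x y hxy
    exact smul_right_injective _ (by norm_num : (12 : ℤ) ≠ 0) hxy
  have h2 := Submodule.finrank_mono hle
  have h3 := (LinearMap.ker f).finrank_quotient_add_finrank
  rw [f.quotKerEquivRange.finrank_eq] at h3
  have h4 : Module.finrank ℤ (LinearMap.ker f) = 0 := by omega
  have h5 : LinearMap.ker f = ⊥ := Submodule.finrank_eq_zero.1 h4
  exact LinearMap.ker_eq_bot.1 h5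

/-- An element of the group ring is determined by its images in the vertex rings. -/
theorem eq_of_pi {r s : ZQ24} (hA : piA r = piA s) (hB : piB r = piB s) (hZ : piZ r = piZ s)
    (hO : piO r = piO s) : r = s :=
  piAll_injective (by simp [piAll, hA, hB, hZ, hO])

/-! ### Stably free modules as kernels of split surjections, and their generators -/

open Matrix

/-- A generator of the kernel of right multiplication by `U`, where `V` is a section of it. -/
structure Frame {S κ ι : Type} [Ring S] [Fintype κ] [DecidableEq κ] [Fintype ι] [DecidableEq ι]
    (V : Matrix κ ι S) (U : Matrix ι κ S) where
  /-- the generator -/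
  gen : ι → S
  /-- the coordinate functional -/
  coord : ι → S
  gen_dot_coord : gen ⬝ᵥ coord = 1
  gen_vecMul : gen ᵥ* U = 0
  mulVec_coord : V *ᵥ coord = 0
  vecMulVec_add : vecMulVec coord gen + U * V = 1

/-- The projection onto the kernel of right multiplication by `U`. -/
def kerProj {S κ ι : Type} [Ring S] [Fintype κ] [DecidableEq κ] [Fintype ι] [DecidableEq ι]
    {V : Matrix κ ι S} {U : Matrix ι κ S} (h : V * U = 1) :
    (ι → S) →ₗ[S] LinearMap.ker U.vecMulLinear :=
  (LinearMap.id - V.vecMulLinear ∘ₗ U.vecMulLinear).codRestrict _ fun x => by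
    simp [vecMul_vecMul, Matrix.mul_assoc, h]

section
variable {S κ ι : Type} [Ring S] [Fintype κ] [DecidableEq κ] [Fintype ι] [DecidableEq ι]
  {V : Matrix κ ι S} {U : Matrix ι κ S}

theorem coe_kerProj (h : V * U = 1) (x : ι → S) : (kerProj h x : ι → S) = x - (x ᵥ* U) ᵥ* V := rfl

theorem kerProj_of_mem (h : V * U = 1) (x : LinearMap.ker U.vecMulLinear) :
    kerProj h (x : ι → S) = x := by
  have hx : (x : ι → S) ᵥ* U = 0 := x.2
  ext1
  rw [coe_kerProj, hx, zero_vecMul, sub_zero]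

/-- The decomposition of a free module given by a split surjection. -/
def kerEquiv (h : V * U = 1) : (LinearMap.ker U.vecMulLinear × (κ → S)) ≃ₗ[S] (ι → S) where
  toFun p := p.1 + p.2 ᵥ* V
  map_add' p q := by simp [add_vecMul]; abel
  map_smul' s p := by simp [smul_vecMul]
  invFun x := (kerProj h x, x ᵥ* U)
  left_inv p := by
    have hp : (p.1 : ι → S) ᵥ* U = 0 := p.1.2
    have h2 : (p.1 + p.2 ᵥ* V : ι → S) ᵥ* U = p.2 := by
      rw [add_vecMul, hp, vecMul_vecMul, h, vecMul_one, zero_add]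
    refine Prod.ext (Subtype.ext ?_) h2
    rw [coe_kerProj, h2, add_sub_cancel_right]
  right_inv x := by
    simp [coe_kerProj]

/-- A generator of the kernel yields a frame. -/
def Frame.ofEquiv (h : V * U = 1) (e : LinearMap.ker U.vecMulLinear ≃ₗ[S] S) : Frame V U := by
  have key : ∀ x : ι → S, x ⬝ᵥ (fun j => e (kerProj h (Pi.single j 1))) = e (kerProj h x) := by
    intro x
    conv_rhs => rw [pi_eq_sum_univ' x]
    simp [dotProduct, map_sum]
  exact
  { gen := (e.symm 1 : LinearMap.ker U.vecMulLinear)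
    coord := fun j => e (kerProj h (Pi.single j 1))
    gen_dot_coord := by rw [key, kerProj_of_mem, LinearEquiv.apply_symm_apply]
    gen_vecMul := (e.symm 1).2
    mulVec_coord := by
      ext i
      change V i ⬝ᵥ _ = 0
      rw [key]
      have : kerProj h (V i) = 0 := by
        have h1 : V i ᵥ* U = Pi.single i 1 := by
          ext j
          change (V * U) i j = _
          rw [h, one_apply, Pi.single_apply]
          simp only [eq_comm]
        ext1
        rw [coe_kerProj, h1, single_one_vecMul]
        exact sub_self _
      rw [this, map_zero]
    vecMulVec_add := by
      ext i j
      have h1 : e (kerProj h (Pi.single i 1)) • (e.symm 1) = kerProj h (Pi.single i 1) := by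
        rw [← map_smul, smul_eq_mul, mul_one, LinearEquiv.symm_apply_apply]
      have h2 := congrFun (congrArg Subtype.val h1) j
      rw [coe_kerProj] at h2
      rw [single_one_vecMul] at h2
      have h3 : (U.row i ᵥ* V) j = (U * V) i j := rfl
      change e (kerProj h (Pi.single i 1)) * (e.symm 1 : LinearMap.ker U.vecMulLinear).1 j
        + (U * V) i j = _
      rw [← h3, ← smul_eq_mul, ← Pi.smul_apply, ← Submodule.coe_smul]
      erw [h2]
      rw [Pi.sub_apply, sub_add_cancel, one_apply, Pi.single_apply]
      simp only [eq_comm] }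

/-- The isomorphism defined by a frame. -/
theorem Frame.dot_smul (F : Frame V U) {x : ι → S} (hx : x ᵥ* U = 0) :
    (x ⬝ᵥ F.coord) • F.gen = x := by
  have h := congrArg (x ᵥ* ·) F.vecMulVec_add
  simp only [vecMul_add, ← vecMul_vecMul, hx, zero_vecMul, add_zero, vecMul_one] at h
  conv_rhs => rw [← h]
  ext j
  simp [vecMul, dotProduct, vecMulVec_apply, Finset.sum_mul, mul_assoc]

/-- The image of a frame under a ring homomorphism. -/
def Frame.map {T : Type} [Ring T] (f : S →+* T) (F : Frame V U) {V' : Matrix κ ι T}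
    {U' : Matrix ι κ T} (hV : V.map f = V') (hU : U.map f = U') : Frame V' U' where
  gen := f ∘ F.gen
  coord := f ∘ F.coord
  gen_dot_coord := by rw [← RingHom.map_dotProduct, F.gen_dot_coord, map_one]
  gen_vecMul := by
    subst hU; ext j; rw [← RingHom.map_vecMul, F.gen_vecMul]; simp
  mulVec_coord := by
    subst hV; ext j; rw [← RingHom.map_mulVec, F.mulVec_coord]; simp
  vecMulVec_add := by
    subst hU hV
    have h := congrArg (fun M => M.map f) F.vecMulVec_add
    simp only [Matrix.map_add f (map_add f), Matrix.map_mul,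
      Matrix.map_one f (map_zero f) (map_one f)] at h
    rw [← h]
    congr 1
    ext i j
    simp [vecMulVec_apply]

/-- Rescaling a generator. -/
def Frame.scale (a : Sˣ) (F : Frame V U) : Frame V U where
  gen := a.1 • F.gen
  coord := fun j => F.coord j * a⁻¹.1
  gen_dot_coord := by
    have h := F.gen_dot_coord
    simp only [dotProduct, Pi.smul_apply, smul_eq_mul] at h ⊢
    calc _ = a.1 * (∑ i, F.gen i * F.coord i) * a⁻¹.1 := by
          rw [Finset.mul_sum, Finset.sum_mul]; simp only [mul_assoc]
      _ = 1 := by rw [h]; simp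
  gen_vecMul := by rw [smul_vecMul, F.gen_vecMul, smul_zero]
  mulVec_coord := by
    ext i
    have h := congrFun F.mulVec_coord i
    simp only [mulVec, dotProduct, Pi.zero_apply] at h ⊢
    simp only [← mul_assoc]
    rw [← Finset.sum_mul, h, zero_mul]
  vecMulVec_add := by
    rw [← F.vecMulVec_add]
    congr 1
    ext i j
    simp [vecMulVec_apply, mul_assoc]

/-- The unit comparing two frames. -/
def Frame.compare (F G : Frame V U) : Sˣ where
  val := F.gen ⬝ᵥ G.coord
  inv := G.gen ⬝ᵥ F.coord
  val_inv := by
    rw [← smul_eq_mul, ← smul_dotProduct, G.dot_smul F.gen_vecMul, F.gen_dot_coord]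
  inv_val := by
    rw [← smul_eq_mul, ← smul_dotProduct, F.dot_smul G.gen_vecMul, G.gen_dot_coord]

theorem Frame.compare_smul (F G : Frame V U) : (F.compare G).1 • G.gen = F.gen :=
  G.dot_smul F.gen_vecMul

theorem Frame.dot_coord_mul_compare (F G : Frame V U) {x : ι → S} (hx : x ᵥ* U = 0) :
    (x ⬝ᵥ F.coord) * (F.compare G).1 = x ⬝ᵥ G.coord := by
  change _ * (F.gen ⬝ᵥ G.coord) = _
  rw [← smul_eq_mul, ← smul_dotProduct, F.dot_smul hx]

theorem Frame.ext_of_gen {F G : Frame V U} (h : F.gen = G.gen) : F.coord = G.coord := by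
  have h1 := F.vecMulVec_add.trans G.vecMulVec_add.symm
  rw [add_left_inj] at h1
  ext i
  have h2 : ∀ j, F.coord i * F.gen j = G.coord i * F.gen j := fun j => by
    have := congrFun (congrFun h1 i) j
    rwa [vecMulVec_apply, vecMulVec_apply, ← h] at this
  have h3 := F.gen_dot_coord
  calc F.coord i = ∑ j, F.coord i * F.gen j * F.coord j := by
        simp only [mul_assoc, ← Finset.mul_sum]
        rw [← dotProduct, h3, mul_one]
    _ = G.coord i := by
        simp only [h2, mul_assoc, ← Finset.mul_sum]
        rw [← dotProduct, h3, mul_one]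

end

/-- Every stably free module of rank one over `S` is free. -/
def HasCancel (S : Type) [Ring S] : Prop :=
  ∀ (m : ℕ) (V : Matrix (Fin m) (Unit ⊕ Fin m) S) (U : Matrix (Unit ⊕ Fin m) (Fin m) S),
    V * U = 1 → Nonempty (Frame V U)

theorem HasCancel.of_equiv {S : Type} [Ring S]
    (h : ∀ (P : Type) [AddCommGroup P] [Module S P] (m : ℕ),
      ((P × (Fin m → S)) ≃ₗ[S] (Unit ⊕ Fin m → S)) → Nonempty (P ≃ₗ[S] S)) : HasCancel S :=
  fun _ _ _ hVU => (h _ _ (kerEquiv hVU)).map (Frame.ofEquiv hVU)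

/-- Milnor's patching argument. -/
theorem HasCancel.of_square {S S₁ S₂ T : Type} [Ring S] [Ring S₁] [Ring S₂] [Ring T]
    (f₁ : S →+* S₁) (f₂ : S →+* S₂) (g₁ : S₁ →+* T) (g₂ : S₂ →+* T)
    (hex : ∀ a b, g₁ a = g₂ b → ∃ s, f₁ s = a ∧ f₂ s = b)
    (hinj : ∀ s t, f₁ s = f₁ t → f₂ s = f₂ t → s = t)
    (hcomm : ∀ s, g₁ (f₁ s) = g₂ (f₂ s))
    (hunits : ∀ u : Tˣ, ∃ (a : S₁ˣ) (b : S₂ˣ), g₁ a * u = g₂ b)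
    (h₁ : HasCancel S₁) (h₂ : HasCancel S₂) : HasCancel S := by
  intro m V U hVU
  have hm : ∀ {R : Type} [Ring R] (f : S →+* R), V.map f * U.map f = 1 := fun f => by
    rw [← Matrix.map_mul, hVU, Matrix.map_one f (map_zero f) (map_one f)]
  obtain ⟨F₁⟩ := h₁ m _ _ (hm f₁)
  obtain ⟨F₂⟩ := h₂ m _ _ (hm f₂)
  obtain ⟨a, b, hab⟩ := hunits ((F₁.map g₁ (V' := V.map (g₁.comp f₁)) (U' := U.map (g₁.comp f₁))
    rfl rfl).compare (F₂.map g₂ (by ext; simp [hcomm]) (by ext; simp [hcomm])))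
  have hgen : g₁ ∘ (F₁.scale a).gen = g₂ ∘ (F₂.scale b).gen := by
    have h := (F₁.map g₁ (V' := V.map (g₁.comp f₁)) (U' := U.map (g₁.comp f₁))
      rfl rfl).compare_smul (F₂.map g₂ (by ext; simp [hcomm]) (by ext; simp [hcomm]))
    ext i
    have h' := congrArg (g₁ a * ·) (congrFun h i)
    simp only [Pi.smul_apply, smul_eq_mul, ← mul_assoc, hab] at h'
    simpa [Frame.scale, Frame.map] using h'.symm
  have hcoord : g₁ ∘ (F₁.scale a).coord = g₂ ∘ (F₂.scale b).coord :=
    Frame.ext_of_gen (F := (F₁.scale a).map g₁ (V' := V.map (g₁.comp f₁))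
      (U' := U.map (g₁.comp f₁)) rfl rfl)
      (G := (F₂.scale b).map g₂ (by ext; simp [hcomm]) (by ext; simp [hcomm])) hgen
  generalize F₁.scale a = F₁ at hgen hcoord
  generalize F₂.scale b = F₂ at hgen hcoord
  choose w hw₁ hw₂ using fun i => hex (F₁.gen i) (F₂.gen i) (congrFun hgen i)
  choose c hc₁ hc₂ using fun i => hex (F₁.coord i) (F₂.coord i) (congrFun hcoord i)
  have aux : ∀ {R : Type} [Ring R] (f : S →+* R) (F : Frame (V.map f) (U.map f)),
      (∀ i, f (w i) = F.gen i) → (∀ i, f (c i) = F.coord i) →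
      f (w ⬝ᵥ c) = f 1 ∧ (∀ j, f ((w ᵥ* U) j) = f 0) ∧ (∀ j, f ((V *ᵥ c) j) = f 0) ∧
      ∀ i j, f ((vecMulVec c w + U * V) i j) = f ((1 : Matrix _ _ S) i j) := by
    intro R _ f F hw hc
    have hw' : f ∘ w = F.gen := funext hw
    have hc' : f ∘ c = F.coord := funext hc
    refine ⟨?_, fun j => ?_, fun j => ?_, fun i j => ?_⟩
    · rw [RingHom.map_dotProduct, hw', hc', F.gen_dot_coord, map_one]
    · rw [RingHom.map_vecMul, hw', F.gen_vecMul, map_zero, Pi.zero_apply]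
    · rw [RingHom.map_mulVec, hc', F.mulVec_coord, map_zero, Pi.zero_apply]
    · have h := congrFun (congrFun F.vecMulVec_add i) j
      rw [← Matrix.map_mul, Matrix.add_apply, Matrix.map_apply, vecMulVec_apply, ← hw, ← hc,
        ← map_mul, ← map_add] at h
      rw [Matrix.add_apply, vecMulVec_apply, h, one_apply, one_apply]
      split_ifs <;> simp
  obtain ⟨a₁, b₁, c₁, d₁⟩ := aux f₁ F₁ hw₁ hc₁
  obtain ⟨a₂, b₂, c₂, d₂⟩ := aux f₂ F₂ hw₂ hc₂
  exact ⟨{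
    gen := w
    coord := c
    gen_dot_coord := hinj _ _ a₁ a₂
    gen_vecMul := funext fun j => hinj _ _ (b₁ j) (b₂ j)
    mulVec_coord := funext fun j => hinj _ _ (c₁ j) (c₂ j)
    vecMulVec_add := Matrix.ext fun i j => hinj _ _ (d₁ i j) (d₂ i j) }⟩

/-! ### Determinants of matrices over a ring with a matrix representation -/

section
variable {L : Type} [Ring L] {κ : Type} [Fintype κ] [DecidableEq κ] {C : Type} [CommRing C]

/-- The determinant of a matrix over `L` with respect to a matrix representation of `L`. -/
def sdet (σ : L →+* Matrix κ κ C) {ι : Type} [Fintype ι] [DecidableEq ι] : Matrix ι ι L →* C :=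
  Matrix.detMonoidHom.comp ((Matrix.compRingEquiv ι κ C).toRingHom.comp
    (RingHom.mapMatrix (m := ι) σ)).toMonoidHom

variable {ι : Type} [Fintype ι] [DecidableEq ι]

theorem sdet_apply (σ : L →+* Matrix κ κ C) (M : Matrix ι ι L) :
    sdet σ M = (Matrix.comp ι ι κ κ C (M.map σ)).det := rfl

theorem sdet_comp {L' : Type} [Ring L'] (σ : L →+* Matrix κ κ C) (f : L' →+* L)
    (M : Matrix ι ι L') : sdet (σ.comp f) M = sdet σ (M.map f) := rfl

theorem sdet_mapMatrix_comp {C' : Type} [CommRing C'] (σ : L →+* Matrix κ κ C) (τ : C →+* C')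
    (M : Matrix ι ι L) : sdet (τ.mapMatrix.comp σ) M = τ (sdet σ M) := by
  rw [sdet_apply, sdet_apply, RingHom.map_det]
  rfl

theorem sdet_submatrix {ι' : Type} [Fintype ι'] [DecidableEq ι'] (σ : L →+* Matrix κ κ C)
    (e : ι' ≃ ι) (M : Matrix ι ι L) : sdet σ (M.submatrix e e) = sdet σ M := by
  rw [sdet_apply, sdet_apply, ← Matrix.det_submatrix_equiv_self (e.prodCongr (Equiv.refl κ))]
  rfl

theorem sdet_fromBlocks_zero₂₁ {ι' : Type} [Fintype ι'] [DecidableEq ι'] (σ : L →+* Matrix κ κ C)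
    (a : Matrix ι ι L) (b : Matrix ι ι' L) (d : Matrix ι' ι' L) :
    sdet σ (fromBlocks a b 0 d) = sdet σ a * sdet σ d := by
  have h := Matrix.det_fromBlocks_zero₂₁ (Matrix.comp _ _ _ _ _ (a.map σ))
    (Matrix.comp _ _ _ _ _ (b.map σ)) (Matrix.comp _ _ _ _ _ (d.map σ))
  rw [sdet_apply, sdet_apply, sdet_apply, ← h,
    ← Matrix.det_submatrix_equiv_self (Equiv.sumProdDistrib ι ι' κ)]
  congr 1
  ext ⟨i | i, k⟩ ⟨j | j, l⟩ <;> first | rfl | exact congrFun (congrFun (map_zero σ) k) l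

theorem sdet_fromBlocks_zero₁₂ {ι' : Type} [Fintype ι'] [DecidableEq ι'] (σ : L →+* Matrix κ κ C)
    (a : Matrix ι ι L) (c : Matrix ι' ι L) (d : Matrix ι' ι' L) :
    sdet σ (fromBlocks a 0 c d) = sdet σ a * sdet σ d := by
  have h := Matrix.det_fromBlocks_zero₁₂ (Matrix.comp _ _ _ _ _ (a.map σ))
    (Matrix.comp _ _ _ _ _ (c.map σ)) (Matrix.comp _ _ _ _ _ (d.map σ))
  rw [sdet_apply, sdet_apply, sdet_apply, ← h,
    ← Matrix.det_submatrix_equiv_self (Equiv.sumProdDistrib ι ι' κ)]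
  congr 1
  ext ⟨i | i, k⟩ ⟨j | j, l⟩ <;> first | rfl | exact congrFun (congrFun (map_zero σ) k) l

theorem sdet_unique [Unique ι] (σ : L →+* Matrix κ κ C) (M : Matrix ι ι L) :
    sdet σ M = (σ (M default default)).det := by
  rw [sdet_apply, ← Matrix.det_submatrix_equiv_self (Equiv.uniqueProd κ ι).symm]
  rfl

/-- The determinant only depends on the representation up to conjugation. -/
theorem sdet_congr_of_conj {f g : L →+* Matrix κ κ C} (s : (Matrix κ κ C)ˣ)
    (h : ∀ x, s.1 * f x = g x * s.1) (M : Matrix ι ι L) : sdet f M = sdet g M := by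
  have h1 : Matrix.diagonal (fun _ : ι => s.1) * M.map f =
      M.map g * Matrix.diagonal (fun _ : ι => s.1) := by
    ext1 i j
    simp [h]
  have h2 := congrArg (fun N => (Matrix.compRingEquiv ι κ C N).det) h1
  simp only [map_mul, det_mul] at h2
  have h3 : IsUnit ((Matrix.compRingEquiv ι κ C) (Matrix.diagonal (fun _ : ι => s.1))).det := by
    rw [← Matrix.isUnit_iff_isUnit_det]
    refine IsUnit.map _ ⟨⟨Matrix.diagonal (fun _ : ι => s.1), Matrix.diagonal (fun _ : ι => s⁻¹.1),
      ?_, ?_⟩, rfl⟩ <;>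
    · rw [Matrix.diagonal_mul_diagonal]; simp
  rw [mul_comm] at h2
  exact h3.mul_right_cancel h2

end

theorem isUnit_of_isUnit_fromBlocks {L ι ι' : Type} [Ring L] [Fintype ι] [DecidableEq ι]
    [Fintype ι'] [DecidableEq ι'] {a : Matrix ι ι L} {b : Matrix ι ι' L} {d : Matrix ι' ι' L}
    (ha : IsUnit a) (h : IsUnit (fromBlocks a b 0 d)) : IsUnit d := by
  obtain ⟨⟨_, N, h1, h2⟩, rfl⟩ := h
  rw [← fromBlocks_toBlocks N, fromBlocks_multiply, ← fromBlocks_one, fromBlocks_inj] at h1 h2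
  simp only [Matrix.zero_mul, zero_add, Matrix.mul_zero, add_zero] at h1 h2
  have h3 : N.toBlocks₂₁ = 0 := by
    obtain ⟨a, rfl⟩ := ha
    calc N.toBlocks₂₁ = N.toBlocks₂₁ * a.1 * a⁻¹.1 := by
          rw [Matrix.mul_assoc, Units.mul_inv, Matrix.mul_one]
      _ = 0 := by rw [h2.2.2.1, Matrix.zero_mul]
  refine ⟨⟨d, N.toBlocks₂₂, h1.2.2.2, ?_⟩, rfl⟩
  rw [← h2.2.2.2, h3, Matrix.zero_mul, zero_add]

theorem isUnit_fromBlocks_one_zero₁₂ {L ι ι' : Type} [Ring L] [Fintype ι] [DecidableEq ι]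
    [Fintype ι'] [DecidableEq ι'] (c : Matrix ι' ι L) :
    IsUnit (fromBlocks 1 0 c 1 : Matrix (ι ⊕ ι') (ι ⊕ ι') L) := by
  refine ⟨⟨fromBlocks 1 0 c 1, fromBlocks 1 0 (-c) 1, ?_, ?_⟩, rfl⟩ <;>
  · rw [fromBlocks_multiply, ← fromBlocks_one]
    simp

theorem isUnit_fromBlocks_one_zero₂₁ {L ι ι' : Type} [Ring L] [Fintype ι] [DecidableEq ι]
    [Fintype ι'] [DecidableEq ι'] (b : Matrix ι ι' L) :
    IsUnit (fromBlocks 1 b 0 1 : Matrix (ι ⊕ ι') (ι ⊕ ι') L) := by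
  refine ⟨⟨fromBlocks 1 b 0 1, fromBlocks 1 (-b) 0 1, ?_, ?_⟩, rfl⟩ <;>
  · rw [fromBlocks_multiply, ← fromBlocks_one]
    simp

/-- A matrix with an invertible upper left corner. -/
theorem exists_sdet_eq_of_isUnit {L ι : Type} [Ring L] [Fintype ι] [DecidableEq ι]
    (ih : ∀ M : Matrix ι ι L, IsUnit M → ∃ u : Lˣ, ∀ (κ C : Type) [Fintype κ] [DecidableEq κ]
      [CommRing C] (σ : L →+* Matrix κ κ C), sdet σ M = (σ u).det)
    (M : Matrix (Unit ⊕ ι) (Unit ⊕ ι) L) (hM : IsUnit M) (hp : IsUnit (M (.inl ()) (.inl ()))) :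
    ∃ u : Lˣ, ∀ (κ C : Type) [Fintype κ] [DecidableEq κ]
      [CommRing C] (σ : L →+* Matrix κ κ C), sdet σ M = (σ u).det := by
  obtain ⟨p, hp⟩ := hp
  have h1 : fromBlocks 1 0 (-(M.toBlocks₂₁ * (Matrix.of fun _ _ => p⁻¹.1 : Matrix Unit Unit L))) 1 * M =
      fromBlocks M.toBlocks₁₁ M.toBlocks₁₂ 0
        (M.toBlocks₂₂ - M.toBlocks₂₁ * (Matrix.of fun _ _ => p⁻¹.1 : Matrix Unit Unit L) * M.toBlocks₁₂) := by
    conv_lhs => rw [← fromBlocks_toBlocks M]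
    rw [fromBlocks_multiply]
    congr 1
    · simp
    · simp
    · ext i j
      simp [Matrix.mul_apply, toBlocks₁₁, ← hp, mul_assoc]
    · simp [sub_eq_neg_add]
  have h2 : IsUnit M.toBlocks₁₁ := by
    refine ⟨⟨M.toBlocks₁₁, Matrix.of fun _ _ => p⁻¹.1, ?_, ?_⟩, rfl⟩ <;>
    · ext i j
      simp [Matrix.mul_apply, toBlocks₁₁, ← hp]
  have h3 : IsUnit (fromBlocks 1 0 (-(M.toBlocks₂₁ * (Matrix.of fun _ _ => p⁻¹.1 : Matrix Unit Unit L))) 1 :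
      Matrix (Unit ⊕ ι) (Unit ⊕ ι) L) := by
    exact isUnit_fromBlocks_one_zero₁₂ _
  have h4 := isUnit_of_isUnit_fromBlocks h2 (h1 ▸ h3.mul hM)
  obtain ⟨u, hu⟩ := ih _ h4
  refine ⟨p * u, fun κ C _ _ _ σ => ?_⟩
  have h5 := congrArg (sdet σ) h1
  rw [map_mul, sdet_fromBlocks_zero₁₂, sdet_fromBlocks_zero₂₁, map_one, map_one, one_mul, one_mul,
    hu, sdet_unique σ M.toBlocks₁₁] at h5
  rw [h5, Units.val_mul, map_mul, det_mul, hp]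
  rfl

/-- Over a ring of stable rank one, every invertible matrix has the determinant of a unit. -/
theorem exists_sdet_eq {L : Type} [Ring L]
    (hL : ∀ (ι : Type) [Fintype ι] (x y : ι → L), ∑ i, x i * y i = 1 → ∃ i, IsUnit (y i)) (n : ℕ) :
    ∀ M : Matrix (Fin n) (Fin n) L, IsUnit M → ∃ u : Lˣ, ∀ (κ C : Type) [Fintype κ] [DecidableEq κ]
      [CommRing C] (σ : L →+* Matrix κ κ C), sdet σ M = (σ u).det := by
  induction n with
  | zero =>
    intro M _
    refine ⟨1, fun κ C _ _ _ σ => ?_⟩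
    rw [Subsingleton.elim M 1, map_one, Units.val_one, map_one, det_one]
  | succ n ih =>
    suffices h : ∀ M : Matrix (Unit ⊕ Fin n) (Unit ⊕ Fin n) L, IsUnit M → ∃ u : Lˣ,
        ∀ (κ C : Type) [Fintype κ] [DecidableEq κ]
        [CommRing C] (σ : L →+* Matrix κ κ C), sdet σ M = (σ u).det by
      intro M hM
      let e : Unit ⊕ Fin n ≃ Fin (n + 1) := Fintype.equivOfCardEq (by simp [add_comm])
      obtain ⟨u, hu⟩ := h (M.submatrix e e) (hM.map (Matrix.reindexRingEquiv L e.symm))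
      exact ⟨u, fun κ C _ _ _ σ => by rw [← hu, sdet_submatrix]⟩
    intro M hM
    have hcol : ∃ i, IsUnit (M i (.inl ())) := by
      obtain ⟨⟨M, N, _, h2⟩, rfl⟩ := hM
      have h3 := congrFun (congrFun h2 (.inl ())) (.inl ())
      rw [Matrix.mul_apply, Matrix.one_apply_eq] at h3
      exact hL _ _ _ h3
    obtain ⟨_ | i, hi⟩ := hcol
    · exact exists_sdet_eq_of_isUnit ih M hM hi
    · obtain ⟨q, hq⟩ := hi
      let r : Matrix Unit (Fin n) L := Matrix.of fun _ j =>
        if j = i then (1 - M (.inl ()) (.inl ())) * q⁻¹.1 else 0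
      have h1 : IsUnit (fromBlocks 1 r 0 1 : Matrix (Unit ⊕ Fin n) (Unit ⊕ Fin n) L) := by
        exact isUnit_fromBlocks_one_zero₂₁ _
      obtain ⟨u, hu⟩ := exists_sdet_eq_of_isUnit ih _ (h1.mul hM) (by
        convert isUnit_one
        rw [Matrix.mul_apply]
        simp [r, ← hq])
      refine ⟨u, fun κ C _ _ _ σ => ?_⟩
      rw [← hu, map_mul, sdet_fromBlocks_zero₂₁, map_one, map_one, one_mul, one_mul]

/-! ### The matrix representation of a quaternion algebra and positivity -/

/-- The representation of a quaternion algebra by two by two matrices over a quadratic algebra. -/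
def quatRep {R : Type} [CommRing R] (a b c : R) :
    QuaternionAlgebra R a b c →+* Matrix (Fin 2) (Fin 2) (QuadraticAlgebra R a b) :=
  quatHom ((Matrix.scalar (Fin 2)).comp (algebraMap R _)) !![⟨0, 1⟩, 0; 0, ⟨b, -1⟩]
    !![0, 1; ⟨c, 0⟩, 0] (fun _ _ => Matrix.scalar_comm _ (fun _ => Commute.all _ _) _)
    (by
      ext i j <;> fin_cases i <;> fin_cases j <;>
        simp [Matrix.mul_apply, Fin.sum_univ_two, Matrix.scalar_apply] <;> ring)
    (by
      ext i j <;> fin_cases i <;> fin_cases j <;>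
        simp [Matrix.mul_apply, Fin.sum_univ_two, Matrix.scalar_apply])
    (by
      ext i j <;> fin_cases i <;> fin_cases j <;>
        simp [Matrix.mul_apply, Fin.sum_univ_two, Matrix.scalar_apply])

theorem quatRep_apply {R : Type} [CommRing R] {a b c : R} (q : QuaternionAlgebra R a b c) :
    quatRep a b c q = !![⟨q.re, q.imI⟩, ⟨q.imJ, q.imK⟩;
      ⟨c * (q.imJ + b * q.imK), -(c * q.imK)⟩, ⟨q.re + b * q.imI, -q.imI⟩] := by
  rw [quatRep, quatHom_apply]
  ext i j <;> fin_cases i <;> fin_cases j <;>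
    simp [Matrix.mul_apply, Fin.sum_univ_two, Matrix.scalar_apply] <;> ring

/-- The representation of the real quaternions by complex matrices. -/
def sigC : QuaternionAlgebra ℝ (-1) 0 (-1) →+* Matrix (Fin 2) (Fin 2) ℂ :=
  quatHom ((Matrix.scalar (Fin 2)).comp Complex.ofRealHom) !![Complex.I, 0; 0, -Complex.I]
    !![0, 1; -1, 0] (fun _ _ => Matrix.scalar_comm _ (fun _ => Commute.all _ _) _)
    (by
      ext i j <;> fin_cases i <;> fin_cases j <;>
        simp [Matrix.mul_apply, Fin.sum_univ_two, Matrix.scalar_apply])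
    (by
      ext i j <;> fin_cases i <;> fin_cases j <;>
        simp [Matrix.mul_apply, Fin.sum_univ_two, Matrix.scalar_apply])
    (by
      ext i j <;> fin_cases i <;> fin_cases j <;>
        simp [Matrix.mul_apply, Fin.sum_univ_two, Matrix.scalar_apply])

theorem sigC_apply (q : QuaternionAlgebra ℝ (-1) 0 (-1)) :
    sigC q = !![⟨q.re, q.imI⟩, ⟨q.imJ, q.imK⟩; ⟨-q.imJ, q.imK⟩, ⟨q.re, -q.imI⟩] := by
  rw [sigC, quatHom_apply]
  ext i j; fin_cases i <;> fin_cases j <;> apply Complex.ext <;>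
    simp [Matrix.mul_apply, Fin.sum_univ_two, Matrix.scalar_apply]

theorem det_sigC (q : QuaternionAlgebra ℝ (-1) 0 (-1)) :
    (sigC q).det = ((q.re ^ 2 + q.imI ^ 2 + q.imJ ^ 2 + q.imK ^ 2 : ℝ) : ℂ) := by
  rw [sigC_apply, det_fin_two_of]
  apply Complex.ext <;> simp [pow_two] <;> ring

theorem exists_sdet_sigC {ι : Type} [Fintype ι] [DecidableEq ι]
    {M : Matrix ι ι (QuaternionAlgebra ℝ (-1) 0 (-1))} (hM : IsUnit M) :
    ∃ r : ℝ, 0 < r ∧ sdet sigC M = r := by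
  have hdiv : ∀ x : QuaternionAlgebra ℝ (-1) 0 (-1), x ≠ 0 → IsUnit x := fun x hx =>
    (isUnit_iff_ne_zero (G₀ := Quaternion ℝ)).2 hx
  obtain ⟨u, hu⟩ := exists_sdet_eq (L := QuaternionAlgebra ℝ (-1) 0 (-1)) (fun ι _ x y h => by
    by_contra! h'
    have h'' : ∀ i, y i = 0 := fun i => by_contra fun hi => h' i (hdiv _ hi)
    simp [h''] at h) (Fintype.card ι) _ (hM.map (Matrix.reindexRingEquiv _ (Fintype.equivFin ι)))
  refine ⟨_, ?_, ((sdet_submatrix sigC (Fintype.equivFin ι).symm M).symm.trans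
    (hu _ _ sigC)).trans (det_sigC _)⟩
  have h0 : u.1 ≠ 0 := u.ne_zero
  by_contra! h
  apply h0
  ext <;> simp only [QuaternionAlgebra.re_zero, QuaternionAlgebra.imI_zero,
    QuaternionAlgebra.imJ_zero, QuaternionAlgebra.imK_zero] <;>
  nlinarith [sq_nonneg u.1.re, sq_nonneg u.1.imI, sq_nonneg u.1.imJ, sq_nonneg u.1.imK]

/-- The real quaternion algebra as a completion of `VA`. -/
def realA : VA →+* QuaternionAlgebra ℝ (-1) 0 (-1) :=
  quatHom (Int.castRingHom _) ⟨0, 1, 0, 0⟩ ⟨0, 0, 1, 0⟩ (fun _ _ => Int.cast_comm _ _)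
    (by ext <;> simp) (by ext <;> simp) (by ext <;> simp)

/-- A real embedding of `ℤ[√3]`. -/
def realRB (s : ℝ) (hs : s * s = 3) : RB →+* ℝ :=
  quadHom (Int.castRingHom ℝ) s (fun _ _ => mul_comm _ _) (by simp [hs])

theorem realRB_apply (s : ℝ) (hs : s * s = 3) (q : RB) :
    realRB s hs q = q.re + q.im * s := quadHom_apply ..

/-- The real quaternion algebra as a completion of `VB`. -/
def realB (s : ℝ) (hs : s * s = 3) : VB →+* QuaternionAlgebra ℝ (-1) 0 (-1) :=
  quatHom ((algebraMap ℝ (QuaternionAlgebra ℝ (-1) 0 (-1))).comp (realRB s hs))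
    ⟨s / 2, 1 / 2, 0, 0⟩ ⟨0, 0, 1, 0⟩ (fun r => Algebra.commutes (realRB s hs r))
    (by
      have h1 : realRB s hs (-1) = -1 := by simp
      have h2 : realRB s hs ⟨0, 1⟩ = s := by simp [realRB_apply]
      rw [RingHom.comp_apply, RingHom.comp_apply, h1, h2]
      ext <;> simp <;> linarith)
    (by
      have h1 : realRB s hs (-1) = -1 := by simp
      rw [RingHom.comp_apply, h1]
      ext <;> simp)
    (by
      have h2 : realRB s hs ⟨0, 1⟩ = s := by simp [realRB_apply]
      rw [RingHom.comp_apply, h2]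
      ext <;> simp; ring)

theorem realA_apply (q : VA) : realA q = ⟨q.re, q.imI, q.imJ, q.imK⟩ := by
  rw [realA, quatHom_apply]
  ext <;> simp

/-- The complex embedding of the Gaussian integers. -/
def cplxA : QuadraticAlgebra ℤ (-1) 0 →+* ℂ :=
  quadHom (Int.castRingHom ℂ) Complex.I (fun _ _ => mul_comm _ _) (by simp)

theorem cplxA_apply (q : QuadraticAlgebra ℤ (-1) 0) : cplxA q = ⟨q.re, q.im⟩ := by
  rw [cplxA, quadHom_apply]
  apply Complex.ext <;> simp

theorem sigC_comp_realA : sigC.comp realA = cplxA.mapMatrix.comp (quatRep (-1 : ℤ) 0 (-1)) := by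
  ext q i j
  rw [RingHom.comp_apply, RingHom.comp_apply, realA_apply, sigC_apply, quatRep_apply]
  fin_cases i <;> fin_cases j <;> apply Complex.ext <;> simp [cplxA_apply]

theorem sdet_repA_pos {ι : Type} [Fintype ι] [DecidableEq ι] {M : Matrix ι ι VA}
    (hM : IsUnit (M.map realA)) :
    ∃ p : ℤ, 0 < p ∧ sdet (quatRep (-1 : ℤ) 0 (-1)) M = ⟨p, 0⟩ := by
  obtain ⟨r, hr, h⟩ := exists_sdet_sigC hM
  rw [← sdet_comp, sigC_comp_realA, sdet_mapMatrix_comp, cplxA_apply] at h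
  have h1 := congrArg Complex.re h
  have h2 := congrArg Complex.im h
  simp only [Complex.ofReal_re, Complex.ofReal_im, Int.cast_eq_zero] at h1 h2
  refine ⟨_, ?_, QuadraticAlgebra.ext rfl h2⟩
  rw [← h1] at hr
  exact_mod_cast hr

theorem realB_apply (s : ℝ) (hs : s * s = 3) (q : VB) :
    realB s hs q = ⟨realRB s hs q.re + realRB s hs q.imI * (s / 2), realRB s hs q.imI / 2,
      realRB s hs q.imJ + realRB s hs q.imK * (s / 2), realRB s hs q.imK / 2⟩ := by
  rw [realB, quatHom_apply]
  simp only [RingHom.comp_apply]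
  generalize realRB s hs q.re = a
  generalize realRB s hs q.imI = b
  generalize realRB s hs q.imJ = c
  generalize realRB s hs q.imK = d
  ext <;> simp [div_eq_mul_inv]

/-- The quadratic extension of `ℤ[√3]` generated by a twelfth root of unity. -/
abbrev KB : Type := QuadraticAlgebra RB (-1) ⟨0, 1⟩

/-- A complex embedding of `KB`. -/
def cplxB (s : ℝ) (hs : s * s = 3) : KB →+* ℂ :=
  quadHom (Complex.ofRealHom.comp (realRB s hs)) ⟨s / 2, 1 / 2⟩ (fun _ _ => mul_comm _ _) (by
    have h1 : realRB s hs (-1) = -1 := by simp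
    have h2 : realRB s hs ⟨0, 1⟩ = s := by simp [realRB_apply]
    rw [RingHom.comp_apply, RingHom.comp_apply, h1, h2]
    apply Complex.ext <;> simp <;> linarith)

theorem cplxB_apply (s : ℝ) (hs : s * s = 3) (q : KB) :
    cplxB s hs q = ⟨realRB s hs q.re + realRB s hs q.im * (s / 2), realRB s hs q.im / 2⟩ := by
  rw [cplxB, quadHom_apply]
  simp only [RingHom.comp_apply]
  generalize realRB s hs q.re = a
  generalize realRB s hs q.im = b
  apply Complex.ext <;> simp [div_eq_mul_inv]

theorem sigC_comp_realB (s : ℝ) (hs : s * s = 3) : sigC.comp (realB s hs) =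
    (cplxB s hs).mapMatrix.comp (quatRep (-1 : RB) ⟨0, 1⟩ (-1)) := by
  ext q i j
  rw [RingHom.comp_apply, RingHom.comp_apply, realB_apply, sigC_apply, quatRep_apply]
  have h2 : realRB s hs ⟨0, 1⟩ = s := by simp [realRB_apply]
  fin_cases i <;> fin_cases j <;> apply Complex.ext <;>
    simp [cplxB_apply, map_add, map_mul, map_neg, h2] <;> ring

theorem sdet_repB_pos {ι : Type} [Fintype ι] [DecidableEq ι] {M : Matrix ι ι VB}
    (hM : ∀ s hs, IsUnit (M.map (realB s hs))) :
    ∃ p q : ℤ, 0 < p ∧ 0 < p ^ 2 - 3 * q ^ 2 ∧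
      sdet (quatRep (-1 : RB) ⟨0, 1⟩ (-1)) M = ⟨⟨p, q⟩, 0⟩ := by
  have key : ∀ s hs, ∃ r : ℝ, 0 < r ∧
      cplxB s hs (sdet (quatRep (-1 : RB) ⟨0, 1⟩ (-1)) M) = r := by
    intro s hs
    obtain ⟨r, hr, h⟩ := exists_sdet_sigC (hM s hs)
    rw [← sdet_comp, sigC_comp_realB, sdet_mapMatrix_comp] at h
    exact ⟨r, hr, h⟩
  generalize sdet (quatRep (-1 : RB) ⟨0, 1⟩ (-1)) M = d at key ⊢
  obtain ⟨⟨p, q⟩, ⟨p', q'⟩⟩ := d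
  have hs : (√3 * √3 : ℝ) = 3 := by norm_num
  have hs0 : (0 : ℝ) < √3 := by positivity
  obtain ⟨r, hr, h⟩ := key (√3) hs
  obtain ⟨r', hr', h'⟩ := key (-√3) (by rw [neg_mul_neg, hs])
  simp only [cplxB_apply, realRB_apply] at h h'
  have h1 := congrArg Complex.re h
  have h2 := congrArg Complex.im h
  have h3 := congrArg Complex.re h'
  have h4 := congrArg Complex.im h'
  simp only [Complex.ofReal_re, Complex.ofReal_im] at h1 h2 h3 h4
  have h5 : (p' : ℝ) = 0 := by linarith
  have h6 : (q' : ℝ) = 0 := by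
    have : (q' : ℝ) * √3 = 0 := by linarith
    simpa [hs0.ne'] using this
  rw [h5, h6] at h1 h3
  have hp : 0 < (p : ℝ) := by linarith
  have hn : 0 < (p : ℝ) ^ 2 - 3 * q ^ 2 := by
    have : 0 < r * r' := mul_pos hr hr'
    rw [← h1, ← h3] at this
    nlinarith
  refine ⟨p, q, by exact_mod_cast hp, by exact_mod_cast hn, ?_⟩
  have h5' : p' = 0 := by exact_mod_cast h5
  have h6' : q' = 0 := by exact_mod_cast h6
  rw [h5', h6']
  rfl

theorem sdet_repA_of_isUnit {ι : Type} [Fintype ι] [DecidableEq ι] {M : Matrix ι ι VA}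
    (hM : IsUnit M) : sdet (quatRep (-1 : ℤ) 0 (-1)) M = 1 := by
  obtain ⟨p, hp, h⟩ := sdet_repA_pos (hM.map (realA.mapMatrix))
  have h1 := hM.map (sdet (quatRep (-1 : ℤ) 0 (-1)))
  rw [h, QuadraticAlgebra.isUnit_iff_norm_isUnit] at h1
  have h2 : QuadraticAlgebra.norm (⟨p, 0⟩ : QuadraticAlgebra ℤ (-1) 0) = p * p := by
    simp [QuadraticAlgebra.norm_def]
  rw [h2] at h1
  have h3 : IsUnit p := isUnit_of_mul_isUnit_left h1
  rw [h, Int.isUnit_iff.1 h3 |>.resolve_right (by omega)]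
  rfl

theorem sdet_repB_of_isUnit {ι : Type} [Fintype ι] [DecidableEq ι] {M : Matrix ι ι VB}
    (hM : IsUnit M) : ∃ p q : ℤ, 0 < p ∧ p ^ 2 - 3 * q ^ 2 = 1 ∧
      sdet (quatRep (-1 : RB) ⟨0, 1⟩ (-1)) M = ⟨⟨p, q⟩, 0⟩ := by
  obtain ⟨p, q, hp, hn, h⟩ := sdet_repB_pos (fun s hs => hM.map (realB s hs).mapMatrix)
  refine ⟨p, q, hp, ?_, h⟩
  have h1 := hM.map (sdet (quatRep (-1 : RB) ⟨0, 1⟩ (-1)))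
  rw [h, QuadraticAlgebra.isUnit_iff_norm_isUnit] at h1
  have h2 : QuadraticAlgebra.norm (⟨⟨p, q⟩, 0⟩ : KB) = ⟨p, q⟩ * ⟨p, q⟩ := by
    simp [QuadraticAlgebra.norm_def]
  rw [h2] at h1
  have h3 := QuadraticAlgebra.isUnit_iff_norm_isUnit.1 (isUnit_of_mul_isUnit_left h1)
  rw [QuadraticAlgebra.norm_def] at h3
  have h4 := (Int.isUnit_iff.1 h3).resolve_right (by simp only [zero_mul, add_zero]; nlinarith)
  simp only [zero_mul, add_zero] at h4
  linarith

/-! ### Indices, and cancellation over definite quaternion orders -/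

theorem card_quotient_range {S K ι : Type} [Ring S] [CommRing K] [Module.Free ℤ K]
    [Module.Finite ℤ K] [Fintype ι] [DecidableEq ι] (rep : S →+* Matrix (Fin 2) (Fin 2) K)
    (T : S ≃+ (Fin 2 → K)) (hT : ∀ s, T s = rep s 0) (M : Matrix ι ι S)
    (h0 : Algebra.norm ℤ (sdet rep M) ≠ 0) :
    Nat.card ((ι → S) ⧸ LinearMap.range M.vecMulLinear) =
      (Algebra.norm ℤ (sdet rep M)).natAbs := by
  set W : Matrix (ι × Fin 2) (ι × Fin 2) K := Matrix.comp _ _ _ _ _ (M.map rep)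
  have hW : sdet rep M = W.det := rfl
  let L : (ι × Fin 2 → K) →ₗ[ℤ] (ι × Fin 2 → K) := (Matrix.toLin' Wᵀ).restrictScalars ℤ
  have hdet : LinearMap.det L = Algebra.norm ℤ (sdet rep M) := by
    rw [LinearMap.det_restrictScalars, LinearMap.det_toLin', det_transpose, hW]
  have hinj : Function.Injective L :=
    LinearMap.ker_eq_bot.1 (not_not.1 (LinearMap.det_eq_zero_iff_ker_ne_bot.not.1 (hdet ▸ h0)))
  have hcard := Submodule.natAbs_det_equiv (LinearMap.range L) (LinearEquiv.ofInjective L hinj)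
  have hL : (LinearMap.range L).subtype ∘ₗ
      ((LinearEquiv.ofInjective L hinj : _ ≃ₗ[ℤ] _) : _ →+ _).toIntLinearMap = L := by
    ext; rfl
  rw [← hdet]
  let E : (ι → S) ≃ₗ[ℤ] (ι × Fin 2 → K) := AddEquiv.toIntLinearEquiv
    { toFun := fun x p => T (x p.1) p.2
      invFun := fun y i => T.symm fun k => y (i, k)
      left_inv := fun x => by ext; simp
      right_inv := fun y => by ext; simp
      map_add' := fun x y => by ext; simp }
  have hE : ∀ x, E (x ᵥ* M) = L (E x) := by
    intro x
    ext ⟨i, k⟩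
    change T ((x ᵥ* M) i) k = (Wᵀ *ᵥ (E x)) (i, k)
    rw [mulVec_transpose]
    simp only [vecMul, dotProduct, Fintype.sum_prod_type, hT, map_sum, map_mul, Matrix.sum_apply,
      Matrix.mul_apply]
    refine Finset.sum_congr rfl fun j _ => Finset.sum_congr rfl fun l _ => ?_
    change _ = T (x j) l * _
    rw [hT]
    rfl
  have hmap : ((LinearMap.range M.vecMulLinear).restrictScalars ℤ).map E.toLinearMap =
      LinearMap.range L := by
    ext y
    simp only [Submodule.mem_map, Submodule.restrictScalars_mem, LinearMap.mem_range]
    constructor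
    · rintro ⟨_, ⟨x, rfl⟩, rfl⟩
      exact ⟨E x, (hE x).symm⟩
    · rintro ⟨x, rfl⟩
      refine ⟨_, ⟨E.symm x, rfl⟩, ?_⟩
      exact (hE _).trans (by rw [LinearEquiv.apply_symm_apply])
  rw [← Nat.card_congr (Submodule.Quotient.restrictScalarsEquiv ℤ
    (LinearMap.range M.vecMulLinear)).toEquiv,
    Nat.card_congr (Submodule.Quotient.equiv _ _ E hmap).toEquiv, ← hcard]
  congr 2

theorem hasCancel_divisionRing {D : Type} [DivisionRing D] : HasCancel D :=
  HasCancel.of_equiv fun P _ _ m e => by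
    have : Module.Finite D (P × (Fin m → D)) := Module.Finite.equiv e.symm
    have : Module.Finite D P := Module.Finite.of_surjective (LinearMap.fst D P (Fin m → D))
      LinearMap.fst_surjective
    have h := e.finrank_eq
    rw [Module.finrank_prod, Module.finrank_fintype_fun_eq_card,
      Module.finrank_fintype_fun_eq_card, Fintype.card_sum] at h
    exact FiniteDimensional.nonempty_linearEquiv_of_finrank_eq (by
      rw [Module.finrank_self]; simpa [add_comm] using h)

/-- Every nonzero left ideal contains an element generating a subideal of bounded index. -/
def EuclidBound (S : Type) [Ring S] (K : ℕ) : Prop :=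
  ∀ J : Submodule S S, J ≠ ⊥ → ∃ y ∈ J, y ≠ 0 ∧ ∃ F : S → Fin K,
    ∀ x ∈ J, ∀ x' ∈ J, F x = F x' → ∃ s, x - x' = s * y

theorem exists_injective_of_frame {S D : Type} [Ring S] [DivisionRing D] (φ : S →+* D)
    (hφ : Function.Injective φ) {m : ℕ} {V : Matrix (Fin m) (Unit ⊕ Fin m) S}
    {U : Matrix (Unit ⊕ Fin m) (Fin m) S} (h : V * U = 1) :
    (LinearMap.ker U.vecMulLinear ≠ ⊥) ∧
    ∃ f : LinearMap.ker U.vecMulLinear →ₗ[S] S, Function.Injective f := by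
  obtain ⟨G⟩ := hasCancel_divisionRing m (V.map φ) (U.map φ) (by
    rw [← Matrix.map_mul, h, Matrix.map_one _ (map_zero φ) (map_one φ)])
  have hne : LinearMap.ker U.vecMulLinear ≠ ⊥ := by
    intro hb
    have hUV : U * V = 1 := by
      refine funext fun i => ?_
      have h0 : kerProj h (Pi.single i 1) = 0 :=
        Subtype.ext ((Submodule.eq_bot_iff _).1 hb _ (kerProj h (Pi.single i 1)).2)
      have h1 := congrArg Subtype.val h0
      rw [coe_kerProj, ZeroMemClass.coe_zero, sub_eq_zero, single_one_vecMul] at h1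
      ext j
      have h2 := congrFun h1 j
      rw [Pi.single_apply] at h2
      rw [one_apply]
      simp only [eq_comm (a := i)]
      exact h2.symm
    have h2 : G.gen = 0 := by
      rw [← vecMul_one G.gen, ← Matrix.map_one φ (map_zero φ) (map_one φ), ← hUV, Matrix.map_mul,
        ← vecMul_vecMul, G.gen_vecMul, zero_vecMul]
    have h3 := G.gen_dot_coord
    rw [h2, zero_dotProduct] at h3
    exact zero_ne_one h3
  refine ⟨hne, ?_⟩
  obtain ⟨p, hp, hp0⟩ := Submodule.exists_mem_ne_zero_of_ne_bot hne
  obtain ⟨i, hi⟩ := Function.ne_iff.1 hp0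
  refine ⟨LinearMap.proj i ∘ₗ Submodule.subtype _, ?_⟩
  have key : ∀ q ∈ LinearMap.ker U.vecMulLinear, ∃ l : D, ∀ j, φ (q j) = l * G.gen j := by
    intro q hq
    refine ⟨_, fun j => (congrFun (G.dot_smul (x := φ ∘ q) ?_) j).symm⟩
    ext j
    rw [← RingHom.map_vecMul, show q ᵥ* U = 0 from hq]
    simp
  rw [injective_iff_map_eq_zero]
  rintro ⟨q, hq⟩ hqi
  change q i = 0 at hqi
  obtain ⟨l, hl⟩ := key q hq
  obtain ⟨l', hl'⟩ := key p hp
  have hgi : G.gen i ≠ 0 := by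
    intro h0
    have := hl' i
    rw [h0, mul_zero, ← map_zero φ] at this
    exact hi (hφ this)
  have hl0 : l = 0 := by
    have := hl i
    rw [hqi, map_zero] at this
    exact (mul_eq_zero.1 this.symm).resolve_right hgi
  ext j
  apply hφ
  simpa [hl0] using hl j

theorem isUnit_map_of_mul_eq_natCast {S D ι : Type} [Ring S] [DivisionRing D] [CharZero D]
    [Fintype ι] [DecidableEq ι] (φ : S →+* D) {N M : Matrix ι ι S} {c : ℕ} (hc : c ≠ 0)
    (h : N * M = (c : Matrix ι ι S)) : IsUnit (M.map φ) := by
  have hc' : (c : D) ≠ 0 := Nat.cast_ne_zero.2 hc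
  have h1 : N.map φ * M.map φ = (c : Matrix ι ι D) := by
    rw [← Matrix.map_mul, h]
    exact map_natCast φ.mapMatrix c
  have h2 : ((c : D)⁻¹ • N.map φ) * M.map φ = 1 := by
    rw [smul_mul_assoc, h1, ← nsmul_one (A := Matrix ι ι D) c, ← Nat.cast_smul_eq_nsmul D,
      smul_smul, inv_mul_cancel₀ hc', one_smul]
  exact ⟨⟨_, _, mul_eq_one_symm h2, h2⟩, rfl⟩

theorem hasCancel_of_euclidBound {S D K : Type} [Ring S] [DivisionRing D] [CommRing K]
    [Module.Free ℤ K] [Module.Finite ℤ K] (φ : S →+* D) (hφ : Function.Injective φ)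
    (rep : S →+* Matrix (Fin 2) (Fin 2) K) (T : S ≃+ (Fin 2 → K)) (hT : ∀ s, T s = rep s 0)
    {k : ℕ} (hS : EuclidBound S k)
    (hnorm : ∀ (m : ℕ) (N M : Matrix (Unit ⊕ Fin m) (Unit ⊕ Fin m) S) (c : ℕ), c ≠ 0 →
      N * M = (c : Matrix (Unit ⊕ Fin m) (Unit ⊕ Fin m) S) → Algebra.norm ℤ (sdet rep M) ≠ 0 ∧
        ((Algebra.norm ℤ (sdet rep M)).natAbs ≤ k → (Algebra.norm ℤ (sdet rep M)).natAbs = 1)) :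
    HasCancel S := by
  intro m V U h
  obtain ⟨hne, f, hf⟩ := exists_injective_of_frame φ hφ h
  obtain ⟨_, ⟨p, rfl⟩, hy, F, hF⟩ := hS (LinearMap.range f) (by
    intro hb
    obtain ⟨p, hp, hp0⟩ := Submodule.exists_mem_ne_zero_of_ne_bot hne
    have h1 : f ⟨p, hp⟩ = 0 := LinearMap.congr_fun (LinearMap.range_eq_bot.1 hb) _
    exact hp0 (congrArg Subtype.val ((injective_iff_map_eq_zero f).1 hf _ h1)))
  have hp0 : p ≠ 0 := fun h0 => hy (by rw [h0, map_zero])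
  have hV : ∀ v, f (kerProj h (v ᵥ* V)) = 0 := by
    intro v
    have : kerProj h (v ᵥ* V) = 0 := by
      ext1
      rw [coe_kerProj, vecMul_vecMul v, h, vecMul_one, sub_self]
      rfl
    rw [this, map_zero]
  let M : Matrix (Unit ⊕ Fin m) (Unit ⊕ Fin m) S := fromRows (Matrix.of fun _ => p.1) V
  have hM : ∀ s v, Sum.elim (fun _ : Unit => s) v ᵥ* M = s • p.1 + v ᵥ* V := by
    intro s v
    ext j
    simp [M, vecMul, dotProduct]
  let Q := (Unit ⊕ Fin m → S) ⧸ LinearMap.range M.vecMulLinear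
  have hFQ : ∀ x x' : Unit ⊕ Fin m → S, F (f (kerProj h x)) = F (f (kerProj h x')) →
      (Submodule.Quotient.mk x : Q) = Submodule.Quotient.mk x' := by
    intro x x' hx
    obtain ⟨s, hs⟩ := hF _ ⟨_, rfl⟩ _ ⟨_, rfl⟩ hx
    rw [← map_sub, ← map_sub, ← smul_eq_mul, ← map_smul] at hs
    have h2 := congrArg Subtype.val (hf hs)
    rw [coe_kerProj] at h2
    rw [Submodule.Quotient.eq]
    refine ⟨Sum.elim (fun _ => s) ((x - x') ᵥ* U), ?_⟩
    change _ ᵥ* M = _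
    rw [hM, ← Submodule.coe_smul, ← h2, sub_add_cancel]
  have hinj : Function.Injective fun q : Q => F (f (kerProj h q.out)) := fun q q' hq => by
    have := hFQ _ _ hq
    rwa [Submodule.Quotient.mk_out, Submodule.Quotient.mk_out] at this
  have hfin : Finite Q := Finite.of_injective _ hinj
  have hk : Nat.card Q ≤ k := by
    simpa using Nat.card_le_card_of_injective _ hinj
  have hcQ : ∀ x : Unit ⊕ Fin m → S, ∃ y, y ᵥ* M = Nat.card Q • x := by
    intro x
    have h1 : (Submodule.Quotient.mk (Nat.card Q • x) : Q) = 0 := by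
      rw [Submodule.Quotient.mk_smul]
      exact card_nsmul_eq_zero'
    exact (Submodule.Quotient.mk_eq_zero _).1 h1
  choose g hg using hcQ
  obtain ⟨hn0, hn1⟩ := hnorm m (Matrix.of fun i => g (Pi.single i 1)) M (Nat.card Q)
    Nat.card_pos.ne' (by
      refine funext fun i => (hg (Pi.single i 1)).trans ?_
      ext j
      rw [← nsmul_one, Pi.smul_apply, Matrix.smul_apply, one_apply, Pi.single_apply]
      simp only [eq_comm])
  have hcard : Nat.card Q = 1 :=
    (card_quotient_range rep T hT M hn0).trans
      (hn1 (card_quotient_range rep T hT M hn0 ▸ hk))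
  have hsub : Subsingleton Q := (Nat.card_eq_one_iff_unique.1 hcard).1
  refine ⟨Frame.ofEquiv h (LinearEquiv.ofBijective (LinearMap.toSpanSingleton S _ p) ⟨?_, ?_⟩).symm⟩
  · rw [injective_iff_map_eq_zero]
    intro s hs
    obtain ⟨i, hi⟩ := Function.ne_iff.1 (fun h' => hp0 (Subtype.ext h') : p.1 ≠ 0)
    have h1 : s * p.1 i = 0 := congrFun (congrArg Subtype.val hs) i
    apply hφ
    rw [map_zero]
    have h2 := congrArg φ h1
    rw [map_mul, map_zero] at h2
    exact (mul_eq_zero.1 h2).resolve_right fun h3 => hi (hφ (h3.trans (map_zero φ).symm))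
  · intro q
    obtain ⟨y, hy⟩ := (Submodule.Quotient.mk_eq_zero _).1
      (Subsingleton.elim (Submodule.Quotient.mk q.1 : Q) 0)
    have hy' : y = Sum.elim (fun _ => y (Sum.inl ())) fun i => y (Sum.inr i) := by
      ext (i | i) <;> rfl
    change y ᵥ* M = q.1 at hy
    rw [hy', hM] at hy
    refine ⟨y (Sum.inl ()), hf ?_⟩
    have h1 := kerProj_of_mem h q
    rw [← hy, map_add] at h1
    have h2 := congrArg f h1
    rw [map_add, hV, add_zero, ← Submodule.coe_smul, kerProj_of_mem] at h2
    exact h2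

theorem exists_round {n : ℤ} (hn : 0 < n) (w : ℤ) :
    ∃ s : ℤ, 4 * (w - n * s) ^ 2 ≤ n ^ 2 := by
  refine ⟨(2 * w + n) / (2 * n), ?_⟩
  have h1 := Int.emod_add_mul_ediv (2 * w + n) (2 * n)
  have h2 := Int.emod_nonneg (2 * w + n) (by omega : 2 * n ≠ 0)
  have h3 := Int.emod_lt_of_pos (2 * w + n) (by omega : 0 < 2 * n)
  generalize (2 * w + n) / (2 * n) = s at *
  generalize (2 * w + n) % (2 * n) = r at *
  have h4 : 2 * (w - n * s) = r - n := by linarith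
  nlinarith

/-- An integer left ideal has a nonzero element of minimal norm. -/
theorem exists_minimal {S : Type} [Ring S] (N : S → ℤ) (hN : ∀ x, 0 ≤ N x) (J : Submodule S S)
    (hJ : J ≠ ⊥) : ∃ y ∈ J, y ≠ 0 ∧ ∀ x ∈ J, N x < N y → x = 0 := by
  obtain ⟨y₀, hy₀, h₀⟩ := Submodule.exists_mem_ne_zero_of_ne_bot hJ
  let A : Set S := {y | y ∈ J ∧ y ≠ 0}
  have hA : A.Nonempty := ⟨y₀, hy₀, h₀⟩
  refine ⟨Function.argminOn (fun x => (N x).toNat) A hA,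
    (Function.argminOn_mem (fun x => (N x).toNat) A hA).1,
    (Function.argminOn_mem (fun x => (N x).toNat) A hA).2, fun x hx hlt => ?_⟩
  by_contra hx0
  have := Function.argminOn_le (fun x => (N x).toNat) A (a := x) ⟨hx, hx0⟩
  have h1 := hN x
  omega

/-- The reduced norm of the Lipschitz order. -/
def normA (x : VA) : ℤ := x.re ^ 2 + x.imI ^ 2 + x.imJ ^ 2 + x.imK ^ 2

/-- Quaternion conjugation on the Lipschitz order. -/
def conjA (x : VA) : VA := ⟨x.re, -x.imI, -x.imJ, -x.imK⟩

theorem normA_mul (x y : VA) : normA (x * y) = normA x * normA y := by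
  simp only [normA, QuaternionAlgebra.re_mul, QuaternionAlgebra.imI_mul,
    QuaternionAlgebra.imJ_mul, QuaternionAlgebra.imK_mul]
  ring

theorem normA_nonneg (x : VA) : 0 ≤ normA x := by
  simp only [normA]; positivity

theorem normA_eq_zero {x : VA} (h : normA x = 0) : x = 0 := by
  simp only [normA] at h
  ext <;> simp only [QuaternionAlgebra.re_zero, QuaternionAlgebra.imI_zero,
    QuaternionAlgebra.imJ_zero, QuaternionAlgebra.imK_zero] <;> nlinarith

theorem normA_conjA (x : VA) : normA (conjA x) = normA x := by
  simp [normA, conjA]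

theorem mul_conjA (x : VA) : x * conjA x = ⟨normA x, 0, 0, 0⟩ := by
  ext <;> simp [conjA, normA] <;> ring

theorem conjA_approx {n : ℤ} (hn : 0 < n) (w : VA) : ∃ s : VA,
    normA (w - s * ⟨n, 0, 0, 0⟩) < n ^ 2 ∨ (normA (w - s * ⟨n, 0, 0, 0⟩) = n ^ 2 ∧
      4 * (w.re - n * s.re) ^ 2 = n ^ 2) := by
  obtain ⟨a, ha⟩ := exists_round hn w.re
  obtain ⟨b, hb⟩ := exists_round hn w.imI
  obtain ⟨c, hc⟩ := exists_round hn w.imJ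
  obtain ⟨d, hd⟩ := exists_round hn w.imK
  refine ⟨⟨a, b, c, d⟩, ?_⟩
  have h : normA (w - (⟨a, b, c, d⟩ : VA) * ⟨n, 0, 0, 0⟩) = (w.re - n * a) ^ 2 +
      (w.imI - n * b) ^ 2 + (w.imJ - n * c) ^ 2 + (w.imK - n * d) ^ 2 := by
    simp [normA]; ring
  rw [h]
  rcases lt_or_ge ((w.re - n * a) ^ 2 +
      (w.imI - n * b) ^ 2 + (w.imJ - n * c) ^ 2 + (w.imK - n * d) ^ 2) (n ^ 2) with h | h
  · exact .inl h
  · exact .inr ⟨by linarith, by simp only; linarith⟩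

theorem euclidBoundA : EuclidBound VA 2 := by
  intro J hJ
  obtain ⟨y, hy, hy0, hmin⟩ := exists_minimal normA normA_nonneg J hJ
  refine ⟨y, hy, hy0, ?_⟩
  set n := normA y with hn
  have hn0 : 0 < n := (normA_nonneg y).lt_of_ne fun h => hy0 (normA_eq_zero h.symm)
  have key : ∀ x ∈ J, (∃ s, x = s * y) ∨ ∃ k : ℤ, 2 * (x * conjA y).re = n * (2 * k + 1) := by
    intro x hx
    obtain ⟨s, hs⟩ := conjA_approx hn0 (x * conjA y)
    have h1 : x * conjA y - s * ⟨n, 0, 0, 0⟩ = (x - s * y) * conjA y := by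
      rw [sub_mul, mul_assoc, mul_conjA]
    rw [h1, normA_mul, normA_conjA, ← hn] at hs
    rcases hs with hs | ⟨-, hs⟩
    · refine .inl ⟨s, sub_eq_zero.1 (hmin _ (J.sub_mem hx (J.smul_mem s hy)) ?_)⟩
      exact lt_of_mul_lt_mul_right (by rwa [← pow_two]) hn0.le
    · right
      have h2 : (2 * ((x * conjA y).re - n * s.re) - n) *
        (2 * ((x * conjA y).re - n * s.re) + n) = 0 := by linarith
      rcases mul_eq_zero.1 h2 with h2 | h2
      · exact ⟨s.re, by linarith⟩
      · exact ⟨s.re - 1, by linarith⟩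
  have hdiv : ∀ x ∈ J, n ∣ (x * conjA y).re → ∃ s, x = s * y := by
    intro x hx ⟨c, hc⟩
    refine (key x hx).resolve_right fun ⟨k, hk⟩ => ?_
    rw [hc] at hk
    have : 2 * c = 2 * k + 1 := mul_left_cancel₀ hn0.ne' (by linarith)
    omega
  classical
  refine ⟨fun x => if n ∣ (x * conjA y).re then 0 else 1, fun x hx x' hx' h => ?_⟩
  by_cases h1 : n ∣ (x * conjA y).re <;> by_cases h2 : n ∣ (x' * conjA y).re <;>
    simp only [h1, h2, if_true, if_false, zero_ne_one, one_ne_zero] at h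
  · obtain ⟨s, rfl⟩ := hdiv x hx h1
    obtain ⟨s', rfl⟩ := hdiv x' hx' h2
    exact ⟨s - s', (sub_mul _ _ _).symm⟩
  · refine hdiv _ (J.sub_mem hx hx') ?_
    rcases key x hx with ⟨s, rfl⟩ | ⟨k, hk⟩
    · exact (h1 (by rw [mul_assoc, mul_conjA]; simp [← hn])).elim
    rcases key x' hx' with ⟨s, rfl⟩ | ⟨k', hk'⟩
    · exact (h2 (by rw [mul_assoc, mul_conjA]; simp [← hn])).elim
    refine ⟨k - k', ?_⟩
    rw [sub_mul, QuaternionAlgebra.re_sub]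
    linarith

instance : DivisionRing (QuaternionAlgebra ℝ (-1) 0 (-1)) :=
  inferInstanceAs (DivisionRing (Quaternion ℝ))

instance : CharZero (QuaternionAlgebra ℝ (-1) 0 (-1)) :=
  charZero_of_injective_algebraMap
    (algebraMap ℝ (QuaternionAlgebra ℝ (-1) 0 (-1))).injective

theorem quadraticAlgebra_norm {R : Type} [CommRing R] [Nontrivial R] (a b x : R) :
    Algebra.norm R (⟨x, 0⟩ : QuadraticAlgebra R a b) = x ^ 2 := by
  have h := Algebra.norm_algebraMap (S := QuadraticAlgebra R a b) x
  rwa [QuadraticAlgebra.finrank_eq_two] at h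

/-- The coordinates in which `quatRep` is right multiplication. -/
def quatCoord {R : Type} [CommRing R] (a b c : R) :
    QuaternionAlgebra R a b c ≃+ (Fin 2 → QuadraticAlgebra R a b) where
  toFun q := ![⟨q.re, q.imI⟩, ⟨q.imJ, q.imK⟩]
  invFun v := ⟨(v 0).re, (v 0).im, (v 1).re, (v 1).im⟩
  left_inv _ := rfl
  right_inv v := by ext k <;> fin_cases k <;> rfl
  map_add' p q := by ext k <;> fin_cases k <;> rfl

theorem quatCoord_apply {R : Type} [CommRing R] {a b c : R} (q : QuaternionAlgebra R a b c) :
    quatCoord a b c q = quatRep a b c q 0 := by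
  rw [quatRep_apply]
  ext k <;> fin_cases k <;> rfl

theorem realA_injective : Function.Injective realA := by
  intro x y h
  simp only [realA_apply, QuaternionAlgebra.mk.injEq, Int.cast_inj] at h
  exact QuaternionAlgebra.ext h.1 h.2.1 h.2.2.1 h.2.2.2

theorem hasCancelA : HasCancel VA := by
  refine hasCancel_of_euclidBound realA realA_injective (quatRep (-1 : ℤ) 0 (-1)) (quatCoord _ _ _)
    quatCoord_apply euclidBoundA fun m N M c hc h => ?_
  obtain ⟨p, hp, h1⟩ := sdet_repA_pos (isUnit_map_of_mul_eq_natCast realA hc h)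
  rw [h1, quadraticAlgebra_norm]
  refine ⟨by positivity, fun h2 => ?_⟩
  have : p < 2 := by
    by_contra! h3
    have : 4 ≤ p ^ 2 := by nlinarith
    omega
  rw [show p = 1 by omega]
  rfl

/-! ### Simultaneous approximation by Eisenstein integers -/

/-- The norm form of the Eisenstein integers. -/
def eisForm (a b : ℤ) : ℤ := a ^ 2 - a * b + b ^ 2

theorem eisForm_nonneg (a b : ℤ) : 0 ≤ eisForm a b := by
  rw [eisForm]; nlinarith [sq_nonneg (a - b), sq_nonneg a, sq_nonneg b]

theorem eis_aux {n w₁ w₂ : ℤ} (hn : 0 < n) (h₁ : 0 ≤ w₁) (h₂ : 0 ≤ w₂) (h₁' : w₁ ≤ n - w₁ - w₂)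
    (h₂' : w₂ ≤ n - w₁ - w₂) :
    8 * (w₁ ^ 2 + w₁ * w₂ + w₂ ^ 2) < n ^ 2 ∨
    8 * (w₁ ^ 2 + w₁ * w₂ + w₂ ^ 2) - 6 * n * (w₁ + w₂) + n ^ 2 < 0 ∨
    (8 * (w₁ ^ 2 + w₁ * w₂ + w₂ ^ 2) - 6 * n * (w₁ + w₂) + n ^ 2 = 0 ∧
      (2 * w₁ = n ∧ w₂ = 0 ∨ w₁ = 0 ∧ 2 * w₂ = n)) := by
  rcases le_or_gt (3 * (w₁ + w₂)) n with h | h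
  · left
    nlinarith [mul_nonneg h₁ h₂]
  right
  rcases lt_trichotomy (2 * (w₁ + w₂)) n with h' | h' | h'
  · left
    nlinarith [mul_nonneg h₁ h₂, mul_pos (by linarith : 0 < 4 * (w₁ + w₂) - n) (sub_pos.2 h')]
  · obtain rfl : n = 2 * (w₁ + w₂) := h'.symm
    rcases h₁.eq_or_lt with rfl | h1
    · exact .inr ⟨by ring, .inr ⟨rfl, by ring⟩⟩
    rcases h₂.eq_or_lt with rfl | h2
    · exact .inr ⟨by ring, .inl ⟨by ring, rfl⟩⟩
    left
    nlinarith [mul_pos h1 h2]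
  · left
    have h3 : 0 ≤ (n - w₁ - w₂ - w₁) * (n - w₁ - w₂ - w₂) :=
      mul_nonneg (by linarith) (by linarith)
    nlinarith [mul_pos (sub_pos.2 h') (by linarith : 0 < 3 * n - 4 * (w₁ + w₂))]

/-- Half points. -/
def IsHalf (n a b : ℤ) : Prop := n ∣ 2 * a ∧ n ∣ 2 * b ∧ ¬(n ∣ a ∧ n ∣ b)

/-- Simultaneous approximation of `U` and `√-3 U` by Eisenstein integers. -/
def EisApprox (n a b : ℤ) : Prop := ∃ l₁ l₂ m₁ m₂ : ℤ,
  2 * (eisForm (a - n * l₁) (b - n * l₂) +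
    eisForm (a - 2 * b - n * m₁) (2 * a - b - n * m₂)) < n ^ 2 ∨
  (2 * (eisForm (a - n * l₁) (b - n * l₂) +
    eisForm (a - 2 * b - n * m₁) (2 * a - b - n * m₂)) = n ^ 2 ∧ IsHalf n a b)

theorem isHalf_of_triangle {n a b v v' w e e' : ℤ} (hn : 0 < n) (hw : 2 * w = n)
    (ha : a = n * v + w * e) (hb : b = n * v' + w * e') (h : eisForm e e' = 1) :
    IsHalf n a b := by
  refine ⟨⟨2 * v + e, by rw [ha, ← hw]; ring⟩, ⟨2 * v' + e', by rw [hb, ← hw]; ring⟩, ?_⟩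
  rintro ⟨⟨c, hc⟩, ⟨d, hd⟩⟩
  have hw0 : w ≠ 0 := by omega
  have h1 : e = 2 * (c - v) := by
    apply mul_left_cancel₀ hw0
    rw [← hw] at hc ha
    linarith
  have h2 : e' = 2 * (d - v') := by
    apply mul_left_cancel₀ hw0
    rw [← hw] at hd hb
    linarith
  rw [h1, h2, eisForm] at h
  have : 4 * ((c - v) ^ 2 - (c - v) * (d - v') + (d - v') ^ 2) = 1 := by linarith
  omega

theorem eisApprox_of_triangle {n w₁ w₂ a b v v' e e' f f' g g' : ℤ} (hn : 0 < n) (h₁ : 0 ≤ w₁)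
    (h₂ : 0 ≤ w₂) (h₁' : w₁ ≤ n - w₁ - w₂) (h₂' : w₂ ≤ n - w₁ - w₂)
    (ha : a = n * v + w₁ * e + w₂ * f) (hb : b = n * v' + w₁ * e' + w₂ * f')
    (he : eisForm e e' = 1) (hf : eisForm f f' = 1)
    (hef : 2 * e * f - e * f' - e' * f + 2 * e' * f' = 1)
    (hg : 3 * g = e + f - 2 * (e' + f')) (hg' : 3 * g' = 2 * (e + f) - (e' + f')) :
    EisApprox n a b := by
  have hQ : eisForm (a - n * v) (b - n * v') = w₁ ^ 2 + w₁ * w₂ + w₂ ^ 2 := by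
    rw [ha, hb]
    rw [eisForm] at he hf ⊢
    linear_combination w₁ ^ 2 * he + w₁ * w₂ * hef + w₂ ^ 2 * hf
  have hQ' : eisForm (a - 2 * b - n * (v - 2 * v')) (2 * a - b - n * (2 * v - v')) =
      3 * (w₁ ^ 2 + w₁ * w₂ + w₂ ^ 2) := by
    rw [← hQ, eisForm, eisForm]; ring
  have hQ'' : eisForm (a - 2 * b - n * (v - 2 * v' + g)) (2 * a - b - n * (2 * v - v' + g')) =
      3 * (w₁ ^ 2 + w₁ * w₂ + w₂ ^ 2) - 3 * n * (w₁ + w₂) + n ^ 2 := by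
    have h1 : 3 * (a - 2 * b - n * (v - 2 * v' + g)) =
        ((3 * w₁ - n) * e + (3 * w₂ - n) * f) - 2 * ((3 * w₁ - n) * e' + (3 * w₂ - n) * f') := by
      rw [ha, hb]; linear_combination -n * hg
    have h2 : 3 * (2 * a - b - n * (2 * v - v' + g')) =
        2 * ((3 * w₁ - n) * e + (3 * w₂ - n) * f) - ((3 * w₁ - n) * e' + (3 * w₂ - n) * f') := by
      rw [ha, hb]; linear_combination -n * hg'
    generalize a - 2 * b - n * (v - 2 * v' + g) = X at *
    generalize 2 * a - b - n * (2 * v - v' + g') = Y at *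
    have h3 : 9 * eisForm X Y = (3 * X) ^ 2 - (3 * X) * (3 * Y) + (3 * Y) ^ 2 := by
      rw [eisForm]; ring
    rw [h1, h2] at h3
    rw [eisForm] at he hf
    have h4 : 9 * eisForm X Y = 9 * (3 * (w₁ ^ 2 + w₁ * w₂ + w₂ ^ 2) - 3 * n * (w₁ + w₂) + n ^ 2) := by
      rw [h3]
      linear_combination 3 * (3 * w₁ - n) ^ 2 * he + 3 * (3 * w₁ - n) * (3 * w₂ - n) * hef +
        3 * (3 * w₂ - n) ^ 2 * hf
    linarith
  rcases eis_aux hn h₁ h₂ h₁' h₂' with h | h | ⟨h, h'⟩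
  · exact ⟨v, v', _, _, .inl (by rw [hQ, hQ']; linarith)⟩
  · exact ⟨v, v', _, _, .inl (by rw [hQ, hQ'']; linarith)⟩
  · refine ⟨v, v', _, _, .inr ⟨by rw [hQ, hQ'']; linarith, ?_⟩⟩
    rcases h' with ⟨hw, rfl⟩ | ⟨rfl, hw⟩
    · exact isHalf_of_triangle (v := v) (v' := v') hn hw (by linarith) (by linarith) he
    · exact isHalf_of_triangle (v := v) (v' := v') hn hw (by linarith) (by linarith) hf

theorem eisApprox {n : ℤ} (hn : 0 < n) (a b : ℤ) : EisApprox n a b := by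
  have ha := Int.emod_add_mul_ediv a n
  have hb := Int.emod_add_mul_ediv b n
  have ha1 := Int.emod_nonneg a hn.ne'
  have hb1 := Int.emod_nonneg b hn.ne'
  have ha2 := Int.emod_lt_of_pos a hn
  have hb2 := Int.emod_lt_of_pos b hn
  generalize a % n = r at *
  generalize b % n = s at *
  generalize a / n = q at *
  generalize b / n = q' at *
  rcases le_total s r with h | h
  · by_cases h1 : r - s ≤ n - r ∧ s ≤ n - r
    · exact eisApprox_of_triangle (w₁ := r - s) (w₂ := s) (v := q) (v' := q') (e := 1) (e' := 0)
        (f := 1) (f' := 1) (g := 0) (g' := 1) hn (by omega) (by omega) (by omega) (by omega)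
        (by linarith) (by linarith) rfl rfl rfl rfl rfl
    by_cases h2 : s ≤ r - s
    · exact eisApprox_of_triangle (w₁ := n - r) (w₂ := s) (v := q + 1) (v' := q') (e := -1)
        (e' := 0) (f := 0) (f' := 1) (g := -1) (g' := -1) hn (by omega) (by omega) (by omega)
        (by omega) (by linarith) (by linarith) rfl rfl rfl rfl rfl
    · exact eisApprox_of_triangle (w₁ := n - r) (w₂ := r - s) (v := q + 1) (v' := q' + 1)
        (e := -1) (e' := -1) (f := 0) (f' := -1) (g := 1) (g' := 0) hn (by omega) (by omega)
        (by omega) (by omega) (by linarith) (by linarith) rfl rfl rfl rfl rfl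
  · by_cases h1 : s - r ≤ n - s ∧ r ≤ n - s
    · exact eisApprox_of_triangle (w₁ := s - r) (w₂ := r) (v := q) (v' := q') (e := 0) (e' := 1)
        (f := 1) (f' := 1) (g := -1) (g' := 0) hn (by omega) (by omega) (by omega) (by omega)
        (by linarith) (by linarith) rfl rfl rfl rfl rfl
    by_cases h2 : r ≤ s - r
    · exact eisApprox_of_triangle (w₁ := n - s) (w₂ := r) (v := q) (v' := q' + 1) (e := 0)
        (e' := -1) (f := 1) (f' := 0) (g := 1) (g' := 1) hn (by omega) (by omega) (by omega)
        (by omega) (by linarith) (by linarith) rfl rfl rfl rfl rfl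
    · exact eisApprox_of_triangle (w₁ := n - s) (w₂ := s - r) (v := q + 1) (v' := q' + 1)
        (e := -1) (e' := -1) (f := -1) (f' := 0) (g := 0) (g' := -1) hn (by omega) (by omega)
        (by omega) (by omega) (by linarith) (by linarith) rfl rfl rfl rfl rfl

theorem exists_eis_third {n a b : ℤ} (h₁ : n ∣ a - 2 * b) (h₂ : n ∣ 2 * a - b) :
    ∃ l l' : ℤ, 3 * eisForm (a - n * l) (b - n * l') ≤ n ^ 2 := by
  obtain ⟨k, hk⟩ := h₁
  obtain ⟨k', hk'⟩ := h₂
  have hb : 3 * b = n * (k' - 2 * k) := by linarith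
  obtain ⟨c, r, hc, hr⟩ : ∃ c r : ℤ, k' - 2 * k = 3 * c + r ∧ r ^ 2 ≤ 1 := by
    refine ⟨(k' - 2 * k + 1) / 3, k' - 2 * k - 3 * ((k' - 2 * k + 1) / 3), by ring, ?_⟩
    have : -1 ≤ k' - 2 * k - 3 * ((k' - 2 * k + 1) / 3) := by omega
    have : k' - 2 * k - 3 * ((k' - 2 * k + 1) / 3) ≤ 1 := by omega
    nlinarith
  refine ⟨k + 2 * c, c, ?_⟩
  have h1 : a - n * (k + 2 * c) = 2 * (b - n * c) := by linarith
  have h2 : 3 * (b - n * c) = n * r := by rw [hc] at hb; linarith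
  have h3 : 3 * eisForm (2 * (b - n * c)) (b - n * c) = (3 * (b - n * c)) ^ 2 := by
    rw [eisForm]; ring
  rw [h1, h3, h2, mul_pow]
  nlinarith [sq_nonneg n]

/-! ### Cancellation over the quaternion order over `ℤ[√3]` -/

/-- The coordinates over the Eisenstein integers of an element of the order `VB`. -/
def eisCoord (x : VB) : Fin 4 → ℤ × ℤ :=
  ![(x.re.re + 2 * x.imI.im, x.imI.im), (-x.re.im, -(2 * x.re.im + x.imI.re)),
    (x.imJ.re + 2 * x.imK.im, x.imK.im), (-x.imJ.im, -(2 * x.imJ.im + x.imK.re))]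

theorem exists_eisCoord (f : Fin 4 → ℤ × ℤ) : ∃ x, eisCoord x = f := by
  refine ⟨⟨⟨(f 0).1 - 2 * (f 0).2, -(f 1).1⟩, ⟨2 * (f 1).1 - (f 1).2, (f 0).2⟩,
    ⟨(f 2).1 - 2 * (f 2).2, -(f 3).1⟩, ⟨2 * (f 3).1 - (f 3).2, (f 2).2⟩⟩, ?_⟩
  ext k <;> fin_cases k <;> simp [eisCoord]

/-- An integer, as an element of the order `VB`. -/
def intB (n : ℤ) : VB := ⟨⟨n, 0⟩, 0, 0, 0⟩

/-- A square root of `-3` in the order `VB`. -/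
def thetaB : VB := ⟨⟨-3, 0⟩, ⟨0, 2⟩, 0, 0⟩

theorem eisCoord_sub (x y : VB) (k : Fin 4) : eisCoord (x - y) k = eisCoord x k - eisCoord y k := by
  fin_cases k <;> ext <;> simp [eisCoord] <;> ring

theorem eisCoord_mul_intB (x : VB) (n : ℤ) (k : Fin 4) :
    eisCoord (x * intB n) k = (n * (eisCoord x k).1, n * (eisCoord x k).2) := by
  fin_cases k <;> ext <;> simp [eisCoord, intB] <;> ring

theorem eisCoord_thetaB_mul (x : VB) (k : Fin 4) : eisCoord (thetaB * x) k =
    ((eisCoord x k).1 - 2 * (eisCoord x k).2, 2 * (eisCoord x k).1 - (eisCoord x k).2) := by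
  fin_cases k <;> ext <;> simp [eisCoord, thetaB] <;> ring

/-- The reduced norm on the order `VB`. -/
def nrdB (x : VB) : RB := (x * star x).re

theorem mul_star_eq_nrdB (x : VB) : x * star x = (nrdB x : VB) :=
  QuaternionAlgebra.mul_star_eq_coe x

theorem nrdB_mul (x y : VB) : nrdB (x * y) = nrdB x * nrdB y := by
  have h : (nrdB (x * y) : VB) = (nrdB x * nrdB y : RB) := by
    rw [← mul_star_eq_nrdB, star_mul, mul_assoc, ← mul_assoc y, mul_star_eq_nrdB,
      QuaternionAlgebra.coe_commutes, ← mul_assoc, mul_star_eq_nrdB, ← QuaternionAlgebra.coe_mul]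
  exact congrArg QuaternionAlgebra.re h

theorem nrdB_eq (x : VB) : nrdB x = x.re ^ 2 + ⟨0, 1⟩ * x.re * x.imI + x.imI ^ 2 +
    (x.imJ ^ 2 + ⟨0, 1⟩ * x.imJ * x.imK + x.imK ^ 2) := by
  simp only [nrdB, QuaternionAlgebra.re_mul, QuaternionAlgebra.re_star,
    QuaternionAlgebra.imI_star, QuaternionAlgebra.imJ_star, QuaternionAlgebra.imK_star]
  ring

theorem re_nrdB (x : VB) :
    (nrdB x).re = ∑ k, eisForm (eisCoord x k).1 (eisCoord x k).2 := by
  rw [nrdB_eq]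
  simp only [eisCoord, eisForm, Fin.sum_univ_four, pow_two]
  simp
  ring

/-- The absolute norm on the order `VB`. -/
def normB : VB →* ℤ where
  toFun x := QuadraticAlgebra.norm (nrdB x)
  map_one' := by
    rw [show nrdB 1 = 1 by simp [nrdB], map_one]
  map_mul' x y := by rw [nrdB_mul, map_mul]

theorem normB_le (x : VB) : normB x ≤ (∑ k, eisForm (eisCoord x k).1 (eisCoord x k).2) ^ 2 := by
  rw [← re_nrdB]
  change QuadraticAlgebra.norm (nrdB x) ≤ _
  rw [QuadraticAlgebra.norm_def]
  nlinarith [sq_nonneg (nrdB x).im]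

theorem realRB_nrdB (s : ℝ) (hs : s * s = 3) (x : VB) : realRB s hs (nrdB x) =
    (realRB s hs x.re + s / 2 * realRB s hs x.imI) ^ 2 + (realRB s hs x.imI / 2) ^ 2 +
    ((realRB s hs x.imJ + s / 2 * realRB s hs x.imK) ^ 2 + (realRB s hs x.imK / 2) ^ 2) := by
  rw [nrdB_eq]
  simp only [map_add, map_mul, map_pow]
  have h : realRB s hs ⟨0, 1⟩ = s := by simp [realRB_apply]
  rw [h]
  have h2 : s ^ 2 = 3 := by rw [pow_two, hs]
  ring_nf
  rw [h2]
  ring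

theorem normB_eq_mul (x : VB) : (normB x : ℝ) = realRB √3 (by norm_num) (nrdB x) *
    realRB (-√3) (by norm_num) (nrdB x) := by
  change ((QuadraticAlgebra.norm (nrdB x) : ℤ) : ℝ) = _
  have h2 : √3 ^ 2 = 3 := by norm_num
  rw [QuadraticAlgebra.norm_def, realRB_apply, realRB_apply]
  push_cast
  ring_nf
  rw [h2]

theorem normB_nonneg (x : VB) : 0 ≤ normB x := by
  have h : (0 : ℝ) ≤ normB x := by
    rw [normB_eq_mul, realRB_nrdB, realRB_nrdB]
    positivity
  exact_mod_cast h

theorem realRB_eq_zero {s : ℝ} {hs : s * s = 3} {r : RB} (h : realRB s hs r = 0) : r = 0 := by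
  rw [realRB_apply] at h
  have hirr : Irrational s := by
    have h3 : Irrational √3 := Nat.Prime.irrational_sqrt (by norm_num : Nat.Prime 3)
    have : (s - √3) * (s + √3) = 0 := by
      have : √3 ^ 2 = 3 := by norm_num
      linarith
    rcases mul_eq_zero.1 this with h | h
    · rwa [sub_eq_zero.1 h]
    · rw [eq_neg_of_add_eq_zero_left h]
      exact h3.neg
  have h1 : r.im = 0 := by
    by_contra h0
    refine hirr ⟨-r.re / r.im, ?_⟩
    push_cast
    have : (r.im : ℝ) ≠ 0 := by exact_mod_cast h0
    field_simp
    linarith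
  rw [h1] at h
  ext
  · simpa using h
  · exact h1

theorem normB_eq_zero {x : VB} (h : normB x = 0) : x = 0 := by
  have key : ∀ s hs, realRB s hs (nrdB x) = 0 → x = 0 := by
    intro s hs h0
    rw [realRB_nrdB] at h0
    have h1 : realRB s hs x.imI = 0 := by nlinarith [sq_nonneg (realRB s hs x.imI)]
    have h2 : realRB s hs x.imK = 0 := by nlinarith [sq_nonneg (realRB s hs x.imK)]
    rw [h1, h2] at h0
    have h3 : realRB s hs x.re = 0 := by nlinarith
    have h4 : realRB s hs x.imJ = 0 := by nlinarith
    exact QuaternionAlgebra.ext (realRB_eq_zero h3) (realRB_eq_zero h1) (realRB_eq_zero h4)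
      (realRB_eq_zero h2)
  have h' : (normB x : ℝ) = 0 := by exact_mod_cast h
  rw [normB_eq_mul] at h'
  rcases mul_eq_zero.1 h' with h | h
  · exact key _ _ h
  · exact key _ _ h

theorem normB_intB (n : ℤ) : normB (intB n) = n ^ 4 := by
  change QuadraticAlgebra.norm (nrdB (intB n)) = _
  rw [nrdB_eq]
  simp [intB, QuadraticAlgebra.norm_def, pow_two]
  ring

theorem exists_mul_eq_intB (y : VB) : ∃ y', y * y' = intB (normB y) := by
  refine ⟨star y * (star (nrdB y) : RB), ?_⟩
  rw [← mul_assoc, mul_star_eq_nrdB, ← QuaternionAlgebra.coe_mul,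
    ← QuadraticAlgebra.algebraMap_norm_eq_mul_star]
  rfl

theorem euclidBoundB : EuclidBound VB 13 := by
  intro J hJ
  obtain ⟨y, hy, hy0, hmin⟩ := exists_minimal normB normB_nonneg J hJ
  refine ⟨y, hy, hy0, ?_⟩
  obtain ⟨y', hy'⟩ := exists_mul_eq_intB y
  set n := normB y with hn
  have hn0 : 0 < n := (normB_nonneg y).lt_of_ne fun h => hy0 (normB_eq_zero h.symm)
  have hyy' : n * normB y' = n ^ 4 := by rw [← normB_intB, ← hy', map_mul]
  have hy'0 : 0 ≤ normB y' := normB_nonneg y'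
  have hmul : ∀ s : VB, s * y * y' = s * intB n := fun s => by rw [mul_assoc, hy']
  have hred : ∀ x ∈ J, ∀ s : VB, ∑ k, eisForm (eisCoord (x * y' - s * intB n) k).1
      (eisCoord (x * y' - s * intB n) k).2 < n ^ 2 → x = s * y := by
    intro x hx s hs
    refine sub_eq_zero.1 (hmin _ (J.sub_mem hx (J.smul_mem s hy)) ?_)
    have h1 : x * y' - s * intB n = (x - s * y) * y' := by rw [sub_mul, hmul]
    have h2 := normB_le (x * y' - s * intB n)
    rw [h1] at h2 hs
    rw [map_mul] at h2
    have h0 : 0 ≤ ∑ k, eisForm (eisCoord ((x - s * y) * y') k).1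
      (eisCoord ((x - s * y) * y') k).2 := Finset.sum_nonneg fun k _ => eisForm_nonneg _ _
    have h3 : normB (x - s * y) * normB y' < n * normB y' := by
      rw [hyy']
      nlinarith
    exact lt_of_mul_lt_mul_right h3 hy'0
  have hmemθ : ∀ x ∈ J, thetaB * x ∈ J := fun x hx => J.smul_mem _ hx
  let a : VB → Fin 4 → ℤ := fun x k => (eisCoord (x * y') k).1
  let b : VB → Fin 4 → ℤ := fun x k => (eisCoord (x * y') k).2
  have ha : ∀ x x' k, a (x - x') k = a x k - a x' k := fun x x' k => by
    simp only [a, sub_mul, eisCoord_sub]; rfl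
  have hb : ∀ x x' k, b (x - x') k = b x k - b x' k := fun x x' k => by
    simp only [b, sub_mul, eisCoord_sub]; rfl
  have haθ : ∀ x k, a (thetaB * x) k = a x k - 2 * b x k := fun x k => by
    simp only [a, b, mul_assoc, eisCoord_thetaB_mul]
  have hbθ : ∀ x k, b (thetaB * x) k = 2 * a x k - b x k := fun x k => by
    simp only [a, b, mul_assoc, eisCoord_thetaB_mul]
  have hred' : ∀ x ∈ J, ∀ l l' : Fin 4 → ℤ,
      ∑ k, eisForm (a x k - n * l k) (b x k - n * l' k) < n ^ 2 → ∃ s, x = s * y := by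
    intro x hx l l' h
    obtain ⟨s, hs⟩ := exists_eisCoord fun k => (l k, l' k)
    refine ⟨s, hred x hx s ?_⟩
    simpa only [eisCoord_sub, eisCoord_mul_intB, hs, Prod.fst_sub, Prod.snd_sub] using h
  have hdvd : ∀ x, (∃ s, x = s * y) → ∀ k, n ∣ a x k ∧ n ∣ b x k := by
    rintro _ ⟨s, rfl⟩ k
    simp only [a, b, hmul, eisCoord_mul_intB]
    exact ⟨⟨_, rfl⟩, ⟨_, rfl⟩⟩
  have hthird : ∀ x ∈ J, (∃ s, thetaB * x = s * y) → n ∣ a x 0 ∧ n ∣ b x 0 → n ∣ a x 1 ∧ n ∣ b x 1 →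
      ∃ s, x = s * y := by
    intro x hx hθ ⟨⟨l0, h0⟩, ⟨l0', h0'⟩⟩ ⟨⟨l1, h1⟩, ⟨l1', h1'⟩⟩
    have h := hdvd _ hθ
    simp only [haθ, hbθ] at h
    obtain ⟨l2, l2', h2⟩ := exists_eis_third (h 2).1 (h 2).2
    obtain ⟨l3, l3', h3⟩ := exists_eis_third (h 3).1 (h 3).2
    refine hred' x hx ![l0, l1, l2, l3] ![l0', l1', l2', l3'] ?_
    simp only [Fin.sum_univ_four, Matrix.cons_val, h0, h0', h1, h1', sub_self]
    have : eisForm 0 0 = 0 := rfl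
    nlinarith
  have key : ∀ x ∈ J, (∃ s, thetaB * x = s * y) ∨ ∀ k, IsHalf n (a x k) (b x k) := by
    intro x hx
    choose l l' m m' h using fun k => eisApprox hn0 (a x k) (b x k)
    have hle : ∀ k, 2 * (eisForm (a x k - n * l k) (b x k - n * l' k) +
        eisForm (a x k - 2 * b x k - n * m k) (2 * a x k - b x k - n * m' k)) ≤ n ^ 2 :=
      fun k => (h k).elim le_of_lt fun h => h.1.le
    rcases lt_or_ge (∑ k, eisForm (a x k - n * l k) (b x k - n * l' k)) (n ^ 2) with h1 | h1
    · obtain ⟨s, hs⟩ := hred' x hx l l' h1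
      exact .inl ⟨thetaB * s, by rw [hs, mul_assoc]⟩
    rcases lt_or_ge (∑ k, eisForm (a (thetaB * x) k - n * m k) (b (thetaB * x) k - n * m' k))
      (n ^ 2) with h2 | h2
    · exact .inl (hred' _ (hmemθ x hx) m m' h2)
    right
    simp only [haθ, hbθ] at h2
    by_contra! hcon
    obtain ⟨k₀, hk₀⟩ := hcon
    have h3 := (h k₀).resolve_right fun h => hk₀ h.2
    have h4 := Finset.sum_lt_sum (fun k _ => hle k) ⟨k₀, Finset.mem_univ _, h3⟩
    rw [← Finset.mul_sum, Finset.sum_add_distrib] at h4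
    simp only [Finset.sum_const, Finset.card_univ, Fintype.card_fin, nsmul_eq_mul] at h4
    push_cast at h4
    linarith
  have hthree : ∀ x, (∃ s, thetaB * x = s * y) → ∀ k, ∃ c, 3 * b x k = n * c := by
    intro x hx k
    have h := hdvd _ hx k
    simp only [haθ, hbθ] at h
    obtain ⟨⟨c, hc⟩, ⟨d, hd⟩⟩ := h
    exact ⟨d - 2 * c, by linarith⟩
  have hthree' : ∀ x, (∃ s, thetaB * x = s * y) → ∀ k, 3 * n ∣ 3 * b x k →
      n ∣ a x k ∧ n ∣ b x k := by
    intro x hx k hk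
    have h1 : n ∣ b x k := (mul_dvd_mul_iff_left (by norm_num : (3 : ℤ) ≠ 0)).1 hk
    have h2 := (hdvd _ hx k).1
    rw [haθ] at h2
    exact ⟨(dvd_sub_left (h1.mul_left 2)).1 h2, h1⟩
  classical
  let e : (ZMod 3 × ZMod 3) ⊕ (ZMod 2 × ZMod 2) ≃ Fin 13 := Fintype.equivFinOfCardEq (by simp [ZMod.card])
  let F : VB → (ZMod 3 × ZMod 3) ⊕ (ZMod 2 × ZMod 2) := fun x =>
    if ∃ s, thetaB * x = s * y then
      .inl (((3 * b x 0 / n : ℤ) : ZMod 3), ((3 * b x 1 / n : ℤ) : ZMod 3))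
    else .inr (((2 * a x 0 / n : ℤ) : ZMod 2), ((2 * b x 0 / n : ℤ) : ZMod 2))
  refine ⟨fun x => e (F x), fun x hx x' hx' h => ?_⟩
  have hF := e.injective h
  simp only [F] at hF
  by_cases h1 : ∃ s, thetaB * x = s * y <;> by_cases h2 : ∃ s, thetaB * x' = s * y
  · rw [if_pos h1, if_pos h2] at hF
    simp only [Sum.inl.injEq, Prod.mk.injEq, ZMod.intCast_eq_intCast_iff_dvd_sub] at hF
    have hsub : ∃ s, thetaB * (x - x') = s * y := by
      obtain ⟨s, hs⟩ := h1
      obtain ⟨s', hs'⟩ := h2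
      exact ⟨s - s', by rw [mul_sub, hs, hs', sub_mul]⟩
    have hk : ∀ k, (3 : ℤ) ∣ 3 * b x' k / n - 3 * b x k / n → 3 * n ∣ 3 * b (x - x') k := by
      intro k hk
      obtain ⟨c, hc⟩ := hthree x h1 k
      obtain ⟨c', hc'⟩ := hthree x' h2 k
      rw [hc, hc', Int.mul_ediv_cancel_left _ hn0.ne', Int.mul_ediv_cancel_left _ hn0.ne'] at hk
      obtain ⟨d, hd⟩ := hk
      exact ⟨-d, by rw [hb]; linear_combination hc - hc' - n * hd⟩
    exact hthird _ (J.sub_mem hx hx') hsub (hthree' _ hsub 0 (hk 0 hF.1))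
      (hthree' _ hsub 1 (hk 1 hF.2))
  · rw [if_pos h1, if_neg h2] at hF
    exact absurd hF (by simp)
  · rw [if_neg h1, if_pos h2] at hF
    exact absurd hF (by simp)
  · rw [if_neg h1, if_neg h2] at hF
    simp only [Sum.inr.injEq, Prod.mk.injEq, ZMod.intCast_eq_intCast_iff_dvd_sub] at hF
    have g1 := (key x hx).resolve_left h1
    have g2 := (key x' hx').resolve_left h2
    have hk : ∀ u v : ℤ, n ∣ 2 * u → n ∣ 2 * v → (2 : ℤ) ∣ 2 * v / n - 2 * u / n → n ∣ u - v := by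
      rintro u v ⟨c, hc⟩ ⟨d, hd⟩ h
      rw [hc, hd, Int.mul_ediv_cancel_left _ hn0.ne', Int.mul_ediv_cancel_left _ hn0.ne'] at h
      obtain ⟨r, hr⟩ := h
      exact ⟨-r, by linarith [congrArg (n * ·) hr]⟩
    have hd0 : n ∣ a (x - x') 0 ∧ n ∣ b (x - x') 0 := by
      rw [ha, hb]
      exact ⟨hk _ _ (g1 0).1 (g2 0).1 hF.1, hk _ _ (g1 0).2.1 (g2 0).2.1 hF.2⟩
    rcases key _ (J.sub_mem hx hx') with hθ | hh
    · refine hthird _ (J.sub_mem hx hx') hθ hd0 (hthree' _ hθ 1 ?_)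
      obtain ⟨c, hc⟩ := hthree _ hθ 1
      have h3 : n ∣ 2 * b (x - x') 1 := by
        rw [hb, mul_sub]; exact dvd_sub (g1 1).2.1 (g2 1).2.1
      have h4 : n ∣ b (x - x') 1 := by
        have := dvd_sub (Dvd.intro c hc.symm : n ∣ 3 * b (x - x') 1) h3
        rwa [show 3 * b (x - x') 1 - 2 * b (x - x') 1 = b (x - x') 1 by ring] at this
      exact mul_dvd_mul_left 3 h4
    · exact absurd hd0 (hh 0).2.2

theorem realB_injective (s : ℝ) (hs : s * s = 3) : Function.Injective (realB s hs) := by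
  rw [injective_iff_map_eq_zero]
  intro x h
  have h0 : s ≠ 0 := by rintro rfl; norm_num at hs
  rw [realB_apply] at h
  have hI : x.imI = 0 := realRB_eq_zero (by simpa using congrArg QuaternionAlgebra.imI h)
  have hK : x.imK = 0 := realRB_eq_zero (by simpa using congrArg QuaternionAlgebra.imK h)
  rw [hI, hK, map_zero] at h
  exact QuaternionAlgebra.ext (realRB_eq_zero (by simpa using congrArg QuaternionAlgebra.re h)) hI
    (realRB_eq_zero (by simpa using congrArg QuaternionAlgebra.imJ h)) hK

instance : Module.Free ℤ KB := Module.Free.trans (R := ℤ) (S := RB)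

instance : Module.Finite ℤ KB := Module.Finite.trans RB KB

theorem norm_KB (r : RB) : Algebra.norm ℤ (⟨r, 0⟩ : KB) = QuadraticAlgebra.norm r ^ 2 := by
  have h1 : Algebra.norm ℤ (⟨r, 0⟩ : KB) = Algebra.norm ℤ (Algebra.norm RB (⟨r, 0⟩ : KB)) :=
    (Algebra.norm_norm).symm
  rw [h1, quadraticAlgebra_norm, map_pow, ← QuadraticAlgebra.det_toLinearMap_eq_norm]
  rfl

theorem hasCancelB : HasCancel VB := by
  refine hasCancel_of_euclidBound (realB √3 (by norm_num)) (realB_injective _ _)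
    (quatRep (-1 : RB) ⟨0, 1⟩ (-1)) (quatCoord _ _ _) quatCoord_apply euclidBoundB
    fun m N M c hc h => ?_
  obtain ⟨p, q, hp, hq, h1⟩ := sdet_repB_pos
    (fun s hs => isUnit_map_of_mul_eq_natCast (realB s hs) hc h)
  have h2 : QuadraticAlgebra.norm (⟨p, q⟩ : RB) = p ^ 2 - 3 * q ^ 2 := by
    rw [QuadraticAlgebra.norm_def]
    ring
  rw [h1, norm_KB, h2]
  refine ⟨by positivity, fun h3 => ?_⟩
  have h4 : p ^ 2 - 3 * q ^ 2 < 4 := by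
    by_contra! h4
    have : 16 ≤ (p ^ 2 - 3 * q ^ 2) ^ 2 := by nlinarith
    omega
  have h5 : p ^ 2 - 3 * q ^ 2 = 1 := by
    have h6 : ∀ a b : ZMod 12, a ^ 2 - 3 * b ^ 2 ≠ 2 ∧ a ^ 2 - 3 * b ^ 2 ≠ 3 := by decide +kernel
    have h7 := h6 p q
    have h8 : p ^ 2 - 3 * q ^ 2 ≠ 2 := fun h => h7.1 (by exact_mod_cast congrArg (Int.cast : ℤ → ZMod 12) h)
    have h9 : p ^ 2 - 3 * q ^ 2 ≠ 3 := fun h => h7.2 (by exact_mod_cast congrArg (Int.cast : ℤ → ZMod 12) h)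
    omega
  rw [h5]
  rfl

instance {R : Type} [Fintype R] (a b : R) : Fintype (QuadraticAlgebra R a b) :=
  Fintype.ofEquiv _ (QuadraticAlgebra.equivProd a b).symm

instance {R : Type} [Fintype R] (a b c : R) : Fintype (QuaternionAlgebra R a b c) :=
  Fintype.ofEquiv _ (QuaternionAlgebra.equivProd a b c).symm

theorem hasCancelInt : HasCancel ℤ := by
  refine HasCancel.of_equiv fun P _ hP m e₀ => ?_
  obtain rfl : hP = AddCommGroup.toIntModule P := Subsingleton.elim _ _
  let e : (P × (Fin m → ℤ)) ≃ₗ[ℤ] (Unit ⊕ Fin m → ℤ) := e₀.toAddEquiv.toIntLinearEquiv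
  have : Module.Finite ℤ (P × (Fin m → ℤ)) := Module.Finite.equiv e.symm
  have : Module.Free ℤ (P × (Fin m → ℤ)) := Module.Free.of_equiv e.symm
  have : Module.Finite ℤ P := Module.Finite.of_surjective (LinearMap.fst ℤ P (Fin m → ℤ))
    Prod.fst_surjective
  have : Module.Projective ℤ P := Module.Projective.of_split (LinearMap.inl ℤ P (Fin m → ℤ))
    (LinearMap.fst ℤ P (Fin m → ℤ)) rfl
  have : Module.Free ℤ P := inferInstance
  have h := e.finrank_eq
  rw [Module.finrank_prod, Module.finrank_fin_fun, Module.finrank_fintype_fun_eq_card,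
    Fintype.card_sum, Fintype.card_unit, Fintype.card_fin] at h
  exact ⟨LinearEquiv.ofFinrankEq P ℤ (by rw [Module.finrank_self]; omega)⟩

theorem hasCancel_quadratic {R T : Type} [CommRing R] [CommRing T] (g : R →+* T)
    (hex : ∀ a b, g a = g b → ∃ d, a = b + 2 * d) (h2 : ∀ a : R, 2 * a = 0 → a = 0)
    (hT : (2 : T) = 0) (hunits : ∀ u : Tˣ, ∃ b : Rˣ, (u : T) = g b) (h : HasCancel R) :
    HasCancel (QuadraticAlgebra R 1 0) := by
  let f : ∀ ε : R, ε * ε = 1 → QuadraticAlgebra R 1 0 →+* R := fun ε hε =>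
    quadHom (RingHom.id R) ε (fun r x => mul_comm _ _) (by simp [hε])
  have hf : ∀ ε hε s, f ε hε s = s.re + s.im * ε := fun ε hε s => by
    simp [f, quadHom_apply]
  have h11 : (-1 : R) * -1 = 1 := by simp
  refine HasCancel.of_square (f 1 (one_mul 1)) (f (-1) h11) g g (fun a b hab => ?_)
    (fun s t h1 h3 => ?_) (fun s => ?_) (fun u => ?_) h h
  · obtain ⟨d, rfl⟩ := hex a b hab
    refine ⟨⟨b + d, d⟩, ?_, ?_⟩ <;> rw [hf] <;> ring
  · simp only [hf] at h1 h3
    have h4 := sub_eq_zero.1 (h2 (s.im - t.im) (by linear_combination h1 - h3))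
    rw [h4] at h1
    exact QuadraticAlgebra.ext (add_right_cancel h1) h4
  · rw [hf _ (one_mul 1), hf _ h11, ← sub_eq_zero, ← map_sub,
      show s.re + s.im * 1 - (s.re + s.im * -1) = 2 * s.im by ring, map_mul, map_ofNat, hT, zero_mul]
  · obtain ⟨b, hb⟩ := hunits u
    exact ⟨1, b, by simp [hb]⟩

theorem hasCancelRO : HasCancel RO := by
  refine hasCancel_quadratic (Int.castRingHom (ZMod 2)) (fun a b h => ?_) (fun a h => by omega)
    (by decide) (fun u => ⟨1, ?_⟩) hasCancelInt
  · have := (ZMod.intCast_eq_intCast_iff_dvd_sub a b 2).1 h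
    obtain ⟨d, hd⟩ := this
    exact ⟨-d, by push_cast at hd; linarith⟩
  · revert u
    decide

theorem hasCancelZ : HasCancel VZ := by
  refine hasCancel_quadratic redO2 (fun a b h => ?_) (fun a h => ?_) (by decide +kernel)
    (fun u => ?_) hasCancelRO
  · rw [← sub_eq_zero, ← map_sub, redO2_apply] at h
    have h1 := congrArg QuadraticAlgebra.re h
    have h2 := congrArg QuadraticAlgebra.im h
    simp only [QuadraticAlgebra.re_zero, QuadraticAlgebra.im_zero,
      ZMod.intCast_zmod_eq_zero_iff_dvd] at h1 h2
    obtain ⟨d, hd⟩ := h1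
    obtain ⟨d', hd'⟩ := h2
    refine ⟨⟨d, d'⟩, ?_⟩
    rw [show (2 : RO) = ⟨2, 0⟩ by decide +kernel]
    simp only [QuadraticAlgebra.re_sub, QuadraticAlgebra.im_sub] at hd hd'
    ext <;> simp <;> omega
  · have h1 := congrArg QuadraticAlgebra.re h
    have h2 := congrArg QuadraticAlgebra.im h
    simp [two_mul] at h1 h2
    exact QuadraticAlgebra.ext (by simp; omega) (by simp; omega)
  · have h : ∀ u v : K2, u * v = 1 → u = 1 ∨ u = ⟨0, 1⟩ := by decide +kernel
    rcases h u _ u.mul_inv with h | h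
    · exact ⟨1, by rw [h]; simp⟩
    · refine ⟨⟨⟨0, 1⟩, ⟨0, 1⟩, by decide +kernel, by decide +kernel⟩, ?_⟩
      rw [h, redO2_apply]
      decide +kernel

/-- The subgroup of `x` with `e x ∈ s X`. -/
def divSubgroup {S : Type} [Ring S] (e s : S) (X : Type) [AddCommGroup X] [Module S X] :
    AddSubgroup X where
  carrier := {x | ∃ y, e • x = s • y}
  zero_mem' := ⟨0, by simp⟩
  add_mem' := by
    rintro _ _ ⟨y, h⟩ ⟨y', h'⟩
    exact ⟨y + y', by rw [smul_add, smul_add, h, h']⟩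
  neg_mem' := by
    rintro _ ⟨y, h⟩
    exact ⟨-y, by rw [smul_neg, smul_neg, h]⟩

theorem mem_divSubgroup {S : Type} [Ring S] {e s : S} {X : Type} [AddCommGroup X] [Module S X]
    {x : X} : x ∈ divSubgroup e s X ↔ ∃ y, e • x = s • y := Iff.rfl

theorem index_divSubgroup_prod {S : Type} [Ring S] (e s : S) (X Y : Type) [AddCommGroup X]
    [Module S X] [AddCommGroup Y] [Module S Y] : (divSubgroup e s (X × Y)).index =
    (divSubgroup e s X).index * (divSubgroup e s Y).index := by
  rw [← AddSubgroup.index_prod]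
  congr 1
  ext ⟨x, y⟩
  simp [mem_divSubgroup, AddSubgroup.mem_prod, Prod.ext_iff]

theorem index_divSubgroup_pi {S : Type} [Ring S] (e s : S) (ι : Type) [Fintype ι] :
    (divSubgroup e s (ι → S)).index = (divSubgroup e s S).index ^ Fintype.card ι := by
  have h := AddSubgroup.index_pi (fun _ : ι => divSubgroup e s S)
  rw [Finset.prod_const, Finset.card_univ] at h
  rw [← h]
  congr 1
  ext x
  simp [mem_divSubgroup, AddSubgroup.mem_pi, funext_iff, Classical.skolem]

theorem index_divSubgroup {S : Type} [Ring S] (e s : S) (P : Type) [AddCommGroup P] [Module S P]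
    {m : ℕ} (E : (P × (Fin m → S)) ≃ₗ[S] (Unit ⊕ Fin m → S)) (h : (divSubgroup e s S).index ≠ 0) :
    (divSubgroup e s P).index = (divSubgroup e s S).index := by
  have h1 : divSubgroup e s (P × (Fin m → S)) =
      (divSubgroup e s (Unit ⊕ Fin m → S)).comap E.toAddMonoidHom := by
    ext x
    refine ⟨?_, ?_⟩
    · rintro ⟨y, hy⟩
      exact ⟨E y, by simpa using congrArg E hy⟩
    · rintro ⟨y, hy⟩
      exact ⟨E.symm y, by simpa using congrArg E.symm hy⟩
  have h2 := congrArg AddSubgroup.index h1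
  rw [AddSubgroup.index_comap_of_surjective _ E.surjective, index_divSubgroup_prod,
    index_divSubgroup_pi, index_divSubgroup_pi, Fintype.card_sum, Fintype.card_unit,
    pow_add, pow_one] at h2
  exact mul_right_cancel₀ (pow_ne_zero _ h) h2

theorem exists_adapted_basis {M : Type} [AddCommGroup M] [Module.Free ℤ M] [Module.Finite ℤ M]
    (hM : Module.finrank ℤ M = 2) (N : Submodule ℤ M) (hN : N.toAddSubgroup.index = 3) :
    ∃ b : Module.Basis (Fin 2) ℤ M, ∀ x, x ∈ N ↔ 3 ∣ b.repr x 0 := by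
  let b₀ := Module.finBasisOfFinrankEq ℤ M hM
  have hr : Module.finrank ℤ N = Module.finrank ℤ M := by
    obtain ⟨n, snf⟩ := N.smithNormalForm b₀
    rw [hM, Module.finrank_eq_card_basis snf.bN, Fintype.card_fin]
    simpa using snf.toAddSubgroup_index_ne_zero_iff.1 (by rw [hN]; norm_num)
  obtain ⟨b, a, bN, h⟩ := Submodule.exists_smith_normal_form_of_rank_eq b₀ hr
  have hdet := Submodule.natAbs_det_basis_change b N bN
  rw [show ((↑) ∘ bN : Fin 2 → M) = fun i => a i • b i from funext h,
    show Nat.card (M ⧸ N) = 3 from hN,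
    show (b.det fun i => a i • b i) = _ from b.det.toMultilinearMap.map_smul_univ a b] at hdet
  have hdet' : (a 0).natAbs * (a 1).natAbs = 3 := by
    simpa [Module.Basis.det_self, Int.natAbs_mul] using hdet
  have hmem : ∀ x, x ∈ N ↔ a 0 ∣ b.repr x 0 ∧ a 1 ∣ b.repr x 1 := by
    intro x
    constructor
    · intro hx
      have h1 := congrArg Subtype.val (bN.sum_repr ⟨x, hx⟩)
      simp only [Fin.sum_univ_two, Submodule.coe_add, Submodule.coe_smul, h] at h1
      rw [← h1]
      simp
    · rintro ⟨⟨c, hc⟩, ⟨d, hd⟩⟩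
      rw [← b.sum_repr x, Fin.sum_univ_two, hc, hd, mul_comm, mul_comm (a 1), mul_smul, mul_smul,
        ← h, ← h]
      exact N.add_mem (N.smul_mem _ (bN 0).2) (N.smul_mem _ (bN 1).2)
  have hp : Nat.Prime 3 := by norm_num
  rcases (Nat.dvd_prime hp).1 (Dvd.intro _ hdet') with h0 | h0
  · have h1 : (a 1).natAbs = 3 := by rwa [h0, one_mul] at hdet'
    refine ⟨b.reindex (Equiv.swap 0 1), fun x => ?_⟩
    rw [hmem, ← Int.natAbs_dvd, ← Int.natAbs_dvd (a := a 1), h0, h1]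
    simp
  · have h1 : (a 1).natAbs = 1 := by rw [h0] at hdet'; omega
    refine ⟨b, fun x => ?_⟩
    rw [hmem, ← Int.natAbs_dvd, ← Int.natAbs_dvd (a := a 1), h0, h1]
    simp

/-- A hereditary order in the split quaternion algebra. -/
abbrev VH : Type := QuaternionAlgebra ℤ (-1) (-1) 1

/-- Elements of `VH` from the entries of the corresponding matrix. -/
def ofEntries (a b c d : ℤ) : VH :=
  a • (⟨0, -1, 1, 1⟩ : VH) + b • (⟨-1, -2, 1, 2⟩ : VH) + c • (⟨1, 2, -2, -1⟩ : VH) +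
    d • (⟨1, 1, -1, -1⟩ : VH)

theorem exists_ofEntries (s : VH) : ∃ a b c d, s = ofEntries a b c d := by
  refine ⟨s.re + s.imI + s.imJ + s.imK, -s.imI - s.imJ, s.imI + s.imK,
    s.re - 2 * s.imI - s.imJ - s.imK, ?_⟩
  ext <;> simp [ofEntries] <;> ring

theorem entries_ofEntries (a b c d : ℤ) : (ofEntries a b c d).re + (ofEntries a b c d).imI +
    (ofEntries a b c d).imJ + (ofEntries a b c d).imK = a ∧
    -(ofEntries a b c d).imI - (ofEntries a b c d).imJ = b := by
  constructor <;> simp [ofEntries] <;> ring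

theorem ofEntries_mul (a b c d a' b' c' d' : ℤ) : ofEntries a b c d * ofEntries a' b' c' d' =
    ofEntries (a * a' + 3 * b * c') (a * b' + b * d') (c * a' + d * c')
      (3 * c * b' + d * d') := by
  ext <;> simp [ofEntries] <;> ring

theorem ofEntries_injective {a b c d a' b' c' d' : ℤ} (h : ofEntries a b c d = ofEntries a' b' c' d') :
    a = a' ∧ b = b' ∧ c = c' ∧ d = d' := by
  have h1 := congrArg QuaternionAlgebra.re h
  have h2 := congrArg QuaternionAlgebra.imI h
  have h3 := congrArg QuaternionAlgebra.imJ h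
  have h4 := congrArg QuaternionAlgebra.imK h
  simp [ofEntries] at h1 h2 h3 h4
  omega

theorem ofEntries_add (a b c d a' b' c' d' : ℤ) : ofEntries a b c d + ofEntries a' b' c' d' =
    ofEntries (a + a') (b + b') (c + c') (d + d') := by
  ext <;> simp [ofEntries] <;> ring

theorem index_divSubgroup_three :
    (divSubgroup (ofEntries 1 0 0 0) (ofEntries 0 1 0 0) VH).index = 3 := by
  let f : VH →+ ZMod 3 :=
    { toFun := fun s => ((s.re + s.imI + s.imJ + s.imK : ℤ) : ZMod 3)
      map_zero' := by simp
      map_add' := fun s t => by simp; ring }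
  have h : divSubgroup (ofEntries 1 0 0 0) (ofEntries 0 1 0 0) VH = f.ker := by
    ext x
    obtain ⟨a, b, c, d, rfl⟩ := exists_ofEntries x
    have hf : f (ofEntries a b c d) = (a : ZMod 3) :=
      congrArg (Int.cast : ℤ → ZMod 3) (entries_ofEntries a b c d).1
    rw [AddMonoidHom.mem_ker, hf, ZMod.intCast_zmod_eq_zero_iff_dvd, mem_divSubgroup]
    constructor
    · rintro ⟨y, hy⟩
      obtain ⟨a', b', c', d', rfl⟩ := exists_ofEntries y
      rw [smul_eq_mul, smul_eq_mul, ofEntries_mul, ofEntries_mul] at hy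
      have := (ofEntries_injective hy).1
      push_cast
      omega
    · rintro ⟨k, rfl⟩
      refine ⟨ofEntries 0 0 k b, ?_⟩
      rw [smul_eq_mul, smul_eq_mul, ofEntries_mul, ofEntries_mul]
      simp
  rw [h, AddSubgroup.index_ker, AddMonoidHom.range_eq_top.2 fun x => ⟨⟨x.val, 0, 0, 0⟩, by simp [f]⟩]
  simp

theorem index_divSubgroup_four :
    (divSubgroup (ofEntries 1 0 0 0) (ofEntries 2 0 0 0) VH).index = 4 := by
  let f : VH →+ ZMod 2 × ZMod 2 :=
    { toFun := fun s =>
        (((s.re + s.imI + s.imJ + s.imK : ℤ) : ZMod 2), ((-s.imI - s.imJ : ℤ) : ZMod 2))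
      map_zero' := by simp
      map_add' := fun s t => by simp; constructor <;> ring }
  have h : divSubgroup (ofEntries 1 0 0 0) (ofEntries 2 0 0 0) VH = f.ker := by
    ext x
    obtain ⟨a, b, c, d, rfl⟩ := exists_ofEntries x
    have hf : f (ofEntries a b c d) = ((a : ZMod 2), (b : ZMod 2)) := by
      refine Prod.ext (congrArg (Int.cast : ℤ → ZMod 2) (entries_ofEntries a b c d).1)
        (congrArg (Int.cast : ℤ → ZMod 2) (entries_ofEntries a b c d).2)
    rw [AddMonoidHom.mem_ker, hf, Prod.mk_eq_zero, ZMod.intCast_zmod_eq_zero_iff_dvd,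
      ZMod.intCast_zmod_eq_zero_iff_dvd, mem_divSubgroup]
    constructor
    · rintro ⟨y, hy⟩
      obtain ⟨a', b', c', d', rfl⟩ := exists_ofEntries y
      rw [smul_eq_mul, smul_eq_mul, ofEntries_mul, ofEntries_mul] at hy
      have := ofEntries_injective hy
      push_cast
      omega
    · rintro ⟨⟨k, rfl⟩, ⟨l, rfl⟩⟩
      refine ⟨ofEntries k l 0 0, ?_⟩
      rw [smul_eq_mul, smul_eq_mul, ofEntries_mul, ofEntries_mul]
      simp
  rw [h, AddSubgroup.index_ker, AddMonoidHom.range_eq_top.2 fun x =>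
    ⟨⟨x.1.val - x.2.val + 2 * x.2.val, -x.2.val, 0, 0⟩, Prod.ext
      (by simp [f]; rw [show (2 : ZMod 2) = 0 from rfl]; ring) (by simp [f])⟩]
  simp

theorem ofEntries_smul_smul {P : Type} [AddCommGroup P] [Module VH P]
    (a b c d a' b' c' d' : ℤ) (p : P) : ofEntries a b c d • ofEntries a' b' c' d' • p =
    ofEntries (a * a' + 3 * b * c') (a * b' + b * d') (c * a' + d * c')
      (3 * c * b' + d * d') • p := by
  rw [smul_smul, ofEntries_mul]

theorem ofEntries_smul {P : Type} [AddCommGroup P] [Module VH P] (a b c d : ℤ) (p : P) :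
    ofEntries a b c d • p = a • ofEntries 1 0 0 0 • p + b • ofEntries 0 1 0 0 • p +
      c • ofEntries 0 0 1 0 • p + d • ofEntries 0 0 0 1 • p := by
  simp only [ofEntries, one_smul, zero_smul, add_zero, zero_add, add_smul, smul_assoc]

theorem nonempty_equiv_of_adapted {P : Type} [AddCommGroup P] [Module VH P]
    (htors : ∀ (n : ℤ) (p : P), n ≠ 0 → n • p = 0 → p = 0) {b₀ b₁ y : P}
    (hb₀ : ofEntries 1 0 0 0 • b₀ = b₀) (hy : ofEntries 0 1 0 0 • y = b₁)
    (hindep : ∀ s t : ℤ, s • b₀ + t • b₁ = 0 → s = 0 ∧ t = 0)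
    (hspan : ∀ x : P, ∃ s t : ℤ, ofEntries 1 0 0 0 • x = s • b₀ + t • b₁)
    (hspan' : ∀ x : P, ∃ s t : ℤ, ofEntries 0 1 0 0 • x = (3 * s) • b₀ + t • b₁) :
    Nonempty (P ≃ₗ[VH] VH) := by
  let g : P := ofEntries 1 0 0 0 • b₀ + ofEntries 0 0 0 1 • y
  have heg : ∀ p q r s, ofEntries 1 0 0 0 • ofEntries p q r s • g = p • b₀ + q • b₁ := by
    intro p q r s
    rw [smul_add, smul_add, ofEntries_smul_smul, ofEntries_smul_smul, ofEntries_smul_smul,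
      ofEntries_smul_smul, ofEntries_smul _ _ _ _ b₀, ofEntries_smul _ _ _ _ y, hb₀, hy]
    simp
  have hαg : ∀ p q r s, ofEntries 0 1 0 0 • ofEntries p q r s • g = (3 * r) • b₀ + s • b₁ := by
    intro p q r s
    rw [smul_add, smul_add, ofEntries_smul_smul, ofEntries_smul_smul, ofEntries_smul_smul,
      ofEntries_smul_smul, ofEntries_smul _ _ _ _ b₀, ofEntries_smul _ _ _ _ y, hb₀, hy]
    simp
  have hzero : ∀ x : P, ofEntries 1 0 0 0 • x = 0 → ofEntries 0 1 0 0 • x = 0 → x = 0 := by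
    intro x h1 h2
    have h3 : (3 : ℤ) • x =
        ofEntries 3 0 0 0 • ofEntries 1 0 0 0 • x + ofEntries 0 0 1 0 • ofEntries 0 1 0 0 • x := by
      have h4 : ofEntries 3 0 0 3 = (3 : ℤ) • (1 : VH) := by decide +kernel
      have h5 := smul_assoc (3 : ℤ) (1 : VH) x
      rw [one_smul, ← h4] at h5
      rw [← h5, ofEntries_smul_smul, ofEntries_smul_smul, ← add_smul, ofEntries_add]
      simp
    exact htors 3 x (by norm_num) (by rw [h3, h1, h2, smul_zero, smul_zero, add_zero])
  refine ⟨(LinearEquiv.ofBijective (LinearMap.toSpanSingleton VH P g) ⟨?_, ?_⟩).symm⟩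
  · rw [injective_iff_map_eq_zero]
    intro s hs
    obtain ⟨p, q, r, t, rfl⟩ := exists_ofEntries s
    rw [LinearMap.toSpanSingleton_apply] at hs
    have h1 := hindep p q (by rw [← heg p q r t, hs, smul_zero])
    have h2 := hindep (3 * r) t (by rw [← hαg p q r t, hs, smul_zero])
    rw [h1.1, h1.2, h2.2, show r = 0 by omega]
    simp [ofEntries]
  · intro x
    obtain ⟨p, q, h1⟩ := hspan x
    obtain ⟨r, t, h2⟩ := hspan' x
    refine ⟨ofEntries p q r t, ?_⟩
    rw [LinearMap.toSpanSingleton_apply]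
    refine sub_eq_zero.1 (hzero _ ?_ ?_)
    · rw [smul_sub, heg, ← h1, sub_self]
    · rw [smul_sub, hαg, ← h2, sub_self]

theorem hasCancelH : HasCancel VH := by
  refine HasCancel.of_equiv fun P _ _ m E => ?_
  let e := ofEntries 1 0 0 0
  let α := ofEntries 0 1 0 0
  have htors : ∀ (n : ℤ) (p : P), n ≠ 0 → n • p = 0 → p = 0 := by
    intro n p hn hp
    have h1 : n • E (p, 0) = 0 := by
      rw [← map_zsmul, Prod.smul_mk, hp, smul_zero]
      exact map_zero E
    have h2 : E (p, 0) = 0 := (smul_eq_zero.1 h1).resolve_left hn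
    exact congrArg Prod.fst (E.map_eq_zero_iff.1 h2)
  have hfin : Module.Finite ℤ P := by
    have : Module.Finite ℤ VH := Module.Finite.of_basis (QuaternionAlgebra.basisOneIJK (-1 : ℤ) (-1) 1)
    exact Module.Finite.of_surjective
      ((AddMonoidHom.fst P (Fin m → VH)).comp E.symm.toLinearMap.toAddMonoidHom).toIntLinearMap
      (Prod.fst_surjective.comp E.symm.surjective)
  have : Module.IsTorsionFree ℤ P := .of_smul_eq_zero fun n p h => or_iff_not_imp_left.2 fun hn => htors n p hn h
  have : Module.Free ℤ P := inferInstance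
  let L := LinearMap.range ((DistribSMul.toAddMonoidHom P e).toIntLinearMap)
  have hL : ∀ x, x ∈ L ↔ e • x = x := by
    intro x
    constructor
    · rintro ⟨y, rfl⟩
      exact ofEntries_smul_smul _ _ _ _ _ _ _ _ _
    · exact fun h => ⟨x, h⟩
  let toL : P →+ L := ((DistribSMul.toAddMonoidHom P e).toIntLinearMap.rangeRestrict).toAddMonoidHom
  have htoL : Function.Surjective toL := LinearMap.surjective_rangeRestrict _
  have htoL_coe : ∀ x, (toL x : P) = e • x := fun _ => rfl
  have hrank : Module.finrank ℤ L = 2 := by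
    have h1 := index_divSubgroup e (ofEntries 2 0 0 0) P E (by
      rw [index_divSubgroup_four]; norm_num)
    rw [index_divSubgroup_four] at h1
    have h2 : divSubgroup e (ofEntries 2 0 0 0) P =
        ((nsmulAddMonoidHom (α := L) 2).range).comap toL := by
      ext x
      constructor
      · rintro ⟨y, hy⟩
        refine ⟨toL y, Subtype.ext ?_⟩
        change 2 • e • y = e • x
        rw [hy, ofEntries_smul 2 0 0 0]
        simp [two_smul, e]
      · rintro ⟨y, hy⟩
        refine ⟨y, ?_⟩
        have h3 : 2 • (y : P) = e • x := congrArg Subtype.val hy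
        rw [← h3, ofEntries_smul 2 0 0 0, (hL y).1 y.2]
        simp [two_smul]
    rw [h2, AddSubgroup.index_comap_of_surjective _ htoL, AddSubgroup.index_range_nsmul] at h1
    exact Nat.pow_right_injective le_rfl h1
  let N : Submodule ℤ L := (LinearMap.range ((DistribSMul.toAddMonoidHom P α).toIntLinearMap)).comap
    L.subtype
  have hN : N.toAddSubgroup.index = 3 := by
    rw [← index_divSubgroup_three, ← index_divSubgroup e α P E (by
      rw [index_divSubgroup_three]; norm_num), ← AddSubgroup.index_comap_of_surjective _ htoL]
    congr 1
    ext x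
    exact ⟨fun ⟨y, hy⟩ => ⟨y, hy.symm⟩, fun ⟨y, hy⟩ => ⟨y, hy.symm⟩⟩
  obtain ⟨b, hb⟩ := exists_adapted_basis hrank N hN
  obtain ⟨y, hy⟩ : ∃ y, α • y = (b 1 : P) := (hb (b 1)).2 (by simp)
  have hrepr : ∀ x : L, (x : P) = b.repr x 0 • (b 0 : P) + b.repr x 1 • (b 1 : P) := fun x => by
    conv_lhs => rw [← b.sum_repr x, Fin.sum_univ_two]
    rfl
  refine nonempty_equiv_of_adapted htors ((hL _).1 (b 0).2) hy (fun s t h => ?_)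
    (fun x => ⟨_, _, hrepr (toL x)⟩) fun x => ?_
  · have h1 : s • b 0 + t • b 1 = 0 := Subtype.ext h
    have h2 := congrArg b.repr h1
    exact ⟨by simpa using DFunLike.congr_fun h2 0, by simpa using DFunLike.congr_fun h2 1⟩
  · have h1 : e • α • x = α • x := ofEntries_smul_smul _ _ _ _ _ _ _ _ _
    obtain ⟨k, hk⟩ := (hb ⟨α • x, (hL _).2 h1⟩).1 ⟨x, rfl⟩
    have h2 := hrepr ⟨α • x, (hL _).2 h1⟩
    rw [hk] at h2
    exact ⟨_, _, h2⟩

/-- The reduction of `VH` modulo two. -/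
abbrev EH : Type := QuaternionAlgebra (ZMod 2) (-1) (-1) 1

def redH : VH →+* EH :=
  quatHom (Int.castRingHom EH) ⟨0, 1, 0, 0⟩ ⟨0, 0, 1, 0⟩ (fun _ _ => Int.cast_comm _ _)
    (by decide +kernel) (by decide +kernel) (by decide +kernel)

theorem redH_apply (s : VH) : redH s = ⟨s.re, s.imI, s.imJ, s.imK⟩ := by
  rw [redH, quatHom_apply]
  ext <;> simp

/-- The specialization of `VO` at the trivial character. -/
def specPos : VO →+* VH :=
  quatHom (quadHom (Int.castRingHom VH) 1 (fun _ _ => Int.cast_comm _ _) (by decide +kernel))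
    ⟨0, 1, 0, 0⟩ ⟨0, 0, 1, 0⟩
    (fun _ _ => by simp only [quadHom_apply, mul_one, ← map_add]; exact Int.cast_comm _ _)
    (by decide +kernel) (by decide +kernel) (by decide +kernel)

/-- The specialization of `VO` at the sign character. -/
def specNeg : VO →+* VH :=
  quatHom (quadHom (Int.castRingHom VH) (-1) (fun _ _ => Int.cast_comm _ _) (by decide +kernel))
    ⟨0, -1, 0, 0⟩ ⟨0, 0, 1, 0⟩
    (fun _ _ => by
      simp only [quadHom_apply, mul_neg_one, ← map_neg, ← map_add]; exact Int.cast_comm _ _)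
    (by decide +kernel) (by decide +kernel) (by decide +kernel)

theorem specPos_apply (s : VO) : specPos s = ⟨s.re.re + s.re.im, s.imI.re + s.imI.im,
    s.imJ.re + s.imJ.im, s.imK.re + s.imK.im⟩ := by
  rw [specPos, quatHom_apply]
  ext <;> simp [quadHom_apply]

theorem specNeg_apply (s : VO) : specNeg s = ⟨s.re.re - s.re.im, -(s.imI.re - s.imI.im),
    s.imJ.re - s.imJ.im, -(s.imK.re - s.imK.im)⟩ := by
  rw [specNeg, quatHom_apply]
  ext <;> simp [quadHom_apply] <;> ring

theorem hasCancelO : HasCancel VO := by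
  refine HasCancel.of_square specPos specNeg redH redH (fun a b hab => ?_) (fun s t h₁ h₂ => ?_)
    (fun s => ?_) (fun u => ?_) hasCancelH hasCancelH
  · rw [redH_apply, redH_apply, QuaternionAlgebra.mk.injEq] at hab
    simp only [ZMod.intCast_eq_intCast_iff_dvd_sub] at hab
    obtain ⟨⟨p, hp⟩, ⟨q, hq⟩, ⟨r, hr⟩, ⟨t, ht⟩⟩ := hab
    push_cast at hp hq hr ht
    refine ⟨⟨⟨a.re + p, -p⟩, ⟨-q, a.imI + q⟩, ⟨a.imJ + r, -r⟩, ⟨-t, a.imK + t⟩⟩, ?_, ?_⟩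
    · rw [specPos_apply]
      ext <;> simp
    · rw [specNeg_apply]
      ext <;> simp <;> omega
  · rw [specPos_apply, specPos_apply, QuaternionAlgebra.mk.injEq] at h₁
    rw [specNeg_apply, specNeg_apply, QuaternionAlgebra.mk.injEq] at h₂
    ext <;> omega
  · rw [specPos_apply, specNeg_apply, redH_apply, redH_apply, QuaternionAlgebra.mk.injEq]
    simp only [ZMod.intCast_eq_intCast_iff_dvd_sub]
    refine ⟨?_, ?_, ?_, ?_⟩ <;> push_cast <;> omega
  · have hx : (⟨0, 1, 0, 0⟩ : VH) ^ 3 = 1 := by decide +kernel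
    have hy : (⟨0, 0, 1, 0⟩ : VH) ^ 2 = 1 := by decide +kernel
    let x : VHˣ := Units.ofPowEqOne _ 3 hx (by norm_num)
    let y : VHˣ := Units.ofPowEqOne _ 2 hy (by norm_num)
    have hX : redH x = ⟨0, 1, 0, 0⟩ := redH_apply _
    have hY : redH y = ⟨0, 0, 1, 0⟩ := redH_apply _
    have h : ∀ u v : EH, u * v = 1 → ∃ k l : Fin 3,
        u = (⟨0, 1, 0, 0⟩ : EH) ^ k.1 * (⟨0, 0, 1, 0⟩ : EH) ^ l.1 := by
      decide +kernel
    obtain ⟨k, l, h⟩ := h u _ u.mul_inv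
    exact ⟨1, x ^ k.1 * y ^ l.1, by
      rw [h, Units.val_mul, Units.val_pow_eq_pow_val, Units.val_pow_eq_pow_val, map_mul, map_pow,
        map_pow, hX, hY, Units.val_one, map_one, one_mul]⟩

/-! ### Determinants of frames -/

section
variable {S κ : Type} [Ring S] [Fintype κ] [DecidableEq κ]
  {V : Matrix κ (Unit ⊕ κ) S} {U : Matrix (Unit ⊕ κ) κ S}

/-- The square matrix whose rows are the generator of the kernel and the given section. -/
def Frame.square (F : Frame V U) : Matrix (Unit ⊕ κ) (Unit ⊕ κ) S :=
  fromRows (Matrix.of fun _ => F.gen) V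

theorem Frame.isUnit_square (F : Frame V U) (h : V * U = 1) : IsUnit F.square := by
  have h1 : F.square * fromCols (Matrix.of fun i (_ : Unit) => F.coord i) U = 1 := by
    have h2 : (Matrix.of fun (_ : Unit) => F.gen) * (Matrix.of fun i (_ : Unit) => F.coord i) = 1 := by
      ext i j
      exact F.gen_dot_coord
    have h3 : (Matrix.of fun (_ : Unit) => F.gen) * U = 0 := by
      refine funext fun i => ?_
      exact F.gen_vecMul
    have h4 : V * (Matrix.of fun i (_ : Unit) => F.coord i) = 0 := by
      ext i j
      exact congrFun F.mulVec_coord i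
    rw [Frame.square, fromRows_mul_fromCols, h2, h3, h4, h, fromBlocks_one]
  have h5 : fromCols (Matrix.of fun i (_ : Unit) => F.coord i) U * F.square = 1 := by
    rw [Frame.square, fromCols_mul_fromRows, ← F.vecMulVec_add]
    congr 1
    ext i j
    simp [Matrix.mul_apply, vecMulVec_apply]
  exact ⟨⟨_, _, h1, h5⟩, rfl⟩

theorem Frame.sdet_square (F G : Frame V U) {n C : Type} [Fintype n] [DecidableEq n] [CommRing C]
    (σ : S →+* Matrix n n C) :
    sdet σ F.square = (σ (F.compare G).1).det * sdet σ G.square := by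
  have h : F.square =
      fromBlocks (Matrix.of fun _ _ => (F.compare G).1 : Matrix Unit Unit S) 0 0 1 * G.square := by
    rw [Frame.square, Frame.square, fromBlocks_mul_fromRows]
    simp only [Matrix.zero_mul, add_zero, zero_add, Matrix.one_mul]
    congr 1
    refine funext fun i => ?_
    rw [← F.compare_smul G]
    ext j
    simp [Matrix.mul_apply]
  rw [h, map_mul, sdet_fromBlocks_zero₂₁, sdet_unique, map_one, mul_one]
  rfl

theorem Frame.square_map {T : Type} [Ring T] (f : S →+* T) (F : Frame V U)
    {V' : Matrix κ (Unit ⊕ κ) T} {U' : Matrix (Unit ⊕ κ) κ T} (hV : V.map f = V')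
    (hU : U.map f = U') : (F.map f hV hU).square = F.square.map f := by
  subst hV
  ext i j
  rcases i with i | i <;> rfl

end

/-- Reduction of the Lipschitz quaternions modulo four. -/
def redA4 : VA →+* QuaternionAlgebra (ZMod 4) (-1) 0 (-1) :=
  quatHom (Int.castRingHom _) ⟨0, 1, 0, 0⟩ ⟨0, 0, 1, 0⟩
    (fun _ _ => Int.cast_comm _ _) (by decide +kernel) (by decide +kernel) (by decide +kernel)

/-- The representation by matrices over the Gaussian integers modulo four. -/
def redK4 : QuadraticAlgebra ℤ (-1) 0 →+* QuadraticAlgebra (ZMod 4) (-1) 0 :=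
  quadHom (Int.castRingHom _) ⟨0, 1⟩ (fun _ _ => mul_comm _ _) (by decide +kernel)

/-- The maximal abelian quotient modulo two. -/
def zaQ : QuaternionAlgebra (ZMod 4) (-1) 0 (-1) →+* EZA :=
  quatHom ((algebraMap (ZMod 2) EZA).comp (ZMod.castHom (by norm_num) (ZMod 2))) ⟨⟨0, 1⟩, 0⟩ ⟨0, 1⟩
    (fun _ _ => mul_comm _ _) (by decide +kernel) (by decide +kernel) (by decide +kernel)

/-- The parity of the sum of the coordinates. -/
def parQ : QuaternionAlgebra (ZMod 4) (-1) 0 (-1) →+* ZMod 2 :=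
  quatHom (ZMod.castHom (by norm_num) (ZMod 2)) 1 1
    (fun _ _ => mul_comm _ _) (by decide +kernel) (by decide +kernel) (by decide +kernel)

theorem isUnit_of_parQ (q : QuaternionAlgebra (ZMod 4) (-1) 0 (-1)) (h : parQ q = 1) :
    IsUnit q := by
  have h1 : ∀ q : QuaternionAlgebra (ZMod 4) (-1) 0 (-1),
      ((q.re + q.imI + q.imJ + q.imK).val % 2 = 1) →
      q * (star q * (q * star q)) = 1 ∧ (star q * (q * star q)) * q = 1 := by decide +kernel
  have h2 : ∀ q : QuaternionAlgebra (ZMod 4) (-1) 0 (-1), 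
      (ZMod.castHom (by norm_num : 2 ∣ 4) (ZMod 2) q.re +
        ZMod.castHom (by norm_num : 2 ∣ 4) (ZMod 2) q.imI * 1 +
        ZMod.castHom (by norm_num : 2 ∣ 4) (ZMod 2) q.imJ * 1 +
        ZMod.castHom (by norm_num : 2 ∣ 4) (ZMod 2) q.imK * (1 * 1) = 1) → (q.re + q.imI + q.imJ + q.imK).val % 2 = 1 := by
    decide +kernel
  rw [parQ, quatHom_apply] at h
  obtain ⟨a, b⟩ := h1 q (h2 q h)
  exact ⟨⟨_, _, a, b⟩, rfl⟩

theorem exists_isUnit_of_sum {ι : Type} [Fintype ι]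
    (x y : ι → QuaternionAlgebra (ZMod 4) (-1) 0 (-1)) (h : ∑ i, x i * y i = 1) :
    ∃ i, IsUnit (y i) := by
  by_contra! hn
  have h1 : ∀ i, parQ (y i) = 0 := fun i => by
    have h2 : ∀ p : ZMod 2, p ≠ 1 → p = 0 := by decide
    exact h2 _ fun h => hn i (isUnit_of_parQ _ h)
  have h3 := congrArg parQ h
  rw [map_sum, map_one] at h3
  simp [h1] at h3

theorem redA4_apply (q : VA) : redA4 q = ⟨q.re, q.imI, q.imJ, q.imK⟩ := by
  rw [redA4, quatHom_apply]
  ext <;> simp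

theorem redK4_apply (q : QuadraticAlgebra ℤ (-1) 0) : redK4 q = ⟨q.re, q.im⟩ := by
  rw [redK4, quadHom_apply]
  ext <;> simp

theorem quatRep_comp_redA4 : (quatRep (-1 : ZMod 4) 0 (-1)).comp redA4 =
    redK4.mapMatrix.comp (quatRep (-1 : ℤ) 0 (-1)) := by
  ext q i j
  · rw [RingHom.comp_apply, RingHom.comp_apply, redA4_apply, quatRep_apply, quatRep_apply]
    fin_cases i <;> fin_cases j <;> simp [redK4_apply]
  · rw [RingHom.comp_apply, RingHom.comp_apply, redA4_apply, quatRep_apply, quatRep_apply]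
    fin_cases i <;> fin_cases j <;> simp [redK4_apply]

theorem zaQ_comp_redA4 : zaQ.comp redA4 = zaA := by
  refine RingHom.ext fun q => ?_
  rw [RingHom.comp_apply, redA4_apply, zaQ, zaA, quatHom_apply, quatHom_apply]
  simp

theorem zaQ_of_det (q : QuaternionAlgebra (ZMod 4) (-1) 0 (-1))
    (h : (quatRep (-1 : ZMod 4) 0 (-1) q).det = 1) :
    ∃ i j : Fin 2, zaQ q = (⟨⟨0, 1⟩, 0⟩ : EZA) ^ i.1 * ⟨0, 1⟩ ^ j.1 := by
  have key : ∀ q : QuaternionAlgebra (ZMod 4) (-1) 0 (-1), q.re * q.re + q.imI * q.imI +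
      q.imJ * q.imJ + q.imK * q.imK = 1 → ∃ i j : Fin 2,
      (algebraMap (ZMod 2) EZA).comp (ZMod.castHom (by norm_num : 2 ∣ 4) (ZMod 2)) q.re +
      (algebraMap (ZMod 2) EZA).comp (ZMod.castHom (by norm_num : 2 ∣ 4) (ZMod 2)) q.imI * ⟨⟨0, 1⟩, 0⟩ +
      (algebraMap (ZMod 2) EZA).comp (ZMod.castHom (by norm_num : 2 ∣ 4) (ZMod 2)) q.imJ * ⟨0, 1⟩ +
      (algebraMap (ZMod 2) EZA).comp (ZMod.castHom (by norm_num : 2 ∣ 4) (ZMod 2)) q.imK * (⟨⟨0, 1⟩, 0⟩ * ⟨0, 1⟩) =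
        (⟨⟨0, 1⟩, 0⟩ : EZA) ^ i.1 * ⟨0, 1⟩ ^ j.1 := by
    decide +kernel
  rw [zaQ, quatHom_apply]
  apply key
  rw [quatRep_apply, det_fin_two_of] at h
  have h1 : _ = (1 : ZMod 4) := congrArg QuadraticAlgebra.re h
  simp at h1
  linear_combination h1

/-- The determinant of an invertible matrix of Lipschitz quaternions in the maximal abelian
quotient modulo two is a group element. -/
theorem sdet_zaA {n : ℕ} (M : Matrix (Unit ⊕ Fin n) (Unit ⊕ Fin n) VA) (hM : IsUnit M) :
    ∃ i j : Fin 2, sdet ((Matrix.scalar Unit).comp zaA) M =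
      (⟨⟨0, 1⟩, 0⟩ : EZA) ^ i.1 * ⟨0, 1⟩ ^ j.1 := by
  obtain ⟨e⟩ : Nonempty (Fin (1 + n) ≃ Unit ⊕ Fin n) :=
    ⟨finSumFinEquiv.symm.trans (Equiv.sumCongr (Equiv.ofUnique _ _) (Equiv.refl _))⟩
  have hM' : IsUnit ((M.map redA4).submatrix e e) := by
    have := hM.map redA4.mapMatrix
    exact this.map (Matrix.reindexRingEquiv _ e.symm)
  obtain ⟨u, hu⟩ := exists_sdet_eq (fun ι _ x y => exists_isUnit_of_sum x y) _ _ hM'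
  have h1 := hu _ _ (quatRep (-1 : ZMod 4) 0 (-1))
  rw [sdet_submatrix, ← sdet_comp, quatRep_comp_redA4, sdet_mapMatrix_comp,
    sdet_repA_of_isUnit hM, map_one] at h1
  obtain ⟨i, j, h2⟩ := zaQ_of_det _ h1.symm
  refine ⟨i, j, ?_⟩
  have h3 := hu _ _ ((Matrix.scalar Unit).comp zaQ)
  rw [sdet_submatrix, ← sdet_comp, RingHom.comp_assoc, zaQ_comp_redA4] at h3
  rw [h3, ← h2]
  simp

theorem eq_of_isUnit_RO {q : RO} (h : IsUnit q) :
    q = 1 ∨ q = -1 ∨ q = ⟨0, 1⟩ ∨ q = ⟨0, -1⟩ := by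
  have key : ∀ s (hs : s * s = (1 : ℤ)), q.re + q.im * s = 1 ∨ q.re + q.im * s = -1 := by
    intro s hs
    have h1 := h.map (quadHom (RingHom.id ℤ) s (fun _ _ => mul_comm _ _) (by simp [hs]) : RO →+* ℤ)
    rwa [quadHom_apply, Int.isUnit_iff] at h1
  have h1 := key 1 (by norm_num)
  have h2 := key (-1) (by norm_num)
  obtain ⟨a, b⟩ := q
  simp only at h1 h2
  have h3 : ((a = 1 ∨ a = -1) ∧ b = 0) ∨ ((b = 1 ∨ b = -1) ∧ a = 0) := by omega
  rcases h3 with ⟨rfl | rfl, rfl⟩ | ⟨rfl | rfl, rfl⟩ <;> decide +kernel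

theorem int_klein_units {a b c d : ℤ} (h1 : a + b * 1 + (c + d * 1) * 1 = 1 ∨
      a + b * 1 + (c + d * 1) * 1 = -1)
    (h2 : a + b * -1 + (c + d * -1) * 1 = 1 ∨ a + b * -1 + (c + d * -1) * 1 = -1)
    (h3 : a + b * 1 + (c + d * 1) * -1 = 1 ∨ a + b * 1 + (c + d * 1) * -1 = -1)
    (h4 : a + b * -1 + (c + d * -1) * -1 = 1 ∨ a + b * -1 + (c + d * -1) * -1 = -1) :
    ((a = 1 ∨ a = -1) ∧ b = 0 ∧ c = 0 ∧ d = 0) ∨ ((b = 1 ∨ b = -1) ∧ a = 0 ∧ c = 0 ∧ d = 0) ∨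
      ((c = 1 ∨ c = -1) ∧ a = 0 ∧ b = 0 ∧ d = 0) ∨
      ((d = 1 ∨ d = -1) ∧ a = 0 ∧ b = 0 ∧ c = 0) := by
  rcases h1 with h1 | h1 <;> rcases h2 with h2 | h2 <;> rcases h3 with h3 | h3 <;>
    rcases h4 with h4 | h4 <;> first
    | (exfalso; omega)
    | exact Or.inl ⟨Or.inl (by omega), by omega, by omega, by omega⟩
    | exact Or.inl ⟨Or.inr (by omega), by omega, by omega, by omega⟩
    | exact Or.inr (Or.inl ⟨Or.inl (by omega), by omega, by omega, by omega⟩)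
    | exact Or.inr (Or.inl ⟨Or.inr (by omega), by omega, by omega, by omega⟩)
    | exact Or.inr (Or.inr (Or.inl ⟨Or.inl (by omega), by omega, by omega, by omega⟩))
    | exact Or.inr (Or.inr (Or.inl ⟨Or.inr (by omega), by omega, by omega, by omega⟩))
    | exact Or.inr (Or.inr (Or.inr ⟨Or.inl (by omega), by omega, by omega, by omega⟩))
    | exact Or.inr (Or.inr (Or.inr ⟨Or.inr (by omega), by omega, by omega, by omega⟩))

/-- The units of the group ring of the Klein four group are trivial. -/
theorem eq_of_isUnit_VZ {z : VZ} (h : IsUnit z) : ∃ i j : Fin 2,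
    z = (⟨⟨0, 1⟩, 0⟩ : VZ) ^ i.1 * ⟨0, 1⟩ ^ j.1 ∨ z = -((⟨⟨0, 1⟩, 0⟩ : VZ) ^ i.1 * ⟨0, 1⟩ ^ j.1) := by
  have key : ∀ s t (hs : s * s = (1 : ℤ)) (ht : t * t = (1 : ℤ)),
      z.re.re + z.re.im * s + (z.im.re + z.im.im * s) * t = 1 ∨
      z.re.re + z.re.im * s + (z.im.re + z.im.im * s) * t = -1 := by
    intro s t hs ht
    have h1 := h.map (quadHom (quadHom (RingHom.id ℤ) s (fun _ _ => mul_comm _ _) (by simp [hs]))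
      t (fun _ _ => mul_comm _ _) (by simp [ht]) : VZ →+* ℤ)
    rwa [quadHom_apply, quadHom_apply, quadHom_apply, Int.isUnit_iff] at h1
  have h1 := key 1 1 (by norm_num) (by norm_num)
  have h2 := key (-1) 1 (by norm_num) (by norm_num)
  have h3 := key 1 (-1) (by norm_num) (by norm_num)
  have h4 := key (-1) (-1) (by norm_num) (by norm_num)
  obtain ⟨⟨a, b⟩, ⟨c, d⟩⟩ := z
  simp only at h1 h2 h3 h4
  have h5 := int_klein_units h1 h2 h3 h4
  rcases h5 with ⟨rfl | rfl, rfl, rfl, rfl⟩ | ⟨rfl | rfl, rfl, rfl, rfl⟩ |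
    ⟨rfl | rfl, rfl, rfl, rfl⟩ | ⟨rfl | rfl, rfl, rfl, rfl⟩ <;> decide +kernel

/-! ### Determinants at the vertices `VB` and `VO` -/

theorem sdet_scalar {L C ι : Type} [Ring L] [CommRing C] [Fintype ι] [DecidableEq ι] (χ : L →+* C)
    (M : Matrix ι ι L) : sdet ((Matrix.scalar Unit).comp χ) M = (M.map χ).det := by
  rw [sdet_apply, ← Matrix.det_submatrix_equiv_self (Equiv.prodPUnit ι).symm]
  congr 1

theorem sdet_of_upperTriangular {L C ι : Type} [Ring L] [CommRing C] [Fintype ι] [DecidableEq ι]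
    (τ : L →+* Matrix (Fin 2) (Fin 2) C) (χ₀ χ₁ : L →+* C) (h0 : ∀ x, τ x 0 0 = χ₀ x)
    (h1 : ∀ x, τ x 1 1 = χ₁ x) (h2 : ∀ x, τ x 1 0 = 0) (M : Matrix ι ι L) :
    sdet τ M = (M.map χ₀).det * (M.map χ₁).det := by
  let e : ι ⊕ ι ≃ ι × Fin 2 :=
    { toFun := Sum.elim (fun i => (i, 0)) fun i => (i, 1)
      invFun := fun p => if p.2 = 0 then .inl p.1 else .inr p.1
      left_inv := by rintro (i | i) <;> simp
      right_inv := by rintro ⟨i, j⟩; fin_cases j <;> simp }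
  rw [sdet_apply, ← Matrix.det_submatrix_equiv_self e,
    ← Matrix.det_fromBlocks_zero₂₁ (M.map χ₀) (M.map fun x => τ x 0 1) (M.map χ₁)]
  congr 1
  ext i j
  rcases i with i | i <;> rcases j with j | j <;> simp [e, Matrix.comp_apply, h0, h1, h2]

theorem conj_quaternion {R E : Type} [CommRing R] [Ring E] {a b c : R}
    {f g : QuaternionAlgebra R a b c →+* E} {s : E}
    (hC : ∀ r : R, s * f ⟨r, 0, 0, 0⟩ = g ⟨r, 0, 0, 0⟩ * s)
    (hI : s * f ⟨0, 1, 0, 0⟩ = g ⟨0, 1, 0, 0⟩ * s) (hJ : s * f ⟨0, 0, 1, 0⟩ = g ⟨0, 0, 1, 0⟩ * s)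
    (x : QuaternionAlgebra R a b c) : s * f x = g x * s := by
  have hadd : ∀ x y, s * f x = g x * s → s * f y = g y * s → s * f (x + y) = g (x + y) * s := by
    intro x y hx hy
    rw [map_add, map_add, mul_add, add_mul, hx, hy]
  have hmul : ∀ x y, s * f x = g x * s → s * f y = g y * s → s * f (x * y) = g (x * y) * s := by
    intro x y hx hy
    rw [map_mul, map_mul, ← mul_assoc, hx, mul_assoc, hy, mul_assoc]
  have h : x = ⟨x.re, 0, 0, 0⟩ + ⟨x.imI, 0, 0, 0⟩ * ⟨0, 1, 0, 0⟩ + ⟨x.imJ, 0, 0, 0⟩ * ⟨0, 0, 1, 0⟩ +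
      ⟨x.imK, 0, 0, 0⟩ * (⟨0, 1, 0, 0⟩ * ⟨0, 0, 1, 0⟩) := by
    ext <;> simp
  rw [h]
  exact hadd _ _ (hadd _ _ (hadd _ _ (hC _) (hmul _ _ (hC _) hI)) (hmul _ _ (hC _) hJ))
    (hmul _ _ (hC _) (hmul _ _ hI hJ))

/-- The quadratic extension of `𝔽₂[C₂]` that splits the reduction of `VB`. -/
abbrev L2 : Type := QuadraticAlgebra K2 (-1) ⟨0, 1⟩

/-- Reduction of `KB` modulo two. -/
def redKB2 : KB →+* L2 :=
  quadHom ((algebraMap K2 L2).comp redB2) ⟨0, 1⟩ (fun _ _ => mul_comm _ _) (by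
    simp only [RingHom.comp_apply, redB2_apply]
    decide +kernel)

/-- Reduction of `KB` modulo `√3`. -/
def redKB3 : KB →+* QuadraticAlgebra (ZMod 3) (-1) 0 :=
  quadHom ((algebraMap (ZMod 3) _).comp redB3) ⟨0, 1⟩ (fun _ _ => mul_comm _ _) (by
    simp only [RingHom.comp_apply, redB3, quadHom_apply]
    decide +kernel)

theorem redB3_apply (q : RB) : redB3 q = q.re := by
  rw [redB3, quadHom_apply]
  simp

theorem redKB3_apply (q : KB) : redKB3 q = ⟨q.re.re, q.im.re⟩ := by
  rw [redKB3, quadHom_apply, RingHom.comp_apply, RingHom.comp_apply, redB3_apply, redB3_apply]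
  ext <;> simp

theorem redKB2_apply (q : KB) : redKB2 q = ⟨redB2 q.re, redB2 q.im⟩ := by
  rw [redKB2, quadHom_apply, RingHom.comp_apply, RingHom.comp_apply]
  generalize redB2 q.re = a
  generalize redB2 q.im = b
  ext <;> simp

theorem quatRep_comp_abB : (quatRep (-1 : ZMod 3) 0 (-1)).comp abB =
    redKB3.mapMatrix.comp (quatRep (-1 : RB) ⟨0, 1⟩ (-1)) := by
  refine RingHom.ext fun q => ?_
  rw [RingHom.comp_apply, RingHom.comp_apply, abB_apply, quatRep_apply, quatRep_apply]
  have h3 : (3 : ZMod 3) = 0 := by decide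
  ext i j <;> fin_cases i <;> fin_cases j <;> simp [redKB3_apply, h3]

theorem quatRep_comp_abA : (quatRep (-1 : ZMod 3) 0 (-1)).comp abA =
    (quadHom (Int.castRingHom _) ⟨0, 1⟩ (fun _ _ => mul_comm _ _) (by decide +kernel) :
      QuadraticAlgebra ℤ (-1) 0 →+* QuadraticAlgebra (ZMod 3) (-1) 0).mapMatrix.comp
      (quatRep (-1 : ℤ) 0 (-1)) := by
  refine RingHom.ext fun q => ?_
  rw [RingHom.comp_apply, RingHom.comp_apply, abA_apply, quatRep_apply, quatRep_apply]
  ext i j <;> fin_cases i <;> fin_cases j <;> simp [quadHom_apply]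

/-- The matrix conjugating `boB` to the reduction of the quaternion representation. -/
def conjB : (Matrix (Fin 2) (Fin 2) L2)ˣ where
  val := !![⟨0, ⟨0, 1⟩⟩, ⟨1, ⟨0, 1⟩⟩; 1, 1]
  inv := !![1, ⟨1, ⟨0, 1⟩⟩; 1, ⟨0, ⟨0, 1⟩⟩]
  val_inv := by decide +kernel
  inv_val := by decide +kernel

theorem conjB_mul (x : VB) :
    conjB.1 * (redKB2.mapMatrix.comp (quatRep (-1 : RB) ⟨0, 1⟩ (-1))) x =
      ((algebraMap K2 L2).mapMatrix.comp boB) x * conjB.1 := by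
  refine conj_quaternion (fun r => ?_) ?_ ?_ x
  · have h1 : (redKB2.mapMatrix.comp (quatRep (-1 : RB) ⟨0, 1⟩ (-1))) ⟨r, 0, 0, 0⟩ =
        Matrix.scalar (Fin 2) (algebraMap K2 L2 (redB2 r)) := by
      rw [RingHom.comp_apply, quatRep_apply]
      ext1 i j
      fin_cases i <;> fin_cases j <;> simp [redKB2_apply] <;> rfl
    have h2 : ((algebraMap K2 L2).mapMatrix.comp boB) ⟨r, 0, 0, 0⟩ =
        Matrix.scalar (Fin 2) (algebraMap K2 L2 (redB2 r)) := by
      rw [RingHom.comp_apply, boB, quatHom_apply]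
      ext1 i j
      fin_cases i <;> fin_cases j <;> simp
    rw [h1, h2]
    exact ((Matrix.scalar_commute _ (fun _ => Commute.all _ _) _).eq).symm
  · decide +kernel
  · decide +kernel

theorem odd_even_of_pell {p q : ℤ} (hp : 0 < p) (h : p ^ 2 - 3 * q ^ 2 = 1) (h3 : (p : ZMod 3) = 1) :
    (p : ZMod 2) = 1 ∧ (q : ZMod 2) = 0 := by
  obtain ⟨k, hk⟩ : (3 : ℤ) ∣ p - 1 := by
    have := (ZMod.intCast_zmod_eq_zero_iff_dvd (p - 1) 3).1 (by simp [h3])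
    exact_mod_cast this
  have hpk : p = 3 * k + 1 := by linarith
  subst hpk
  have hq : k * (3 * k + 2) = q ^ 2 := by linarith
  rcases Int.even_or_odd q with ⟨r, rfl⟩ | ⟨r, rfl⟩
  · have hk' : Even k := by
      by_contra hodd
      rw [Int.not_even_iff_odd] at hodd
      obtain ⟨l, rfl⟩ := hodd
      have : (2 * l + 1) * (3 * (2 * l + 1) + 2) = 4 * (r * r) := by linarith
      ring_nf at this
      omega
    obtain ⟨l, rfl⟩ := hk'
    have h2 : (2 : ZMod 2) = 0 := by decide
    push_cast
    constructor
    · linear_combination (3 * (l : ZMod 2)) * h2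
    · linear_combination (r : ZMod 2) * h2
  · exfalso
    have hodd : Odd k := by
      by_contra heven
      rw [Int.not_odd_iff_even] at heven
      obtain ⟨l, rfl⟩ := heven
      ring_nf at hq
      omega
    have hco : IsCoprime (3 * k + 2) k := by
      obtain ⟨l, rfl⟩ := hodd
      exact ⟨-l, 3 * l + 1, by ring⟩
    obtain ⟨a, ha | ha⟩ := Int.sq_of_isCoprime hco (by rw [mul_comm]; exact hq)
    · have h4 := congrArg (Int.cast : ℤ → ZMod 3) ha
      push_cast at h4
      have : ∀ k a : ZMod 3, 3 * k + 2 ≠ a ^ 2 := by decide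
      exact this _ _ h4
    · nlinarith [sq_nonneg a]

theorem sdet_boB {ι : Type} [Fintype ι] [DecidableEq ι] {M : Matrix ι ι VB} (hM : IsUnit M)
    (h : sdet (quatRep (-1 : ZMod 3) 0 (-1)) (M.map abB) = 1) : sdet boB M = 1 := by
  obtain ⟨p, q, hp, hpq, hd⟩ := sdet_repB_of_isUnit hM
  rw [← sdet_comp, quatRep_comp_abB, sdet_mapMatrix_comp, hd, redKB3_apply] at h
  obtain ⟨h1, h2⟩ := odd_even_of_pell hp hpq (congrArg QuadraticAlgebra.re h)
  have h3 := sdet_congr_of_conj conjB conjB_mul M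
  rw [sdet_mapMatrix_comp, sdet_mapMatrix_comp, hd, redKB2_apply, redB2_apply, map_zero, h1, h2]
    at h3
  have h4 : _ = (1 : K2) := congrArg QuadraticAlgebra.re h3.symm
  simpa using h4

theorem sdet_quatRep_abA {ι : Type} [Fintype ι] [DecidableEq ι] {M : Matrix ι ι VA}
    (hM : IsUnit M) : sdet (quatRep (-1 : ZMod 3) 0 (-1)) (M.map abA) = 1 := by
  rw [← sdet_comp, quatRep_comp_abA, sdet_mapMatrix_comp, sdet_repA_of_isUnit hM, map_one]

/-- The two characters of the Klein four group algebra over `𝔽₃[C₂]`. -/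
def evalOZ (t : K3) (ht : t * t = 1) : EOZ →+* K3 :=
  quadHom (RingHom.id K3) t (fun _ _ => mul_comm _ _) (by simpa using ht)

theorem evalOZ_apply (t : K3) (ht : t * t = 1) (q : EOZ) : evalOZ t ht q = q.re + q.im * t := by
  rw [evalOZ, quadHom_apply]
  rfl

theorem sdet_boO {ι : Type} [Fintype ι] [DecidableEq ι] {M : Matrix ι ι VO} (hM : IsUnit M)
    {z : VZ} (hz : IsUnit z) (h : (M.map ozO).det = ozZ z) : sdet boO M = 1 := by
  have h1 : sdet (redO3.mapMatrix.comp rhoO) M =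
      (M.map ((evalOZ 1 (by decide +kernel)).comp ozO)).det *
      (M.map ((evalOZ (-1) (by decide +kernel)).comp ozO)).det := by
    refine sdet_of_upperTriangular _ _ _ (fun x => ?_) (fun x => ?_) (fun x => ?_) M
    all_goals
      have e2 : (2 : RO) = ⟨2, 0⟩ := by decide +kernel
      have e3 : (3 : RO) = ⟨3, 0⟩ := by decide +kernel
      have k3 : (3 : ZMod 3) = 0 := by decide
      have k2 : (2 : ZMod 3) = -1 := by decide
      simp only [RingHom.comp_apply, evalOZ_apply, ozO_apply, rhoO_apply, e2, e3,
        RingHom.mapMatrix_apply, Matrix.map_apply, redO3_apply]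
      ext <;> simp [k2, k3] <;> ring
  have h2 : ∀ t ht, (M.map ((evalOZ t ht).comp ozO)).det = evalOZ t ht (ozZ z) := fun t ht => by
    rw [← h, RingHom.map_det]
    rfl
  rw [h2, h2, sdet_mapMatrix_comp, evalOZ_apply, evalOZ_apply] at h1
  have h3 : redO3 (sdet rhoO M) = 1 ∨ redO3 (sdet rhoO M) = -1 := by
    rw [h1]
    obtain ⟨i, j, rfl | rfl⟩ := eq_of_isUnit_VZ hz <;> fin_cases i <;> fin_cases j <;>
      decide +kernel
  have h4 : sdet rhoO M = 1 ∨ sdet rhoO M = -1 := by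
    rcases eq_of_isUnit_RO (hM.map (sdet rhoO)) with h | h | h | h
    · exact Or.inl h
    · exact Or.inr h
    · exfalso; rw [h] at h3; revert h3; decide +kernel
    · exfalso; rw [h] at h3; revert h3; decide +kernel
  rw [boO, sdet_mapMatrix_comp]
  rcases h4 with h | h <;> rw [h] <;> decide +kernel

/-! ### Units of the edge rings modulo units of the vertex rings -/

/-- The units of `EAB` that represent the stably free modules. -/
def unitE (e : ZMod 3) : EABˣ where
  val := ⟨1, e, e, e⟩
  inv := ⟨1, -e, -e, -e⟩
  val_inv := by revert e; decide +kernel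
  inv_val := by revert e; decide +kernel

theorem exists_unitE (k : EABˣ) :
    ∃ (a : VAˣ) (b : VBˣ) (e : ZMod 3), abA a * k = unitE e * abB b := by
  have h1 : ∀ k : EAB, k ≠ 0 → k * star k ≠ 0 →
      ∃ a ∈ ([1, ⟨0, 1, 0, 0⟩, ⟨0, 0, 1, 0⟩, ⟨0, 0, 0, 1⟩, -1, ⟨0, -1, 0, 0⟩, ⟨0, 0, -1, 0⟩,
        ⟨0, 0, 0, -1⟩] : List EAB), ∃ b ∈ ([1, ⟨1, 1, 0, 0⟩] : List EAB), ∃ e : ZMod 3,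
        a * k = ⟨1, e, e, e⟩ * b := by
    decide +kernel
  have h2 : ∀ a ∈ ([1, ⟨0, 1, 0, 0⟩, ⟨0, 0, 1, 0⟩, ⟨0, 0, 0, 1⟩, -1, ⟨0, -1, 0, 0⟩, ⟨0, 0, -1, 0⟩,
        ⟨0, 0, 0, -1⟩] : List EAB),
      ∃ a' ∈ ([1, ⟨0, 1, 0, 0⟩, ⟨0, 0, 1, 0⟩, ⟨0, 0, 0, 1⟩, -1, ⟨0, -1, 0, 0⟩, ⟨0, 0, -1, 0⟩,
        ⟨0, 0, 0, -1⟩] : List VA), abA a' = a ∧ a' * star a' = 1 ∧ star a' * a' = 1 := by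
    decide +kernel
  have h3 : ∀ b ∈ ([1, ⟨1, 1, 0, 0⟩] : List EAB),
      ∃ b' ∈ ([1, ⟨1, 1, 0, 0⟩] : List VB), abB b' = b ∧
      ∃ c ∈ ([1, ⟨⟨-1, 1⟩, ⟨-2, 1⟩, 0, 0⟩] : List VB), b' * c = 1 ∧ c * b' = 1 := by
    decide +kernel
  have hk : k.1 * star k.1 ≠ 0 := fun h => by
    have h4 : star k.1 = 0 := by simpa using congrArg (k⁻¹.1 * ·) h
    exact k.ne_zero (star_eq_zero.1 h4)
  obtain ⟨a, ha, b, hb, e, he⟩ := h1 k k.ne_zero hk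
  obtain ⟨a', -, rfl, h4, h5⟩ := h2 a ha
  obtain ⟨b', -, rfl, c, -, h6, h7⟩ := h3 b hb
  exact ⟨⟨a', _, h4, h5⟩, ⟨b', c, h6, h7⟩, e, he⟩

/-- The image in the units of `VO` of a generator of the group. -/
def unitOx : VOˣ := ⟨⟨0, 1, 0, 0⟩, ⟨⟨0, -1⟩, -1, 0, 0⟩, by decide +kernel, by decide +kernel⟩
/-- The image in the units of `VO` of a generator of the group. -/
def unitOy : VOˣ := ⟨⟨0, 0, 1, 0⟩, ⟨0, 0, 1, 0⟩, by decide +kernel, by decide +kernel⟩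
/-- An exceptional unit of `VO`. -/
def unitOe : VOˣ := ⟨⟨⟨0, -1⟩, ⟨-1, -1⟩, ⟨-1, -1⟩, 0⟩, ⟨⟨0, -1⟩, ⟨-1, -1⟩, ⟨-1, -1⟩, 0⟩,
  by decide +kernel, by decide +kernel⟩

theorem exists_unitO_ozO (k : EOZˣ) : ∃ a : VOˣ, ozO a * k = 1 := by
  have h0 : ∀ k : EOZ, k * k * k = k := by decide +kernel
  have h1 : ∀ k : EOZ, k * k = 1 → ∃ h i j l : Fin 2,
      (-1 : EOZ) ^ h.1 * ⟨⟨0, 1⟩, 0⟩ ^ i.1 * ⟨0, 1⟩ ^ j.1 *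
        ⟨⟨-1, 1⟩, ⟨-1, -1⟩⟩ ^ l.1 * k = 1 := by
    decide +kernel
  obtain ⟨h, i, j, l, h2⟩ := h1 k.1 (by
    have h2 := congrArg (· * k⁻¹.1) (h0 k.1)
    simpa only [Units.mul_inv_cancel_right, Units.mul_inv] using h2)
  refine ⟨(-1) ^ h.1 * unitOx ^ i.1 * unitOy ^ j.1 * unitOe ^ l.1, ?_⟩
  rw [← h2]
  have hx : ozO unitOx = ⟨⟨0, 1⟩, 0⟩ := by decide +kernel
  have hy : ozO unitOy = ⟨0, 1⟩ := by decide +kernel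
  have he : ozO unitOe = ⟨⟨-1, 1⟩, ⟨-1, -1⟩⟩ := by decide +kernel
  simp only [Units.val_mul, Units.val_pow_eq_pow_val, Units.val_neg, Units.val_one, map_mul,
    map_pow, map_neg, map_one, hx, hy, he]

theorem exists_unit_zaZ (i j : ℕ) : ∃ (a : VZˣ) (b : VOˣ),
    zaZ a = (⟨⟨0, 1⟩, 0⟩ : EZA) ^ i * ⟨0, 1⟩ ^ j ∧ ozO b = ozZ a := by
  refine ⟨(⟨⟨⟨0, 1⟩, 0⟩, ⟨⟨0, 1⟩, 0⟩, by decide +kernel, by decide +kernel⟩ : VZˣ) ^ i *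
    (⟨⟨0, 1⟩, ⟨0, 1⟩, by decide +kernel, by decide +kernel⟩ : VZˣ) ^ j,
    unitOx ^ i * unitOy ^ j, ?_, ?_⟩
  · simp only [Units.val_mul, Units.val_pow_eq_pow_val, map_mul, map_pow]
    congr 2
  · simp only [Units.val_mul, Units.val_pow_eq_pow_val, map_mul, map_pow]
    congr 2

theorem exists_unitO_upper (p : K2) : ∃ o : VOˣ, boO o = !![1, p; 0, 1] ∧ ozO o = 1 := by
  have h : ∀ p : K2, ∃ r ∈ ([0, 1, ⟨0, 1⟩, ⟨1, 1⟩] : List RO),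
      (1 + ⟨r, 0, 0, 0⟩ * ⟨-1, ⟨0, -2⟩, 1, ⟨0, 2⟩⟩ : VO) *
        (1 - ⟨r, 0, 0, 0⟩ * ⟨-1, ⟨0, -2⟩, 1, ⟨0, 2⟩⟩) = 1 ∧
      (1 - ⟨r, 0, 0, 0⟩ * ⟨-1, ⟨0, -2⟩, 1, ⟨0, 2⟩⟩ : VO) *
        (1 + ⟨r, 0, 0, 0⟩ * ⟨-1, ⟨0, -2⟩, 1, ⟨0, 2⟩⟩) = 1 ∧
      boO (1 + ⟨r, 0, 0, 0⟩ * ⟨-1, ⟨0, -2⟩, 1, ⟨0, 2⟩⟩) = !![1, p; 0, 1] ∧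
      ozO (1 + ⟨r, 0, 0, 0⟩ * ⟨-1, ⟨0, -2⟩, 1, ⟨0, 2⟩⟩) = 1 := by
    decide +kernel
  obtain ⟨r, -, h1, h2, h3, h4⟩ := h p
  exact ⟨⟨_, _, h1, h2⟩, h3, h4⟩

theorem exists_unitO_lower (p : K2) : ∃ o : VOˣ, boO o = !![1, 0; p, 1] ∧ ozO o = 1 := by
  have h : ∀ p : K2, ∃ r ∈ ([0, 1, ⟨0, 1⟩, ⟨1, 1⟩] : List RO),
      (1 + ⟨r, 0, 0, 0⟩ * ⟨1, ⟨0, 2⟩, -2, ⟨0, -1⟩⟩ : VO) *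
        (1 - ⟨r, 0, 0, 0⟩ * ⟨1, ⟨0, 2⟩, -2, ⟨0, -1⟩⟩) = 1 ∧
      (1 - ⟨r, 0, 0, 0⟩ * ⟨1, ⟨0, 2⟩, -2, ⟨0, -1⟩⟩ : VO) *
        (1 + ⟨r, 0, 0, 0⟩ * ⟨1, ⟨0, 2⟩, -2, ⟨0, -1⟩⟩) = 1 ∧
      boO (1 + ⟨r, 0, 0, 0⟩ * ⟨1, ⟨0, 2⟩, -2, ⟨0, -1⟩⟩) = !![1, 0; p, 1] ∧
      ozO (1 + ⟨r, 0, 0, 0⟩ * ⟨1, ⟨0, 2⟩, -2, ⟨0, -1⟩⟩) = 1 := by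
    decide +kernel
  obtain ⟨r, -, h1, h2, h3, h4⟩ := h p
  exact ⟨⟨_, _, h1, h2⟩, h3, h4⟩

theorem exists_unitO_boO (t : EBO) (ht : t.det = 1) : ∃ o : VOˣ, boO o = t ∧ ozO o = 1 := by
  have h : ∀ a b c d : K2, a * d - b * c = 1 → ∃ p q r s : K2,
      a = (1 + p * q) * (1 + r * s) + p * s ∧ b = (1 + p * q) * r + p ∧
      c = q * (1 + r * s) + s ∧ d = q * r + 1 := by
    decide +kernel
  rw [det_fin_two] at ht
  obtain ⟨p, q, r, s, ha, hb, hc, hd⟩ := h _ _ _ _ ht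
  obtain ⟨o₁, h1, k1⟩ := exists_unitO_upper p
  obtain ⟨o₂, h2, k2⟩ := exists_unitO_lower q
  obtain ⟨o₃, h3, k3⟩ := exists_unitO_upper r
  obtain ⟨o₄, h4, k4⟩ := exists_unitO_lower s
  refine ⟨o₁ * o₂ * (o₃ * o₄), ?_, by simp [k1, k2, k3, k4]⟩
  simp only [Units.val_mul, map_mul, h1, h2, h3, h4]
  rw [eta_fin_two t, ha, hb, hc, hd]
  simp only [mul_fin_two]
  ext1 i j
  fin_cases i <;> fin_cases j <;> simp

/-! ### The patched modules -/

instance : Module ZQ24 (VA × VB × VZ × VO) := Module.compHom _ piAll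

theorem smul_def (r : ZQ24) (p : VA × VB × VZ × VO) :
    r • p = (piA r * p.1, piB r * p.2.1, piZ r * p.2.2.1, piO r * p.2.2.2) := rfl

/-- The module obtained by patching the vertex rings along the unit `u` of `EAB`. -/
def patch (u : EAB) : Submodule ZQ24 (VA × VB × VZ × VO) where
  carrier := {p | abA p.1 * u = abB p.2.1 ∧ boB p.2.1 = boO p.2.2.2 ∧ ozO p.2.2.2 = ozZ p.2.2.1 ∧
    zaZ p.2.2.1 = zaA p.1}
  zero_mem' := by simp
  add_mem' := by
    rintro p q ⟨h1, h2, h3, h4⟩ ⟨k1, k2, k3, k4⟩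
    simp [add_mul, h1, h2, h3, h4, k1, k2, k3, k4]
  smul_mem' := by
    rintro r p ⟨h1, h2, h3, h4⟩
    simp [smul_def, mul_assoc, h1, h2, h3, h4, abA_piA, boB_piB, ozO_piO, zaZ_piZ]

theorem mem_patch {u : EAB} {a : VA} {b : VB} {z : VZ} {o : VO} : (a, b, z, o) ∈ patch u ↔
    abA a * u = abB b ∧ boB b = boO o ∧ ozO o = ozZ z ∧ zaZ z = zaA a := Iff.rfl

section
variable {R S₁ S₂ T κ ι : Type} [Ring R] [Ring S₁] [Ring S₂] [Ring T] [Fintype κ] [DecidableEq κ]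
  [Fintype ι] [DecidableEq ι] {V : Matrix κ ι R} {U : Matrix ι κ R} {f₁ : R →+* S₁} {f₂ : R →+* S₂}
  {g₁ : S₁ →+* T} {g₂ : S₂ →+* T}

/-- The unit comparing two frames along an edge. -/
def edge (h : ∀ r, g₁ (f₁ r) = g₂ (f₂ r)) (F : Frame (V.map f₁) (U.map f₁))
    (G : Frame (V.map f₂) (U.map f₂)) : Tˣ :=
  (F.map g₁ (V' := V.map (g₁.comp f₁)) (U' := U.map (g₁.comp f₁)) rfl rfl).compare
    (G.map g₂ (by ext; simp [h]) (by ext; simp [h]))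

/-- The coordinate with respect to a frame of the image of a vector. -/
def Frame.proj (f₁ : R →+* S₁) (F : Frame (V.map f₁) (U.map f₁)) (x : ι → R) : S₁ :=
  (f₁ ∘ x) ⬝ᵥ F.coord

variable (h : ∀ r, g₁ (f₁ r) = g₂ (f₂ r)) (F : Frame (V.map f₁) (U.map f₁))
    (G : Frame (V.map f₂) (U.map f₂))

theorem edge_scale (a : S₁ˣ) (b : S₂ˣ) : (edge h (F.scale a) (G.scale b)).1 =
    g₁ a * (edge h F G).1 * g₂ b⁻¹.1 := by
  change (g₁ ∘ (a.1 • F.gen)) ⬝ᵥ (g₂ ∘ fun j => G.coord j * b⁻¹.1) =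
    g₁ a * ((g₁ ∘ F.gen) ⬝ᵥ (g₂ ∘ G.coord)) * g₂ b⁻¹.1
  simp only [dotProduct, Pi.smul_apply, smul_eq_mul, Finset.mul_sum, Finset.sum_mul, mul_assoc,
    Function.comp_apply, map_mul]

theorem edge_mul_gen (i : ι) : (edge h F G).1 * g₂ (G.gen i) = g₁ (F.gen i) :=
  congrFun ((F.map g₁ (V' := V.map (g₁.comp f₁)) (U' := U.map (g₁.comp f₁)) rfl rfl).compare_smul
    (G.map g₂ (by ext; simp [h]) (by ext; simp [h]))) i

theorem dot_mul_edge {x : ι → R} (hx : x ᵥ* U = 0) :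
    g₁ (F.proj f₁ x) * (edge h F G).1 = g₂ (G.proj f₂ x) := by
  have h1 := (F.map g₁ (V' := V.map (g₁.comp f₁)) (U' := U.map (g₁.comp f₁)) rfl
    rfl).dot_coord_mul_compare (G.map g₂ (by ext; simp [h]) (by ext; simp [h]))
    (x := (g₁.comp f₁) ∘ x) (by
      ext j
      rw [← RingHom.map_vecMul, hx]
      simp)
  have h2 : (g₁.comp f₁) ∘ x = g₂ ∘ f₂ ∘ x := funext fun i => h (x i)
  rw [Frame.proj, Frame.proj, RingHom.map_dotProduct, RingHom.map_dotProduct]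
  refine Eq.trans h1 ?_
  rw [h2]
  rfl

end

theorem sdet_edge {R S₁ S₂ T κ : Type} [Ring R] [Ring S₁] [Ring S₂] [Ring T] [Fintype κ]
    [DecidableEq κ] {V : Matrix κ (Unit ⊕ κ) R} {U : Matrix (Unit ⊕ κ) κ R} {f₁ : R →+* S₁}
    {f₂ : R →+* S₂} {g₁ : S₁ →+* T} {g₂ : S₂ →+* T} (h : ∀ r, g₁ (f₁ r) = g₂ (f₂ r))
    (F : Frame (V.map f₁) (U.map f₁)) (G : Frame (V.map f₂) (U.map f₂)) {n C : Type} [Fintype n]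
    [DecidableEq n] [CommRing C] (σ : T →+* Matrix n n C) :
    sdet σ (F.square.map g₁) = (σ (edge h F G).1).det * sdet σ (G.square.map g₂) := by
  have h1 := Frame.sdet_square (F.map g₁ (V' := V.map (g₁.comp f₁)) (U' := U.map (g₁.comp f₁)) rfl
    rfl) (G.map g₂ (by ext; simp [h]) (by ext; simp [h])) σ
  rw [Frame.square_map g₂] at h1
  exact (congrArg (sdet σ) (Frame.square_map g₁ F (V' := V.map (g₁.comp f₁)) rfl
    rfl)).symm.trans h1

/-- A split surjection with kernel `P`. -/
theorem exists_ker_equiv {S P κ ι : Type} [Ring S] [AddCommGroup P] [Module S P] [Fintype κ]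
    [DecidableEq κ] [Fintype ι] [DecidableEq ι] (φ : (P × (κ → S)) ≃ₗ[S] (ι → S)) :
    ∃ (V : Matrix κ ι S) (U : Matrix ι κ S), V * U = 1 ∧
      Nonempty (P ≃ₗ[S] LinearMap.ker U.vecMulLinear) := by
  let V : Matrix κ ι S := Matrix.of fun i => φ (0, Pi.single i 1)
  let U : Matrix ι κ S := Matrix.of fun j => (φ.symm (Pi.single j 1)).2
  have hU : ∀ x, x ᵥ* U = (φ.symm x).2 := fun x => by
    conv_rhs => rw [pi_eq_sum_univ' x]
    ext k
    simp [vecMul, dotProduct, map_sum, U, Prod.snd_sum]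
  refine ⟨V, U, ?_, ⟨LinearEquiv.ofBijective ((φ.toLinearMap ∘ₗ LinearMap.inl S P (κ → S)).codRestrict _
    fun p => ?_) ⟨fun p q hpq => ?_, fun x => ?_⟩⟩⟩
  · refine funext fun i => ?_
    change V i ᵥ* U = _
    rw [hU]
    change (φ.symm (φ (0, Pi.single i 1))).2 = _
    rw [LinearEquiv.symm_apply_apply]
    ext j
    change (Pi.single i (1 : S) : κ → S) j = _
    rw [one_apply, Pi.single_apply]
    simp only [eq_comm]
  · change _ ᵥ* U = 0
    rw [hU]
    simp
  · have h1 := φ.injective (congrArg Subtype.val hpq)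
    exact congrArg Prod.fst h1
  · refine ⟨(φ.symm x).1, Subtype.ext ?_⟩
    have h1 : (φ.symm x).2 = 0 := by rw [← hU]; exact x.2
    change φ ((φ.symm x).1, 0) = x
    rw [← h1]
    exact φ.apply_symm_apply x

/-- Frames at the four vertices. -/
structure Frames {m : ℕ} (V : Matrix (Fin m) (Unit ⊕ Fin m) ZQ24)
    (U : Matrix (Unit ⊕ Fin m) (Fin m) ZQ24) where
  /-- the frame over `VA` -/
  A : Frame (V.map piA) (U.map piA)
  /-- the frame over `VB` -/
  B : Frame (V.map piB) (U.map piB)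
  /-- the frame over `VZ` -/
  Z : Frame (V.map piZ) (U.map piZ)
  /-- the frame over `VO` -/
  O : Frame (V.map piO) (U.map piO)

/-- The coordinates with respect to the frames. -/
def Frames.coords {m : ℕ} {V : Matrix (Fin m) (Unit ⊕ Fin m) ZQ24}
    {U : Matrix (Unit ⊕ Fin m) (Fin m) ZQ24} (F : Frames V U) :
    (Unit ⊕ Fin m → ZQ24) →ₗ[ZQ24] VA × VB × VZ × VO where
  toFun x := (F.A.proj piA x, F.B.proj piB x, F.Z.proj piZ x,
    F.O.proj piO x)
  map_add' x y := by
    simp only [Frame.proj, dotProduct, Function.comp_apply, Pi.add_apply, map_add, add_mul,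
      Finset.sum_add_distrib, Prod.mk_add_mk]
  map_smul' r x := by
    simp only [Frame.proj, dotProduct, smul_def, Function.comp_apply, Pi.smul_apply, smul_eq_mul, map_mul,
      Finset.mul_sum, mul_assoc, RingHom.id_apply]

theorem Frames.coords_apply {m : ℕ} {V : Matrix (Fin m) (Unit ⊕ Fin m) ZQ24}
    {U : Matrix (Unit ⊕ Fin m) (Fin m) ZQ24} (F : Frames V U) (x : Unit ⊕ Fin m → ZQ24) :
    F.coords x = (F.A.proj piA x, F.B.proj piB x, F.Z.proj piZ x,
      F.O.proj piO x) := rfl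

theorem Frames.coords_mem {m : ℕ} {V : Matrix (Fin m) (Unit ⊕ Fin m) ZQ24}
    {U : Matrix (Unit ⊕ Fin m) (Fin m) ZQ24} (F : Frames V U) (hbo : (edge boB_piB F.B F.O).1 = 1)
    (hoz : (edge ozO_piO F.O F.Z).1 = 1) (hza : (edge zaZ_piZ F.Z F.A).1 = 1)
    {x : Unit ⊕ Fin m → ZQ24} (hx : x ᵥ* U = 0) :
    F.coords x ∈ patch (edge abA_piA F.A F.B).1 := by
  have h1 := dot_mul_edge abA_piA F.A F.B hx
  have h2 := dot_mul_edge boB_piB F.B F.O hx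
  have h3 := dot_mul_edge ozO_piO F.O F.Z hx
  have h4 := dot_mul_edge zaZ_piZ F.Z F.A hx
  rw [hbo, mul_one] at h2
  rw [hoz, mul_one] at h3
  rw [hza, mul_one] at h4
  rw [F.coords_apply]
  exact mem_patch.2 ⟨h1, h2, h3, h4⟩

theorem Frames.coords_injOn {m : ℕ} {V : Matrix (Fin m) (Unit ⊕ Fin m) ZQ24}
    {U : Matrix (Unit ⊕ Fin m) (Fin m) ZQ24} (F : Frames V U)
    {x y : Unit ⊕ Fin m → ZQ24} (hx : x ᵥ* U = 0) (hy : y ᵥ* U = 0)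
    (hxy : F.coords x = F.coords y) : x = y := by
  have key : ∀ {S : Type} [Ring S] (f : ZQ24 →+* S) (G : Frame (V.map f) (U.map f)),
      G.proj f x = G.proj f y → ∀ i, f (x i) = f (y i) := by
    intro S _ f G h i
    have hz : ∀ z : Unit ⊕ Fin m → ZQ24, z ᵥ* U = 0 → (f ∘ z) ᵥ* (U.map f) = 0 := fun z hz => by
      ext j
      rw [← RingHom.map_vecMul, hz]
      simp
    have h1 := G.dot_smul (hz x hx)
    rw [← Frame.proj, h, Frame.proj, G.dot_smul (hz y hy)] at h1
    exact (congrFun h1 i).symm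
  have h1 : (F.A.proj piA x, F.B.proj piB x,
      F.Z.proj piZ x, F.O.proj piO x) = (F.A.proj piA y,
      F.B.proj piB y, F.Z.proj piZ y, F.O.proj piO y) :=
    hxy
  simp only [Prod.mk.injEq] at h1
  obtain ⟨hA, hB, hZ, hO⟩ := h1
  exact funext fun i => eq_of_pi (key _ _ hA i) (key _ _ hB i) (key _ _ hZ i) (key _ _ hO i)

theorem Frames.exists_coords_eq {m : ℕ} {V : Matrix (Fin m) (Unit ⊕ Fin m) ZQ24}
    {U : Matrix (Unit ⊕ Fin m) (Fin m) ZQ24} (F : Frames V U)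
    (hbo : (edge boB_piB F.B F.O).1 = 1)
    (hoz : (edge ozO_piO F.O F.Z).1 = 1) (hza : (edge zaZ_piZ F.Z F.A).1 = 1)
    {p : VA × VB × VZ × VO} (hp : p ∈ patch (edge abA_piA F.A F.B).1) :
    ∃ x : Unit ⊕ Fin m → ZQ24, x ᵥ* U = 0 ∧ F.coords x = p := by
  obtain ⟨a, b, z, o⟩ := p
  obtain ⟨h1, h2, h3, h4⟩ := hp
  simp only at h1 h2 h3 h4
  have hex : ∀ i, ∃ r, piA r = a * F.A.gen i ∧ piB r = b * F.B.gen i ∧ piZ r = z * F.Z.gen i ∧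
      piO r = o * F.O.gen i := fun i => by
    apply exists_of_matched
    · rw [map_mul, map_mul, ← edge_mul_gen abA_piA F.A F.B, ← mul_assoc, h1]
    · rw [map_mul, map_mul, ← edge_mul_gen boB_piB F.B F.O, hbo, one_mul, h2]
    · rw [map_mul, map_mul, ← edge_mul_gen ozO_piO F.O F.Z, hoz, one_mul, h3]
    · rw [map_mul, map_mul, ← edge_mul_gen zaZ_piZ F.Z F.A, hza, one_mul, h4]
  choose x hA hB hZ hO using hex
  have hdot : ∀ {S : Type} [Ring S] (f : ZQ24 →+* S) (G : Frame (V.map f) (U.map f)) (s : S),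
      (∀ i, f (x i) = s * G.gen i) → G.proj f x = s ∧ ∀ j, f ((x ᵥ* U) j) = f 0 := by
    intro S _ f G s h
    have hf : f ∘ x = s • G.gen := funext h
    refine ⟨by rw [Frame.proj, hf, smul_dotProduct, G.gen_dot_coord, smul_eq_mul, mul_one], fun j => ?_⟩
    rw [RingHom.map_vecMul, hf, smul_vecMul, G.gen_vecMul, smul_zero, map_zero, Pi.zero_apply]
  obtain ⟨eA, kA⟩ := hdot _ F.A a hA
  obtain ⟨eB, kB⟩ := hdot _ F.B b hB
  obtain ⟨eZ, kZ⟩ := hdot _ F.Z z hZ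
  obtain ⟨eO, kO⟩ := hdot _ F.O o hO
  refine ⟨x, funext fun j => eq_of_pi (kA j) (kB j) (kZ j) (kO j), ?_⟩
  change (F.A.proj piA x, F.B.proj piB x, F.Z.proj piZ x,
    F.O.proj piO x) = _
  rw [eA, eB, eZ, eO]

theorem nonempty_linearEquiv_of_injOn {S M N : Type} [Ring S] [AddCommGroup M] [AddCommGroup N]
    [Module S M] [Module S N] (f : M →ₗ[S] N) (p : Submodule S M) (q : Submodule S N)
    (h : ∀ x ∈ p, f x ∈ q) (hinj : ∀ x ∈ p, ∀ y ∈ p, f x = f y → x = y)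
    (hsurj : ∀ y ∈ q, ∃ x ∈ p, f x = y) : Nonempty (p ≃ₗ[S] q) :=
  ⟨LinearEquiv.ofBijective (f.restrict h)
    ⟨fun x y hxy => Subtype.ext (hinj x x.2 y y.2 (congrArg Subtype.val hxy)), fun y => by
      obtain ⟨x, hx, hxy⟩ := hsurj y y.2
      exact ⟨⟨x, hx⟩, Subtype.ext hxy⟩⟩⟩

theorem Frames.nonempty_equiv {m : ℕ} {V : Matrix (Fin m) (Unit ⊕ Fin m) ZQ24}
    {U : Matrix (Unit ⊕ Fin m) (Fin m) ZQ24} (F : Frames V U)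
    (hbo : (edge boB_piB F.B F.O).1 = 1)
    (hoz : (edge ozO_piO F.O F.Z).1 = 1) (hza : (edge zaZ_piZ F.Z F.A).1 = 1) :
    Nonempty (LinearMap.ker U.vecMulLinear ≃ₗ[ZQ24] patch (edge abA_piA F.A F.B).1) :=
  nonempty_linearEquiv_of_injOn F.coords _ _ (fun _ hx => F.coords_mem hbo hoz hza hx)
    (fun _ hx _ hy => F.coords_injOn hx hy) fun _ hp => F.exists_coords_eq hbo hoz hza hp

/-! ### Normalisation of the frames -/

theorem map_mul_map_eq_one {R S κ ι : Type} [Ring R] [Ring S] [Fintype κ] [DecidableEq κ] [Fintype ι]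
    {V : Matrix κ ι R} {U : Matrix ι κ R} (h : V * U = 1) (f : R →+* S) :
    V.map f * U.map f = 1 := by
  rw [← Matrix.map_mul, h, Matrix.map_one f (map_zero f) (map_one f)]

section
variable {m : ℕ} {V : Matrix (Fin m) (Unit ⊕ Fin m) ZQ24} {U : Matrix (Unit ⊕ Fin m) (Fin m) ZQ24}

theorem edge_zaZ_eq (hVU : V * U = 1) (F : Frame (V.map piZ) (U.map piZ))
    (G : Frame (V.map piA) (U.map piA)) :
    ∃ i j : ℕ, (edge zaZ_piZ F G).1 = (⟨⟨0, 1⟩, 0⟩ : EZA) ^ i * ⟨0, 1⟩ ^ j := by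
  have h1 := sdet_edge zaZ_piZ F G (Matrix.scalar Unit)
  obtain ⟨i, j, h2⟩ := sdet_zaA G.square (G.isUnit_square (map_mul_map_eq_one hVU piA))
  rw [sdet_comp] at h2
  have h3 : sdet (Matrix.scalar Unit) (F.square.map zaZ) = zaZ F.square.det := by
    rw [← sdet_comp, sdet_scalar]
    exact (RingHom.map_det _ _).symm
  have h4 : (Matrix.scalar Unit (edge zaZ_piZ F G).1).det = (edge zaZ_piZ F G).1 := by
    simp
  obtain ⟨k, l, h5⟩ := eq_of_isUnit_VZ
    ((Matrix.isUnit_iff_isUnit_det _).1 (F.isUnit_square (map_mul_map_eq_one hVU piZ)))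
  have h6 : zaZ F.square.det = (⟨⟨0, 1⟩, 0⟩ : EZA) ^ (k : ℕ) * ⟨0, 1⟩ ^ (l : ℕ) := by
    have e1 : zaZ ⟨⟨0, 1⟩, 0⟩ = ⟨⟨0, 1⟩, 0⟩ := by decide +kernel
    have e2 : zaZ ⟨0, 1⟩ = ⟨0, 1⟩ := by decide +kernel
    have e3 : ∀ t : EZA, -t = t := fun t => by
      have : (2 : EZA) = 0 := by decide +kernel
      rw [neg_eq_iff_add_eq_zero, ← two_mul, this, zero_mul]
    rcases h5 with h5 | h5
    · rw [h5, map_mul, map_pow, map_pow, e1, e2]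
    · rw [h5, map_neg, map_mul, map_pow, map_pow, e1, e2, e3]
  rw [h2, h3, h4, h6] at h1
  have hc : (⟨⟨0, 1⟩, 0⟩ : EZA) ^ 2 = 1 := by decide +kernel
  have hy : (⟨0, 1⟩ : EZA) ^ 2 = 1 := by decide +kernel
  refine ⟨i + k, j + l, ?_⟩
  generalize (edge zaZ_piZ F G).1 = s at h1
  generalize (⟨⟨0, 1⟩, 0⟩ : EZA) = c at *
  generalize (⟨0, 1⟩ : EZA) = y at *
  have hc' : c ^ (i : ℕ) * c ^ (i : ℕ) = 1 := by rw [← mul_pow, ← sq, hc, one_pow]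
  have hy' : y ^ (j : ℕ) * y ^ (j : ℕ) = 1 := by rw [← mul_pow, ← sq, hy, one_pow]
  calc s = s * (c ^ (i : ℕ) * c ^ (i : ℕ)) * (y ^ (j : ℕ) * y ^ (j : ℕ)) := by
        rw [hc', hy', mul_one, mul_one]
    _ = s * (c ^ (i : ℕ) * y ^ (j : ℕ)) * (c ^ (i : ℕ) * y ^ (j : ℕ)) := by ring
    _ = _ := by rw [← h1]; ring

theorem det_edge_boB (hVU : V * U = 1) (F : Frames V U) {e : ZMod 3}
    (hab : (edge abA_piA F.A F.B).1 = (unitE e).1) (hoz : (edge ozO_piO F.O F.Z).1 = 1) :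
    (edge boB_piB F.B F.O).1.det = 1 := by
  have h1 := sdet_edge boB_piB F.B F.O (RingHom.id EBO)
  have hB : sdet (RingHom.id EBO) (F.B.square.map boB) = 1 := by
    refine sdet_boB (F.B.isUnit_square (map_mul_map_eq_one hVU piB)) ?_
    have h2 := sdet_edge abA_piA F.A F.B (quatRep (-1 : ZMod 3) 0 (-1))
    rw [sdet_quatRep_abA (F.A.isUnit_square (map_mul_map_eq_one hVU piA)), hab] at h2
    have h3 : ∀ e : ZMod 3, (quatRep (-1 : ZMod 3) 0 (-1) ⟨1, e, e, e⟩).det = 1 := by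
      decide +kernel
    have h4 : (quatRep (-1 : ZMod 3) 0 (-1) (unitE e).1).det = 1 := h3 e
    rw [h4, one_mul] at h2
    exact h2.symm
  have hO : sdet (RingHom.id EBO) (F.O.square.map boO) = 1 := by
    refine sdet_boO (F.O.isUnit_square (map_mul_map_eq_one hVU piO)) (z := F.Z.square.det)
      ((Matrix.isUnit_iff_isUnit_det _).1 (F.Z.isUnit_square (map_mul_map_eq_one hVU piZ))) ?_
    have h2 := sdet_edge ozO_piO F.O F.Z (Matrix.scalar Unit)
    rw [hoz, map_one, det_one, one_mul, ← sdet_comp, ← sdet_comp, sdet_scalar, sdet_scalar] at h2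
    rw [h2]
    exact (RingHom.map_det _ _).symm
  rw [hB, hO, mul_one] at h1
  exact h1.symm

theorem Frame.eq_scale_one {S κ ι : Type} [Ring S] [Fintype κ] [DecidableEq κ] [Fintype ι]
    [DecidableEq ι] {V : Matrix κ ι S} {U : Matrix ι κ S} (F : Frame V U) : F = F.scale 1 := by
  cases F
  simp [Frame.scale]

theorem exists_frame_O (hVU : V * U = 1) {A : Frame (V.map piA) (U.map piA)}
    {B : Frame (V.map piB) (U.map piB)} {Z : Frame (V.map piZ) (U.map piZ)}
    {O₁ : Frame (V.map piO) (U.map piO)} {e : ZMod 3}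
    (hab : (edge abA_piA A B).1 = (unitE e).1) (hoz : (edge ozO_piO O₁ Z).1 = 1) :
    ∃ O : Frame (V.map piO) (U.map piO), (edge boB_piB B O).1 = 1 ∧ (edge ozO_piO O Z).1 = 1 := by
  have hdet : (edge boB_piB B O₁).1.det = 1 := det_edge_boB hVU ⟨A, B, Z, O₁⟩ hab hoz
  obtain ⟨t, h6, h7⟩ := exists_unitO_boO (edge boB_piB B O₁).1 hdet
  refine ⟨O₁.scale t, ?_, ?_⟩
  · rw [B.eq_scale_one, edge_scale, Units.val_one, map_one, one_mul]
    rw [← h6, ← map_mul, Units.mul_inv, map_one]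
  · rw [Z.eq_scale_one, edge_scale, h7, inv_one, Units.val_one, map_one, one_mul, mul_one]
    exact hoz

theorem exists_frames_A_B (hVU : V * U = 1) : ∃ (A : Frame (V.map piA) (U.map piA))
    (B : Frame (V.map piB) (U.map piB)) (e : ZMod 3), (edge abA_piA A B).1 = (unitE e).1 := by
  obtain ⟨A₀⟩ := hasCancelA m _ _ (map_mul_map_eq_one hVU piA)
  obtain ⟨B₀⟩ := hasCancelB m _ _ (map_mul_map_eq_one hVU piB)
  obtain ⟨a, b, e, h1⟩ := exists_unitE (edge abA_piA A₀ B₀)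
  refine ⟨A₀.scale a, B₀.scale b, e, ?_⟩
  rw [edge_scale, h1, mul_assoc, ← map_mul, Units.mul_inv, map_one, mul_one]

theorem exists_frames_Z_O (hVU : V * U = 1) (A : Frame (V.map piA) (U.map piA)) :
    ∃ (Z : Frame (V.map piZ) (U.map piZ)) (O : Frame (V.map piO) (U.map piO)),
      (edge ozO_piO O Z).1 = 1 ∧ (edge zaZ_piZ Z A).1 = 1 := by
  obtain ⟨Z₀⟩ := hasCancelZ m _ _ (map_mul_map_eq_one hVU piZ)
  obtain ⟨O₀⟩ := hasCancelO m _ _ (map_mul_map_eq_one hVU piO)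
  obtain ⟨o, h2⟩ := exists_unitO_ozO (edge ozO_piO O₀ Z₀)
  obtain ⟨i, j, h3⟩ := edge_zaZ_eq hVU Z₀ A
  obtain ⟨z, o', h4, h5⟩ := exists_unit_zaZ i j
  refine ⟨Z₀.scale z, O₀.scale (o' * o), ?_, ?_⟩
  · rw [edge_scale, Units.val_mul, map_mul, mul_assoc (ozO o'.1), h2, mul_one, h5,
      ← map_mul, Units.mul_inv, map_one]
  · rw [A.eq_scale_one, edge_scale, h3, h4, inv_one, Units.val_one, map_one, mul_one]
    have hc : (⟨⟨0, 1⟩, 0⟩ : EZA) ^ 2 = 1 := by decide +kernel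
    have hy : (⟨0, 1⟩ : EZA) ^ 2 = 1 := by decide +kernel
    rw [← sq, mul_pow, ← pow_mul, ← pow_mul, mul_comm i, mul_comm j, pow_mul, pow_mul, hc, hy,
      one_pow, one_pow, one_mul]

theorem exists_frames (hVU : V * U = 1) : ∃ (F : Frames V U) (e : ZMod 3),
    (edge abA_piA F.A F.B).1 = (unitE e).1 ∧ (edge boB_piB F.B F.O).1 = 1 ∧
      (edge ozO_piO F.O F.Z).1 = 1 ∧ (edge zaZ_piZ F.Z F.A).1 = 1 := by
  obtain ⟨A, B, e, hab⟩ := exists_frames_A_B hVU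
  obtain ⟨Z, O₁, hoz₁, hza⟩ := exists_frames_Z_O hVU A
  obtain ⟨O, hbo, hoz⟩ := exists_frame_O hVU hab hoz₁
  exact ⟨⟨A, B, Z, O⟩, e, hab, hbo, hoz, hza⟩

end

theorem exists_equiv_patch {P : Type} [AddCommGroup P] [Module ZQ24 P] {m : ℕ}
    (φ : (P × (Fin m → ZQ24)) ≃ₗ[ZQ24] (Fin (m + 1) → ZQ24)) :
    ∃ e : ZMod 3, Nonempty (P ≃ₗ[ZQ24] patch (unitE e).1) := by
  have ψ : Fin (m + 1) ≃ Unit ⊕ Fin m :=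
    Fintype.equivOfCardEq (by simp [add_comm])
  obtain ⟨V, U, hVU, ⟨f⟩⟩ := exists_ker_equiv (φ.trans (LinearEquiv.funCongrLeft ZQ24 ZQ24 ψ.symm))
  obtain ⟨F, e, hab, hbo, hoz, hza⟩ := exists_frames hVU
  obtain ⟨g⟩ := F.nonempty_equiv hbo hoz hza
  rw [hab] at g
  exact ⟨e, ⟨f.trans g⟩⟩

/-! ### The patched modules are stably free -/

theorem smul_one_mem (r : ZQ24) : r • ((1, 1, 1, 1) : VA × VB × VZ × VO) ∈ patch 1 :=
  Submodule.smul_mem _ r (mem_patch.2 (by simp only [map_one, mul_one, and_self]))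

theorem exists_smul_one_eq {p : VA × VB × VZ × VO} (hp : p ∈ patch 1) :
    ∃ r : ZQ24, r • ((1, 1, 1, 1) : VA × VB × VZ × VO) = p := by
  obtain ⟨a, b, z, o⟩ := p
  obtain ⟨h1, h2, h3, h4⟩ := mem_patch.1 hp
  rw [mul_one] at h1
  obtain ⟨r, rA, rB, rZ, rO⟩ := exists_of_matched h1 h2 h3 h4
  refine ⟨r, ?_⟩
  simp only [smul_def, mul_one, rA, rB, rZ, rO]

theorem smul_one_injective {r s : ZQ24}
    (h : r • ((1, 1, 1, 1) : VA × VB × VZ × VO) = s • (1, 1, 1, 1)) : r = s := by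
  simp only [smul_def, mul_one, Prod.mk.injEq] at h
  exact eq_of_pi h.1 h.2.1 h.2.2.1 h.2.2.2

theorem nonempty_equiv_patch_one : Nonempty (ZQ24 ≃ₗ[ZQ24] patch 1) :=
  ⟨LinearEquiv.ofBijective
    ((LinearMap.toSpanSingleton ZQ24 (VA × VB × VZ × VO) (1, 1, 1, 1)).codRestrict _ smul_one_mem)
    ⟨fun _ _ h => smul_one_injective (congrArg Subtype.val h), fun p =>
      (exists_smul_one_eq p.2).imp fun _ h => Subtype.ext h⟩⟩

/-- The map between sums of two patched modules given by a two by two matrix over `VA`. -/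
def patchMap {u v : EAB} (M : Matrix (Fin 2) (Fin 2) VA) (h₀ : abA (M 0 0) * v = u)
    (h₁ : M.map abA 0 1 = 0 ∧ M.map abA 1 0 = 0 ∧ M.map abA 1 1 = 1) (h₂ : M.map zaA = 1) :
    (patch u × patch 1) →ₗ[ZQ24] (patch v × patch 1) where
  toFun p := (⟨(p.1.1.1 * M 0 0 + p.2.1.1 * M 1 0, p.1.1.2), by
      obtain ⟨e1, e2, e3⟩ := h₁
      rw [map_apply] at e2
      have k0 : zaA (M 0 0) = 1 := congrFun (congrFun h₂ 0) 0
      have k1 : zaA (M 1 0) = 0 := congrFun (congrFun h₂ 1) 0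
      obtain ⟨q1, q2, q3, q4⟩ := p.1.2
      refine ⟨?_, q2, q3, ?_⟩
      · rw [map_add, map_mul, map_mul, e2, mul_zero, add_zero, mul_assoc, h₀, q1]
      · rw [map_add, map_mul, map_mul, k0, k1, mul_zero, add_zero, mul_one]
        exact q4⟩,
    ⟨(p.1.1.1 * M 0 1 + p.2.1.1 * M 1 1, p.2.1.2), by
      obtain ⟨e1, e2, e3⟩ := h₁
      rw [map_apply] at e1 e3
      have k0 : zaA (M 0 1) = 0 := congrFun (congrFun h₂ 0) 1
      have k1 : zaA (M 1 1) = 1 := congrFun (congrFun h₂ 1) 1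
      obtain ⟨q1, q2, q3, q4⟩ := p.2.2
      refine ⟨?_, q2, q3, ?_⟩
      · rw [map_add, map_mul, map_mul, e1, e3, mul_zero, zero_add, mul_one]
        exact q1
      · rw [map_add, map_mul, map_mul, k0, k1, mul_zero, zero_add, mul_one]
        exact q4⟩)
  map_add' p q := by
    ext1 <;> refine Subtype.ext (Prod.ext ?_ rfl)
    · change (p.1.1.1 + q.1.1.1) * M 0 0 + (p.2.1.1 + q.2.1.1) * M 1 0 =
        (p.1.1.1 * M 0 0 + p.2.1.1 * M 1 0) + (q.1.1.1 * M 0 0 + q.2.1.1 * M 1 0)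
      rw [add_mul, add_mul]
      abel
    · change (p.1.1.1 + q.1.1.1) * M 0 1 + (p.2.1.1 + q.2.1.1) * M 1 1 =
        (p.1.1.1 * M 0 1 + p.2.1.1 * M 1 1) + (q.1.1.1 * M 0 1 + q.2.1.1 * M 1 1)
      rw [add_mul, add_mul]
      abel
  map_smul' r p := by
    ext1 <;> refine Subtype.ext (Prod.ext ?_ rfl)
    · change (piA r * p.1.1.1) * M 0 0 + (piA r * p.2.1.1) * M 1 0 =
        piA r * (p.1.1.1 * M 0 0 + p.2.1.1 * M 1 0)
      rw [mul_add, mul_assoc, mul_assoc]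
    · change (piA r * p.1.1.1) * M 0 1 + (piA r * p.2.1.1) * M 1 1 =
        piA r * (p.1.1.1 * M 0 1 + p.2.1.1 * M 1 1)
      rw [mul_add, mul_assoc, mul_assoc]

theorem patchMap_patchMap {u v : EAB} {M N : Matrix (Fin 2) (Fin 2) VA} (hMN : M * N = 1)
    (h₀ : abA (M 0 0) * v = u)
    (h₁ : M.map abA 0 1 = 0 ∧ M.map abA 1 0 = 0 ∧ M.map abA 1 1 = 1) (h₂ : M.map zaA = 1)
    (k₀ : abA (N 0 0) * u = v)
    (k₁ : N.map abA 0 1 = 0 ∧ N.map abA 1 0 = 0 ∧ N.map abA 1 1 = 1) (k₂ : N.map zaA = 1)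
    (p : patch u × patch 1) : patchMap N k₀ k₁ k₂ (patchMap M h₀ h₁ h₂ p) = p := by
  have e : ∀ i j, M i 0 * N 0 j + M i 1 * N 1 j = (1 : Matrix (Fin 2) (Fin 2) VA) i j := fun i j => by
    rw [← hMN, Matrix.mul_apply, Fin.sum_univ_two]
  have key : ∀ (a b : VA) (j : Fin 2), (a * M 0 0 + b * M 1 0) * N 0 j + (a * M 0 1 + b * M 1 1) * N 1 j =
      a * (1 : Matrix (Fin 2) (Fin 2) VA) 0 j + b * (1 : Matrix (Fin 2) (Fin 2) VA) 1 j := by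
    intro a b j
    rw [← e, ← e]
    noncomm_ring
  ext1 <;> refine Subtype.ext (Prod.ext ?_ rfl)
  · refine (key p.1.1.1 p.2.1.1 0).trans ?_
    rw [one_apply_eq, one_apply_ne (by decide), mul_one, mul_zero, add_zero]
  · refine (key p.1.1.1 p.2.1.1 1).trans ?_
    rw [one_apply_eq, one_apply_ne (by decide), mul_one, mul_zero, zero_add]

theorem exists_matrix_unitE (e : ZMod 3) : ∃ M N : Matrix (Fin 2) (Fin 2) VA, M * N = 1 ∧
    N * M = 1 ∧ abA (M 0 0) = (unitE e).1 ∧ abA (N 0 0) * (unitE e).1 = 1 ∧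
    (M.map abA 0 1 = 0 ∧ M.map abA 1 0 = 0 ∧ M.map abA 1 1 = 1) ∧
    (N.map abA 0 1 = 0 ∧ N.map abA 1 0 = 0 ∧ N.map abA 1 1 = 1) ∧
    M.map zaA = 1 ∧ N.map zaA = 1 := by
  let x : VA := ⟨0, 4, 4, 4⟩
  let y : VA := ⟨-4, 0, -4, 4⟩
  let M : Matrix (Fin 2) (Fin 2) VA := !![1, x; 0, 1] * !![1, 0; y, 1] * !![1, -x; 0, 1] * !![1, 0; -y, 1]
  let N : Matrix (Fin 2) (Fin 2) VA := !![1, 0; y, 1] * !![1, x; 0, 1] * !![1, 0; -y, 1] * !![1, -x; 0, 1]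
  have h : M * N = 1 ∧ N * M = 1 ∧ abA (M 0 0) = ⟨1, 1, 1, 1⟩ ∧ abA (N 0 0) * ⟨1, 1, 1, 1⟩ = 1 ∧
    (M.map abA 0 1 = 0 ∧ M.map abA 1 0 = 0 ∧ M.map abA 1 1 = 1) ∧
    (N.map abA 0 1 = 0 ∧ N.map abA 1 0 = 0 ∧ N.map abA 1 1 = 1) ∧
    M.map zaA = 1 ∧ N.map zaA = 1 := by
    decide +kernel
  have h' : abA (N 0 0) = ⟨1, 2, 2, 2⟩ ∧ abA (M 0 0) * ⟨1, 2, 2, 2⟩ = 1 := by decide +kernel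
  fin_cases e
  · refine ⟨1, 1, ?_⟩
    change _ ∧ _ ∧ abA ((1 : Matrix (Fin 2) (Fin 2) VA) 0 0) = ⟨1, 0, 0, 0⟩ ∧
      abA ((1 : Matrix (Fin 2) (Fin 2) VA) 0 0) * ⟨1, 0, 0, 0⟩ = 1 ∧ _
    decide +kernel
  · exact ⟨M, N, h⟩
  · exact ⟨N, M, h.2.1, h.1, h'.1, h'.2, h.2.2.2.2.2.1, h.2.2.2.2.1, h.2.2.2.2.2.2.2,
      h.2.2.2.2.2.2.1⟩

theorem nonempty_equiv_patch_unitE (e : ZMod 3) :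
    Nonempty ((patch (unitE e).1 × (Fin 1 → ZQ24)) ≃ₗ[ZQ24] (Fin (1 + 1) → ZQ24)) := by
  obtain ⟨M, N, hMN, hNM, h₀, k₀, h₁, k₁, h₂, k₂⟩ := exists_matrix_unitE e
  rw [← mul_one (abA (M 0 0))] at h₀
  obtain ⟨f⟩ := nonempty_equiv_patch_one
  have g : (patch (unitE e).1 × patch 1) ≃ₗ[ZQ24] (patch 1 × patch 1) :=
    LinearEquiv.ofBijective (patchMap M h₀ h₁ h₂)
      ⟨Function.LeftInverse.injective (g := patchMap N k₀ k₁ k₂)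
        (patchMap_patchMap hMN h₀ h₁ h₂ k₀ k₁ k₂),
      Function.RightInverse.surjective (g := patchMap N k₀ k₁ k₂)
        (patchMap_patchMap hNM k₀ k₁ k₂ h₀ h₁ h₂)⟩
  have f₁ : (Fin 1 → ZQ24) ≃ₗ[ZQ24] ZQ24 := LinearEquiv.funUnique (Fin 1) ZQ24 ZQ24
  exact ⟨((LinearEquiv.refl _ _).prodCongr (f₁.trans f)).trans
    (g.trans ((f.symm.prodCongr f.symm).trans (LinearEquiv.finTwoArrow ZQ24 ZQ24).symm))⟩

/-! ### The images of the units of `VA` and of `VB` in `EAB` -/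

/-- The image of the quaternion group of order eight. -/
def imageQ8 : List EAB := [1, ⟨0, 1, 0, 0⟩, ⟨0, 0, 1, 0⟩, ⟨0, 0, 0, 1⟩, -1, ⟨0, -1, 0, 0⟩,
  ⟨0, 0, -1, 0⟩, ⟨0, 0, 0, -1⟩]

theorem mem_imageQ8 {x : EAB} {f₀ f₁ f₂ f₃ : ℤ} (h₀ : 0 ≤ f₀) (h₁ : 0 ≤ f₁) (h₂ : 0 ≤ f₂)
    (h₃ : 0 ≤ f₃) (h : f₀ + f₁ + f₂ + f₃ = 1) (e₀ : x.re ^ 2 = f₀) (e₁ : x.imI ^ 2 = f₁)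
    (e₂ : x.imJ ^ 2 = f₂) (e₃ : x.imK ^ 2 = f₃) : x ∈ imageQ8 := by
  have key : ∀ x : EAB, ∀ t ∈ ([(1, 0, 0, 0), (0, 1, 0, 0), (0, 0, 1, 0), (0, 0, 0, 1)] :
      List (ZMod 3 × ZMod 3 × ZMod 3 × ZMod 3)), x.re ^ 2 = t.1 → x.imI ^ 2 = t.2.1 →
      x.imJ ^ 2 = t.2.2.1 → x.imK ^ 2 = t.2.2.2 → x ∈ imageQ8 := by
    decide +kernel
  refine key x (f₀, f₁, f₂, f₃) ?_ e₀ e₁ e₂ e₃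
  obtain ⟨rfl, rfl, rfl, rfl⟩ | ⟨rfl, rfl, rfl, rfl⟩ | ⟨rfl, rfl, rfl, rfl⟩ |
      ⟨rfl, rfl, rfl, rfl⟩ : f₀ = 1 ∧ f₁ = 0 ∧ f₂ = 0 ∧ f₃ = 0 ∨ f₀ = 0 ∧ f₁ = 1 ∧ f₂ = 0 ∧ f₃ = 0 ∨
      f₀ = 0 ∧ f₁ = 0 ∧ f₂ = 1 ∧ f₃ = 0 ∨ f₀ = 0 ∧ f₁ = 0 ∧ f₂ = 0 ∧ f₃ = 1 := by
    omega
  all_goals decide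

theorem abA_mem_imageQ8 {a : VA} (h : IsUnit a) : abA a ∈ imageQ8 := by
  obtain ⟨b, hb⟩ := h.exists_right_inv
  have h1 : normA a * normA b = 1 := by
    rw [← normA_mul, hb]
    decide
  have h2 : normA a = 1 := by
    have := Int.eq_one_or_neg_one_of_mul_eq_one h1
    have := normA_nonneg a
    omega
  rw [normA] at h2
  refine mem_imageQ8 (sq_nonneg _) (sq_nonneg _) (sq_nonneg _) (sq_nonneg _) h2 ?_ ?_ ?_ ?_ <;>
  · rw [abA_apply]
    push_cast
    rfl

theorem abB_mem_imageQ8_of_nrdB {b : VB} (h : nrdB b = 1) : abB b ∈ imageQ8 := by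
  have h1 := re_nrdB b
  rw [h, Fin.sum_univ_four] at h1
  refine mem_imageQ8 (eisForm_nonneg _ _) (eisForm_nonneg _ _) (eisForm_nonneg _ _)
    (eisForm_nonneg _ _) h1.symm ?_ ?_ ?_ ?_
  all_goals
    rw [abB_apply]
    simp only [eisCoord, eisForm, Matrix.cons_val]
    push_cast
    have h3 : (3 : ZMod 3) = 0 := by decide
  · linear_combination (-(b.imI.im : ZMod 3) ^ 2 - b.re.re * b.imI.im) * h3
  · linear_combination (-(b.re.im : ZMod 3) ^ 2 - b.re.im * b.imI.re) * h3
  · linear_combination (-(b.imK.im : ZMod 3) ^ 2 - b.imJ.re * b.imK.im) * h3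
  · linear_combination (-(b.imJ.im : ZMod 3) ^ 2 - b.imJ.im * b.imK.re) * h3

theorem exists_sqrt_of_pell {p q : ℤ} (hp : 0 < p) (h : p ^ 2 - 3 * q ^ 2 = 1)
    (h3 : (p : ZMod 3) = 1) : ∃ r s : ℤ, r ^ 2 - 3 * s ^ 2 = 1 ∧ r ^ 2 + 3 * s ^ 2 = p ∧
      2 * r * s = q := by
  obtain ⟨h4, h5⟩ := odd_even_of_pell hp h h3
  obtain ⟨t, rfl⟩ : (2 : ℤ) ∣ q := by
    have := (ZMod.intCast_zmod_eq_zero_iff_dvd q 2).1 h5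
    exact_mod_cast this
  obtain ⟨k, hk⟩ : (6 : ℤ) ∣ p - 1 := by
    have h6 : (3 : ℤ) ∣ p - 1 := by
      have := (ZMod.intCast_zmod_eq_zero_iff_dvd (p - 1) 3).1 (by simp [h3])
      exact_mod_cast this
    have h7 : (2 : ℤ) ∣ p - 1 := by
      have := (ZMod.intCast_zmod_eq_zero_iff_dvd (p - 1) 2).1 (by simp [h4])
      exact_mod_cast this
    omega
  obtain rfl : p = 6 * k + 1 := by linarith
  have ht : k * (3 * k + 1) = t ^ 2 := by linarith
  have hcop : IsCoprime k (3 * k + 1) := ⟨-3, 1, by ring⟩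
  have hk0 : 0 ≤ k := by omega
  obtain ⟨s, hs⟩ := Int.sq_of_isCoprime hcop ht
  obtain ⟨r, hr⟩ := Int.sq_of_isCoprime hcop.symm ((mul_comm _ _).trans ht)
  have hs : k = s ^ 2 := hs.elim id fun h => by linarith [sq_nonneg s]
  have hr : 3 * k + 1 = r ^ 2 := hr.resolve_right fun h => by nlinarith [sq_nonneg r]
  have hrs : (r * s) ^ 2 = t ^ 2 := by rw [mul_pow, ← hr, ← hs, ← ht]; ring
  rcases sq_eq_sq_iff_eq_or_eq_neg.1 hrs with h | h
  · exact ⟨r, s, by linarith, by linarith, by linarith⟩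
  · exact ⟨r, -s, by linarith, by linarith, by linarith⟩

theorem abB_mem_imageQ8 {b : VB} (h : IsUnit b) (h1 : abB b * star (abB b) = 1) :
    abB b ∈ imageQ8 := by
  obtain ⟨c, hc⟩ := h.exists_right_inv
  have hn : normB b * normB c = 1 := by rw [← map_mul, hc, map_one]
  have hn1 : normB b = 1 := by
    have := Int.eq_one_or_neg_one_of_mul_eq_one hn
    have := normB_nonneg b
    omega
  have hpq : (nrdB b).re ^ 2 - 3 * (nrdB b).im ^ 2 = 1 := by
    have h2 : QuadraticAlgebra.norm (nrdB b) = 1 := hn1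
    rw [QuadraticAlgebra.norm_def] at h2
    linarith
  have hp : 0 < (nrdB b).re := by
    have h2 : 0 ≤ (nrdB b).re := by
      rw [re_nrdB]
      exact Finset.sum_nonneg fun _ _ => eisForm_nonneg _ _
    refine h2.lt_of_ne fun h3 => ?_
    rw [← h3] at hpq
    nlinarith [sq_nonneg (nrdB b).im]
  have h3 : ((nrdB b).re : ZMod 3) = 1 := by
    have h2 := congrArg QuaternionAlgebra.re h1
    rw [abB_apply] at h2
    rw [nrdB_eq]
    simp only [pow_two]
    simp at h2 ⊢
    have h4 : (3 : ZMod 3) = 0 := by decide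
    linear_combination h2 + ((b.re.im : ZMod 3) ^ 2 + b.imI.re * b.re.im + b.imI.im * b.re.re + b.imI.im ^ 2 +
      b.imJ.im ^ 2 + b.imJ.re * b.imK.im + b.imJ.im * b.imK.re + b.imK.im ^ 2) * h4
  obtain ⟨r, s, e1, e2, e3⟩ := exists_sqrt_of_pell hp hpq h3
  have h5 : abB (b * ((⟨r, -s⟩ : RB) : VB)) ∈ imageQ8 := by
    apply abB_mem_imageQ8_of_nrdB
    rw [nrdB_mul]
    have h6 : nrdB ((⟨r, -s⟩ : RB) : VB) = ⟨r, -s⟩ ^ 2 := by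
      rw [nrdB_eq]
      simp
    have h7 : nrdB b = ⟨r, s⟩ ^ 2 := by
      rw [pow_two]
      ext
      · simp; linarith
      · simp; linarith
    have h8 : (⟨r, s⟩ * ⟨r, -s⟩ : RB) = 1 := by
      rw [show (1 : RB) = ⟨1, 0⟩ from rfl]
      ext
      · simp; linarith
      · simp; ring
    rw [h6, h7, ← mul_pow, h8, one_pow]
  rw [map_mul] at h5
  have h6 : abB ((⟨r, -s⟩ : RB) : VB) = 1 ∨ abB ((⟨r, -s⟩ : RB) : VB) = -1 := by
    have h7 : (r : ZMod 3) ^ 2 = 1 := by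
      have h8 := congrArg (Int.cast : ℤ → ZMod 3) e1
      push_cast at h8
      have h4 : (3 : ZMod 3) = 0 := by decide
      linear_combination h8 + (s : ZMod 3) ^ 2 * h4
    have h8 : abB ((⟨r, -s⟩ : RB) : VB) = ⟨(r : ZMod 3), 0, 0, 0⟩ := by
      rw [abB_apply]
      simp
    rw [h8]
    generalize (r : ZMod 3) = r at h7
    revert r
    decide +kernel
  have h7 : ∀ x : EAB, (x * 1 ∈ imageQ8 → x ∈ imageQ8) ∧ (x * -1 ∈ imageQ8 → x ∈ imageQ8) := by
    decide +kernel
  rcases h6 with h6 | h6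
  · rw [h6] at h5
    exact (h7 _).1 h5
  · rw [h6] at h5
    exact (h7 _).2 h5

theorem eq_of_unitE_mul {a : VA} {b : VB} (ha : IsUnit a) (hb : IsUnit b) {e e' : ZMod 3}
    (h : abA a * (unitE e').1 = (unitE e).1 * abB b) : e = e' := by
  have key : ∀ x ∈ imageQ8, ∀ e e' : ZMod 3, ∀ y : EAB, x * ⟨1, e', e', e'⟩ = ⟨1, e, e, e⟩ * y →
      y * star y = 1 := by
    decide +kernel
  have key' : ∀ x ∈ imageQ8, ∀ y ∈ imageQ8, ∀ e e' : ZMod 3,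
      x * ⟨1, e', e', e'⟩ = ⟨1, e, e, e⟩ * y → e = e' := by
    decide +kernel
  have ha' := abA_mem_imageQ8 ha
  exact key' _ ha' _ (abB_mem_imageQ8 hb (key _ ha' _ _ _ h)) _ _ h

/-! ### The patched modules are pairwise not isomorphic -/

theorem exists_pi_eq_six_A : ∃ r, piA r = 6 ∧ piB r = 0 ∧ piZ r = 0 ∧ piO r = 0 :=
  exists_of_matched (by decide +kernel) (by decide +kernel) (by decide +kernel) (by decide +kernel)

theorem exists_pi_eq_six_B : ∃ r, piA r = 0 ∧ piB r = 6 ∧ piZ r = 0 ∧ piO r = 0 :=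
  exists_of_matched (by decide +kernel) (by decide +kernel) (by decide +kernel) (by decide +kernel)

theorem six_mul_injective_A {x y : VA} (h : 6 * x = 6 * y) : x = y := by
  rw [show (6 : VA) = ((6 : ℤ) : VA) from rfl, ← zsmul_eq_mul, ← zsmul_eq_mul] at h
  have h' : ∀ m n : ℤ, 6 • m = 6 • n → m = n := fun m n => by simp
  exact QuaternionAlgebra.ext (h' _ _ (congrArg (·.re) h)) (h' _ _ (congrArg (·.imI) h))
    (h' _ _ (congrArg (·.imJ) h)) (h' _ _ (congrArg (·.imK) h))

theorem six_mul_injective_B {x y : VB} (h : 6 * x = 6 * y) : x = y := by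
  rw [show (6 : VB) = ((6 : ℤ) : VB) from rfl, ← zsmul_eq_mul, ← zsmul_eq_mul] at h
  have h' : ∀ m n : ℤ, 6 • m = 6 • n → m = n := fun m n => by simp
  have h'' : ∀ m n : RB, (6 : ℤ) • m = (6 : ℤ) • n → m = n := fun m n hm =>
    QuadraticAlgebra.ext (h' _ _ (congrArg (·.re) hm)) (h' _ _ (congrArg (·.im) hm))
  exact QuaternionAlgebra.ext (h'' _ _ (congrArg (·.re) h)) (h'' _ _ (congrArg (·.imI) h))
    (h'' _ _ (congrArg (·.imJ) h)) (h'' _ _ (congrArg (·.imK) h))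

section
variable {u v : EAB}

theorem map_fst_eq (ψ : patch u →ₗ[ZQ24] patch v) {p q : patch u} (hq : q.1.1 = 1) :
    (ψ p).1.1 = p.1.1 * (ψ q).1.1 := by
  obtain ⟨r, rA, rB, rZ, rO⟩ := exists_pi_eq_six_A
  have h : (secA p.1.1 * r) • q = r • p := by
    refine Subtype.ext ?_
    change (secA p.1.1 * r) • q.1 = r • p.1
    rw [smul_def, smul_def]
    simp only [map_mul, piA_secA, rA, rB, rZ, rO, hq, mul_one, mul_zero, zero_mul]
    rw [Commute.ofNat_left 6 p.1.1]
  have h2 : (secA p.1.1 * r) • ψ q = r • ψ p := by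
    rw [← map_smul, h, map_smul]
  have h3 : piA (secA p.1.1 * r) * (ψ q).1.1 = piA r * (ψ p).1.1 :=
    congrArg (fun x => x.1.1) h2
  rw [map_mul, piA_secA, rA, ← Commute.ofNat_left 6 p.1.1, mul_assoc] at h3
  exact (six_mul_injective_A h3).symm

theorem map_snd_eq (ψ : patch u →ₗ[ZQ24] patch v) {p q : patch u} (hq : q.1.2.1 = 1) :
    (ψ p).1.2.1 = p.1.2.1 * (ψ q).1.2.1 := by
  obtain ⟨r, rA, rB, rZ, rO⟩ := exists_pi_eq_six_B
  have h : (secB p.1.2.1 * r) • q = r • p := by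
    refine Subtype.ext ?_
    change (secB p.1.2.1 * r) • q.1 = r • p.1
    rw [smul_def, smul_def]
    simp only [map_mul, piB_secB, rA, rB, rZ, rO, hq, mul_one, mul_zero, zero_mul]
    rw [Commute.ofNat_left 6 p.1.2.1]
  have h2 : (secB p.1.2.1 * r) • ψ q = r • ψ p := by
    rw [← map_smul, h, map_smul]
  have h3 : piB (secB p.1.2.1 * r) * (ψ q).1.2.1 = piB r * (ψ p).1.2.1 :=
    congrArg (fun x => x.1.2.1) h2
  rw [map_mul, piB_secB, rB, ← Commute.ofNat_left 6 p.1.2.1, mul_assoc] at h3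
  exact (six_mul_injective_B h3).symm

theorem isUnit_map_fst (ψ : patch u ≃ₗ[ZQ24] patch v) {p : patch u} {q : patch v}
    (hp : p.1.1 = 1) (hq : q.1.1 = 1) : IsUnit (ψ p).1.1 := by
  have h1 := map_fst_eq ψ.symm.toLinearMap (p := ψ p) hq
  have h2 := map_fst_eq ψ.toLinearMap (p := ψ.symm q) hp
  rw [LinearEquiv.coe_coe, LinearEquiv.symm_apply_apply, hp] at h1
  rw [LinearEquiv.coe_coe, LinearEquiv.apply_symm_apply, hq] at h2
  exact ⟨⟨_, _, h1.symm, h2.symm⟩, rfl⟩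

theorem isUnit_map_snd (ψ : patch u ≃ₗ[ZQ24] patch v) {p : patch u} {q : patch v}
    (hp : p.1.2.1 = 1) (hq : q.1.2.1 = 1) : IsUnit (ψ p).1.2.1 := by
  have h1 := map_snd_eq ψ.symm.toLinearMap (p := ψ p) hq
  have h2 := map_snd_eq ψ.toLinearMap (p := ψ.symm q) hp
  rw [LinearEquiv.coe_coe, LinearEquiv.symm_apply_apply, hp] at h1
  rw [LinearEquiv.coe_coe, LinearEquiv.apply_symm_apply, hq] at h2
  exact ⟨⟨_, _, h1.symm, h2.symm⟩, rfl⟩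

end

theorem exists_fst_eq_one (e : ZMod 3) : ∃ p : patch (unitE e).1, p.1.1 = 1 := by
  obtain ⟨b, h1, h2⟩ : ∃ b : VB, abB b = (unitE e).1 ∧ boB b = 1 := by
    have h : ∀ e : ZMod 3, abB ⟨1, 4 * (e.val : RB), 4 * (e.val : RB), 4 * (e.val : RB)⟩ =
        ⟨1, e, e, e⟩ ∧ boB ⟨1, 4 * (e.val : RB), 4 * (e.val : RB), 4 * (e.val : RB)⟩ = 1 := by
      decide +kernel
    exact ⟨_, h e⟩
  exact ⟨⟨(1, b, 1, 1), mem_patch.2 (by simp only [h1, h2, map_one, one_mul, and_self])⟩, rfl⟩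

theorem exists_snd_eq_one (e : ZMod 3) : ∃ p : patch (unitE e).1, p.1.2.1 = 1 := by
  obtain ⟨a, h1, h2⟩ : ∃ a : VA, abA a * (unitE e).1 = 1 ∧ zaA a = 1 := by
    have h : ∀ e : ZMod 3, abA ⟨1, -4 * (e.val : ℤ), -4 * (e.val : ℤ), -4 * (e.val : ℤ)⟩ *
        ⟨1, e, e, e⟩ = 1 ∧ zaA ⟨1, -4 * (e.val : ℤ), -4 * (e.val : ℤ), -4 * (e.val : ℤ)⟩ = 1 := by
      decide +kernel
    exact ⟨_, h e⟩
  exact ⟨⟨(a, 1, 1, 1), mem_patch.2 (by simp only [h1, h2, map_one, and_self])⟩, rfl⟩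

theorem eq_of_patch_equiv {e e' : ZMod 3}
    (ψ : patch (unitE e).1 ≃ₗ[ZQ24] patch (unitE e').1) : e = e' := by
  obtain ⟨p, hp⟩ := exists_fst_eq_one e
  obtain ⟨p', hp'⟩ := exists_fst_eq_one e'
  obtain ⟨q, hq⟩ := exists_snd_eq_one e
  obtain ⟨q', hq'⟩ := exists_snd_eq_one e'
  have h1 : abA p.1.1 * (unitE e).1 = abB p.1.2.1 := p.2.1
  have h2 : abA (ψ p).1.1 * (unitE e').1 = abB (ψ p).1.2.1 := (ψ p).2.1
  have h3 : (ψ p).1.2.1 = p.1.2.1 * (ψ q).1.2.1 := map_snd_eq ψ.toLinearMap hq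
  rw [h3, map_mul, ← h1, hp, map_one, one_mul] at h2
  exact eq_of_unitE_mul (isUnit_map_fst ψ hp hp') (isUnit_map_snd ψ hq hq') h2

/-- The isomorphism class of a patched module. -/
def patchClass (e : ZMod 3) :
    Quot (fun (P Q : {P : ModuleCat.{0} ZQ24 // IsStablyFreeOfRankOne P}) =>
      Nonempty (↥P.1 ≃ₗ[ZQ24] ↥Q.1)) :=
  Quot.mk _ ⟨ModuleCat.of ZQ24 (patch (unitE e).1), 1, nonempty_equiv_patch_unitE e⟩

theorem patchClass_bijective : Function.Bijective patchClass := by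
  refine ⟨fun e e' h => ?_, ?_⟩
  · have hr : Equivalence (fun (P Q : {P : ModuleCat.{0} ZQ24 // IsStablyFreeOfRankOne P}) =>
        Nonempty (↥P.1 ≃ₗ[ZQ24] ↥Q.1)) :=
      ⟨fun _ => ⟨.refl _ _⟩, fun ⟨f⟩ => ⟨f.symm⟩, fun ⟨f⟩ ⟨g⟩ => ⟨f.trans g⟩⟩
    obtain ⟨ψ⟩ := hr.eqvGen_iff.1 (Quot.eqvGen_exact h)
    exact eq_of_patch_equiv ψ
  · rintro ⟨P, a, ⟨φ⟩⟩
    obtain ⟨e, ⟨f⟩⟩ := exists_equiv_patch φ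
    exact ⟨e, Quot.sound ⟨f.symm⟩⟩

end SwanQ24

/-- There are exactly 3 isomorphism classes of stably free rank one `ℤQ₂₄`-modules:
the quotient of the type of stably free rank one modules by the isomorphism relation
has exactly three elements. -/
theorem card_stablyFree_rank_one_ZQ24_eq_three :
    Nat.card (Quot (fun (P Q : {P : ModuleCat.{0} ZQ24 // IsStablyFreeOfRankOne P}) =>
      Nonempty (↥P.1 ≃ₗ[ZQ24] ↥Q.1))) = 3 := by
  rw [← Nat.card_eq_of_bijective _ SwanQ24.patchClass_bijective, Nat.card_zmod]

end
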